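/- arXiv:math/0602443 — 4 statements merged into one kernel-verified Lean document; each statement's English description precedes it below -/
import Mathlib

section
/- Let τ ∈ ℂ with Im τ > 0 and let L = {m + n·τ : m, n ∈ ℤ}. Let U ⊆ ℂ be a nonempty open set with U + ω = U for every ω ∈ L, such that for all z, w ∈ U there exists ω ∈ L with z and w + ω lying in the same connected component of U, and such that every connected component of ℂ ∖ U has nonempty interior. Then there exist holomorphic L-periodic functions f, g : U → ℂ such that for every holomorphic L-periodic function h : U → ℂ, every compact set K ⊆ U, and every ε > 0, there exists a complex polynomial P in two variables with |h(z) − P(f(z), g(z))| < ε for all z ∈ K. -/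
open Complex Set

open Polynomial Lagrange in
theorem nodal_eq_nodal_add_sum (S : Finset ℕ) (a b : ℕ → ℂ) (ha : Function.Injective a) :
    nodal S b = nodal S a + ∑ j ∈ S, C ((nodal S b).eval (a j) / (nodal (S.erase j) a).eval (a j)) *
      nodal (S.erase j) a := by
  have hinj : Set.InjOn a S := ha.injOn
  rw [← sub_eq_iff_eq_add']
  have hcard : ∀ j ∈ S, (nodal (S.erase j) a).degree < S.card := by
    intro j hj
    rw [degree_nodal]
    exact_mod_cast Finset.card_erase_lt_of_mem hj
  refine eq_of_degrees_lt_of_eval_index_eq S hinj ?_ ?_ ?_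
  · calc (nodal S b - nodal S a).degree < (nodal S b).degree :=
        degree_sub_lt_left (by simp [degree_nodal]) nodal_ne_zero
          (by rw [nodal_monic.leadingCoeff, nodal_monic.leadingCoeff])
      _ = S.card := degree_nodal
  · refine (degree_sum_le _ _).trans_lt ?_
    rw [Finset.sup_lt_iff (WithBot.bot_lt_coe _)]
    intro j hj
    rw [← smul_eq_C_mul]; exact (degree_smul_le _ _).trans_lt (hcard j hj)
  · intro i hi
    rw [eval_sub, eval_nodal_at_node hi, sub_zero, eval_finsetSum, Finset.sum_eq_single i]
    · rw [eval_mul, eval_C, div_mul_cancel₀]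
      refine eval_nodal_not_at_node fun j hj h => ?_
      exact (Finset.mem_erase.1 hj).1 (ha h).symm
    · intro j _ hji
      rw [eval_mul, eval_nodal_at_node (Finset.mem_erase.2 ⟨hji.symm, hi⟩), mul_zero]
    · exact fun h => absurd hi h

/-- Elements `x`, `y` with `y ^ 2 = P x` together with elements `k j` behaving like
`(y + v j) / (x - a j)`. -/
structure PoleSystem (E : Type*) [CommRing E] [Algebra ℂ E] where
  x : E
  y : E
  P : Polynomial ℂ
  k : ℕ → E
  a : ℕ → ℂ
  v : ℕ → ℂ
  y_sq : y ^ 2 = Polynomial.aeval x P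
  rel : ∀ j, (x - algebraMap ℂ E (a j)) * k j = y + algebraMap ℂ E (v j)
  v_sq : ∀ j, v j ^ 2 = P.eval (a j)
  v_ne : ∀ j, v j ≠ 0
  a_inj : Function.Injective a

namespace PoleSystem

open Polynomial Lagrange

section Algebra

variable {E : Type*} [CommRing E] [Algebra ℂ E] (Q : PoleSystem E)

/-- The residue at the `j`-th pole of the rational function `∏ i ∈ S, (X - b i) / (X - a i)`. -/
noncomputable def coef (S : Finset ℕ) (b : ℕ → ℂ) (j : ℕ) : ℂ :=
  (nodal S b).eval (Q.a j) / (nodal (S.erase j) Q.a).eval (Q.a j)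

/-- The perturbation of `y` whose odd part is `y * ∏ i ∈ S, (x - b i) / (x - a i)`. -/
noncomputable def gen (S : Finset ℕ) (b : ℕ → ℂ) : E :=
  Q.y + ∑ j ∈ S, Q.coef S b j • Q.k j

theorem nodal_mul_k {T : Finset ℕ} {j : ℕ} (hj : j ∈ T) :
    aeval Q.x (nodal T Q.a) * Q.k j =
      aeval Q.x (nodal (T.erase j) Q.a) * (Q.y + algebraMap ℂ E (Q.v j)) := by
  rw [nodal_eq_mul_nodal_erase hj, ← Q.rel j]
  simp only [map_mul, map_sub, aeval_X, aeval_C]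
  ring

theorem nodal_mul_gen (S : Finset ℕ) (b : ℕ → ℂ) :
    ∃ q : ℂ[X], aeval Q.x (nodal S Q.a) * Q.gen S b =
      aeval Q.x (nodal S b) * Q.y + aeval Q.x q := by
  refine ⟨∑ j ∈ S, C (Q.coef S b j * Q.v j) * nodal (S.erase j) Q.a, ?_⟩
  conv_rhs => rw [nodal_eq_nodal_add_sum S Q.a b Q.a_inj]
  rw [gen, mul_add, Finset.mul_sum]
  have : ∀ j ∈ S, aeval Q.x (nodal S Q.a) * (Q.coef S b j • Q.k j) =
      aeval Q.x (C (Q.coef S b j) * nodal (S.erase j) Q.a) * Q.y +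
      aeval Q.x (C (Q.coef S b j * Q.v j) * nodal (S.erase j) Q.a) := by
    intro j hj
    rw [mul_smul_comm, Q.nodal_mul_k hj, Algebra.smul_def]
    simp only [map_mul, aeval_C]
    ring
  rw [Finset.sum_congr rfl this, Finset.sum_add_distrib, ← Finset.sum_mul]
  simp only [map_add, map_sum, coef]
  ring

theorem nodal_erase_mul_gen (S : Finset ℕ) (b : ℕ → ℂ) {j : ℕ} (hj : j ∈ S) :
    ∃ u w : ℂ[X], aeval Q.x (nodal (S.erase j) Q.a) * Q.gen S b =
      Q.coef S b j • (aeval Q.x (nodal (S.erase j) Q.a) * Q.k j) +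
        aeval Q.x u + aeval Q.x w * Q.y := by
  refine ⟨∑ i ∈ S.erase j, C (Q.coef S b i * Q.v i) * nodal ((S.erase j).erase i) Q.a,
    nodal (S.erase j) Q.a +
      ∑ i ∈ S.erase j, C (Q.coef S b i) * nodal ((S.erase j).erase i) Q.a, ?_⟩
  rw [gen, ← Finset.add_sum_erase S _ hj, mul_add, mul_add, Finset.mul_sum]
  have : ∀ i ∈ S.erase j, aeval Q.x (nodal (S.erase j) Q.a) * (Q.coef S b i • Q.k i) =
      aeval Q.x (C (Q.coef S b i * Q.v i) * nodal ((S.erase j).erase i) Q.a) +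
      aeval Q.x (C (Q.coef S b i) * nodal ((S.erase j).erase i) Q.a) * Q.y := by
    intro i hi
    rw [mul_smul_comm, Q.nodal_mul_k hi, Algebra.smul_def]
    simp only [map_mul, aeval_C]
    ring
  rw [Finset.sum_congr rfl this, Finset.sum_add_distrib, ← Finset.sum_mul]
  simp only [map_add, map_sum, mul_smul_comm]
  ring

theorem coef_ne_zero {S : Finset ℕ} {b : ℕ → ℂ} {j : ℕ}
    (hb : ∀ i ∈ S, b i ≠ Q.a j) : Q.coef S b j ≠ 0 := by
  refine div_ne_zero (eval_nodal_not_at_node fun i hi => (hb i hi).symm)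
    (eval_nodal_not_at_node fun i hi h => ?_)
  exact (Finset.mem_erase.1 hi).1 (Q.a_inj h).symm

variable {Q}

/-- A subalgebra of `E` contains an element as soon as it contains its products with two coprime
polynomials in `x`. -/
theorem mem_of_nodal_mul_mem {B : Submodule ℂ E} (hB : ∀ p : ℂ[X], ∀ F ∈ B, aeval Q.x p * F ∈ B)
    {S : Finset ℕ} {j : ℕ} {F : E} (h₁ : aeval Q.x (nodal (S.erase j) Q.a) * F ∈ B)
    (h₂ : (Q.x - algebraMap ℂ E (Q.a j)) * F ∈ B) : F ∈ B := by
  obtain ⟨w, hw⟩ := X_sub_C_dvd_sub_C_eval (a := Q.a j) (p := nodal (S.erase j) Q.a)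
  set c := (nodal (S.erase j) Q.a).eval (Q.a j) with hc
  have hc0 : c ≠ 0 := by
    refine eval_nodal_not_at_node fun i hi h => ?_
    exact (Finset.mem_erase.1 hi).1 (Q.a_inj h).symm
  have h := congrArg (aeval Q.x) hw
  simp only [map_sub, map_mul, aeval_X, aeval_C] at h
  have key : c • F ∈ B := by
    have : c • F = aeval Q.x (nodal (S.erase j) Q.a) * F -
        aeval Q.x w * ((Q.x - algebraMap ℂ E (Q.a j)) * F) := by
      rw [Algebra.smul_def]
      linear_combination (-F) * h
    rw [this]
    exact B.sub_mem h₁ (hB _ _ h₂)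
  exact (B.smul_mem_iff hc0).1 key

theorem aeval_mem {B : Subalgebra ℂ E} (hx : Q.x ∈ B) (p : ℂ[X]) : aeval Q.x p ∈ B :=
  (Algebra.adjoin_le (Set.singleton_subset_iff.2 hx) : Algebra.adjoin ℂ {Q.x} ≤ B)
    (aeval_mem_adjoin_singleton ℂ Q.x)

variable {S : Finset ℕ} {b : ℕ → ℂ} {B : Subalgebra ℂ E}

/-- The elements whose product with `∏ i ∈ S, (x - b i)` lies in `B`. -/
noncomputable def conductor (Q : PoleSystem E) (S : Finset ℕ) (b : ℕ → ℂ) (B : Subalgebra ℂ E) :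
    Submodule ℂ E :=
  (Subalgebra.toSubmodule B).comap (LinearMap.mulLeft ℂ (aeval Q.x (nodal S b)))

theorem mem_conductor {F : E} : F ∈ Q.conductor S b B ↔ aeval Q.x (nodal S b) * F ∈ B := Iff.rfl

theorem mul_mem_conductor {u F : E} (hu : u ∈ B) (hF : F ∈ Q.conductor S b B) :
    u * F ∈ Q.conductor S b B := by
  rw [mem_conductor] at *
  rw [mul_left_comm]
  exact B.mul_mem hu hF

theorem k_pow_mem_conductor (hx : Q.x ∈ B) (hg : Q.gen S b ∈ B) {j : ℕ} (hj : j ∈ S)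
    (hb : ∀ i ∈ S, b i ≠ Q.a j) (m : ℕ) :
    Q.k j ^ m ∈ Q.conductor S b B ∧ Q.y * Q.k j ^ m ∈ Q.conductor S b B := by
  have hp := aeval_mem (Q := Q) hx
  have hM : ∀ p : ℂ[X], ∀ F ∈ Q.conductor S b B, aeval Q.x p * F ∈ Q.conductor S b B :=
    fun p F hF => mul_mem_conductor (hp p) hF
  have hc := Q.coef_ne_zero hb
  induction m with
  | zero =>
    simp only [pow_zero, mul_one, mem_conductor]
    refine ⟨hp _, ?_⟩
    obtain ⟨q, hq⟩ := Q.nodal_mul_gen S b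
    rw [← sub_eq_iff_eq_add.2 hq]
    exact B.sub_mem (B.mul_mem (hp _) hg) (hp _)
  | succ m ih =>
    obtain ⟨u, w, h⟩ := Q.nodal_erase_mul_gen S b hj
    set p := aeval Q.x (nodal (S.erase j) Q.a) with hpdef
    have hgp : p * Q.gen S b ∈ B := B.mul_mem (hp _) hg
    have hrel := Q.rel j
    have hpm : p ∈ B := hp _
    have hysq := Q.y_sq
    constructor
    · refine mem_of_nodal_mul_mem hM (S := S) (j := j) ?_ ?_
      · rw [← hpdef, ← Submodule.smul_mem_iff _ hc]
        have : Q.coef S b j • (p * Q.k j ^ (m + 1)) = (p * Q.gen S b) * Q.k j ^ m -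
            aeval Q.x u * Q.k j ^ m - aeval Q.x w * (Q.y * Q.k j ^ m) := by
          rw [h]; simp only [Algebra.smul_def]; ring
        rw [this]
        exact Submodule.sub_mem _ (Submodule.sub_mem _ (mul_mem_conductor hgp ih.1) (hM _ _ ih.1))
          (hM _ _ ih.2)
      · have : (Q.x - algebraMap ℂ E (Q.a j)) * Q.k j ^ (m + 1) =
            Q.y * Q.k j ^ m + Q.v j • Q.k j ^ m := by
          rw [Algebra.smul_def, pow_succ]; linear_combination (Q.k j ^ m) * hrel
        rw [this]
        exact Submodule.add_mem _ ih.2 (Submodule.smul_mem _ _ ih.1)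
    · refine mem_of_nodal_mul_mem hM (S := S) (j := j) ?_ ?_
      · rw [← hpdef, ← Submodule.smul_mem_iff _ hc]
        have : Q.coef S b j • (p * (Q.y * Q.k j ^ (m + 1))) =
            (p * Q.gen S b) * (Q.y * Q.k j ^ m) - aeval Q.x u * (Q.y * Q.k j ^ m) -
              aeval Q.x w * (aeval Q.x Q.P * Q.k j ^ m) := by
          rw [h, ← hysq]; simp only [Algebra.smul_def]; ring
        rw [this]
        exact Submodule.sub_mem _ (Submodule.sub_mem _ (mul_mem_conductor hgp ih.2) (hM _ _ ih.2))
          (hM _ _ (hM _ _ ih.1))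
      · have : (Q.x - algebraMap ℂ E (Q.a j)) * (Q.y * Q.k j ^ (m + 1)) =
            aeval Q.x Q.P * Q.k j ^ m + Q.v j • (Q.y * Q.k j ^ m) := by
          rw [Algebra.smul_def, pow_succ, ← hysq]; linear_combination (Q.y * Q.k j ^ m) * hrel
        rw [this]
        exact Submodule.add_mem _ (hM _ _ ih.1) (Submodule.smul_mem _ _ ih.2)

/-- The elements all of whose products with the monomials `y ^ e * k j ^ m` lie in the conductor. -/
noncomputable def stableConductor (Q : PoleSystem E) (S : Finset ℕ) (b : ℕ → ℂ)
    (B : Subalgebra ℂ E) (j : ℕ) :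
    Submodule ℂ E where
  carrier := {F | ∀ m : ℕ, Q.k j ^ m * F ∈ Q.conductor S b B ∧
    Q.y * Q.k j ^ m * F ∈ Q.conductor S b B}
  add_mem' := fun hF hG m => by
    rw [mul_add, mul_add]
    exact ⟨Submodule.add_mem _ (hF m).1 (hG m).1, Submodule.add_mem _ (hF m).2 (hG m).2⟩
  zero_mem' := fun m => by simp
  smul_mem' := fun c F hF m => by
    rw [mul_smul_comm, mul_smul_comm]
    exact ⟨Submodule.smul_mem _ _ (hF m).1, Submodule.smul_mem _ _ (hF m).2⟩

theorem k_pow_decomposition (hx : Q.x ∈ B) (hg : Q.gen S b ∈ B) {j : ℕ} (hj : j ∈ S)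
    (hb : ∀ i ∈ S, b i ≠ Q.a j) {w : ℂ} (hw : w ^ 2 = Q.P.eval (b j)) (hw0 : w ≠ 0) (n : ℕ) :
    ∃ G ∈ Q.stableConductor S b B j, Q.k j ^ n =
      algebraMap ℂ E ((((Q.v j + w) / (b j - Q.a j)) ^ n +
        ((Q.v j - w) / (b j - Q.a j)) ^ n) / 2) +
      algebraMap ℂ E ((((Q.v j + w) / (b j - Q.a j)) ^ n -
        ((Q.v j - w) / (b j - Q.a j)) ^ n) / (2 * w)) * Q.y +
      (Q.x - algebraMap ℂ E (b j)) * G := by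
  have hp := aeval_mem (Q := Q) hx
  set N := Q.stableConductor S b B j with hN
  have hNk : ∀ F ∈ N, Q.k j * F ∈ N := fun F hF m => by
    have := hF (m + 1)
    rw [pow_succ] at this
    rw [← mul_assoc, ← mul_assoc, mul_assoc Q.y]
    exact this
  have hNx : ∀ p : ℂ[X], ∀ F ∈ N, aeval Q.x p * F ∈ N := fun p F hF m => by
    rw [mul_left_comm, mul_left_comm (Q.y * Q.k j ^ m)]
    exact ⟨mul_mem_conductor (hp _) (hF m).1, mul_mem_conductor (hp _) (hF m).2⟩
  have hNy : ∀ F ∈ N, Q.y * F ∈ N := fun F hF m => by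
    constructor
    · have : Q.k j ^ m * (Q.y * F) = Q.y * Q.k j ^ m * F := by ring
      rw [this]; exact (hF m).2
    · have : Q.y * Q.k j ^ m * (Q.y * F) = aeval Q.x Q.P * (Q.k j ^ m * F) := by
        rw [← Q.y_sq]; ring
      rw [this]; exact mul_mem_conductor (hp _) (hF m).1
  have hN1 : (1 : E) ∈ N := fun m => by
    simpa using k_pow_mem_conductor hx hg hj hb m
  have hd : b j - Q.a j ≠ 0 := sub_ne_zero.2 (hb j hj)
  set d := b j - Q.a j with hddef
  obtain ⟨Pt, hPt⟩ := X_sub_C_dvd_sub_C_eval (a := b j) (p := Q.P)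
  have hP := congrArg (aeval Q.x) hPt
  simp only [map_sub, map_mul, aeval_X, aeval_C] at hP
  rw [← hw, ← Q.y_sq] at hP
  have hk : Q.k j = algebraMap ℂ E d⁻¹ * (Q.y + algebraMap ℂ E (Q.v j)) -
      (Q.x - algebraMap ℂ E (b j)) * (algebraMap ℂ E d⁻¹ * Q.k j) := by
    have h1 : algebraMap ℂ E d⁻¹ * algebraMap ℂ E d = 1 := by
      rw [← map_mul, inv_mul_cancel₀ hd, map_one]
    have h2 : algebraMap ℂ E d = algebraMap ℂ E (b j) - algebraMap ℂ E (Q.a j) := by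
      rw [hddef, map_sub]
    linear_combination (algebraMap ℂ E d⁻¹) * (Q.rel j) - Q.k j * h1 +
      algebraMap ℂ E d⁻¹ * Q.k j * h2
  induction n with
  | zero => exact ⟨0, N.zero_mem, by simp⟩
  | succ n ih =>
    obtain ⟨G, hG, hGe⟩ := ih
    set α := (((Q.v j + w) / d) ^ n + ((Q.v j - w) / d) ^ n) / 2 with hα
    set β := (((Q.v j + w) / d) ^ n - ((Q.v j - w) / d) ^ n) / (2 * w) with hβ
    have e1 : (((Q.v j + w) / d) ^ (n + 1) + ((Q.v j - w) / d) ^ (n + 1)) / 2 =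
        d⁻¹ * (Q.v j * α + β * w ^ 2) := by
      rw [hα, hβ, pow_succ, pow_succ]
      generalize ((Q.v j + w) / d) ^ n = s
      generalize ((Q.v j - w) / d) ^ n = t
      field_simp; ring
    have e2 : (((Q.v j + w) / d) ^ (n + 1) - ((Q.v j - w) / d) ^ (n + 1)) / (2 * w) =
        d⁻¹ * (α + β * Q.v j) := by
      rw [hα, hβ, pow_succ, pow_succ]
      generalize ((Q.v j + w) / d) ^ n = s
      generalize ((Q.v j - w) / d) ^ n = t
      field_simp; ring
    refine ⟨Q.k j * G + (d⁻¹ * β) • (aeval Q.x Pt * 1) - (d⁻¹ * α) • (Q.k j * 1) -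
      (d⁻¹ * β) • (Q.k j * (Q.y * 1)), ?_, ?_⟩
    · exact N.sub_mem (N.sub_mem (N.add_mem (hNk _ hG) (N.smul_mem _ (hNx _ _ hN1)))
        (N.smul_mem _ (hNk _ hN1))) (N.smul_mem _ (hNk _ (hNy _ hN1)))
    · rw [e1, e2, pow_succ, hGe]
      simp only [Algebra.smul_def, map_mul, map_add, map_pow] at hP ⊢
      linear_combination (algebraMap ℂ E α + algebraMap ℂ E β * Q.y) * hk +
        (algebraMap ℂ E d⁻¹ * algebraMap ℂ E β) * hP

end Algebra

section Finite

open Filter Topology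

variable {E : Type*} [NormedCommRing E] [NormedAlgebra ℂ E] {Q : PoleSystem E}

theorem tendsto_inv_smul_pow {k : E} {l m w : ℂ} (hw : w ≠ 0) (hm : ‖m‖ < ‖l‖) (hk : ‖k‖ < ‖l‖) :
    (∀ᶠ n : ℕ in atTop, (l ^ n - m ^ n) / (2 * w) ≠ 0) ∧
    Tendsto (fun n : ℕ => ((l ^ n - m ^ n) / (2 * w))⁻¹ • k ^ n) atTop (𝓝 0) := by
  have hl : 0 < ‖l‖ := (norm_nonneg m).trans_lt hm
  have hl0 : l ≠ 0 := norm_pos_iff.1 hl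
  have hw2 : (2 * w) ≠ 0 := mul_ne_zero two_ne_zero hw
  have h1 : Tendsto (fun n : ℕ => 1 - (m / l) ^ n) atTop (𝓝 (1 - 0)) := by
    refine tendsto_const_nhds.sub (tendsto_pow_atTop_nhds_zero_of_norm_lt_one ?_)
    rw [norm_div, div_lt_one hl]; exact hm
  have h2 : ∀ n : ℕ, (l ^ n - m ^ n) / (2 * w) = l ^ n * (1 - (m / l) ^ n) / (2 * w) := fun n => by
    rw [mul_sub, mul_one, ← mul_pow, mul_div_cancel₀ _ hl0]
  simp_rw [h2]
  have h3 : ∀ᶠ n : ℕ in atTop, 1 - (m / l) ^ n ≠ 0 :=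
    h1.eventually_ne (by simp)
  refine ⟨h3.mono fun n hn => div_ne_zero (mul_ne_zero (pow_ne_zero _ hl0) hn) hw2, ?_⟩
  have h4 : Tendsto (fun n : ℕ => (‖k‖ / ‖l‖) ^ n) atTop (𝓝 0) :=
    tendsto_pow_atTop_nhds_zero_of_lt_one (by positivity) ((div_lt_one hl).2 hk)
  have h5 : Tendsto (fun n : ℕ => ‖2 * w‖ * (‖k‖ / ‖l‖) ^ n * ‖1 - (m / l) ^ n‖⁻¹) atTop
      (𝓝 (‖2 * w‖ * 0 * ‖(1 - 0 : ℂ)‖⁻¹)) :=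
    (h4.const_mul _).mul (h1.norm.inv₀ (by simp))
  rw [mul_zero, zero_mul] at h5
  refine squeeze_zero_norm' ?_ h5
  filter_upwards [eventually_gt_atTop 0] with n hn
  rw [norm_smul]
  calc _ ≤ ‖(l ^ n * (1 - (m / l) ^ n) / (2 * w))⁻¹‖ * ‖k‖ ^ n := by
        gcongr; exact norm_pow_le' _ hn
    _ = _ := by
        generalize 1 - (m / l) ^ n = s
        rw [norm_inv, norm_div, norm_mul, norm_pow, div_pow, inv_div]
        simp only [div_eq_mul_inv, mul_inv]
        ring

variable {S : Finset ℕ} {b : ℕ → ℂ} {B : Subalgebra ℂ E}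

/-- The condition under which a closed subalgebra containing `x` and `gen S b` contains `y` and the
`k j`, `j ∈ S`. -/
structure IsClose (Q : PoleSystem E) (S : Finset ℕ) (b : ℕ → ℂ) : Prop where
  ne : ∀ i ∈ S, ∀ j, b i ≠ Q.a j
  inj : Set.InjOn b S
  root : ∀ j ∈ S, ∃ w : ℂ, w ^ 2 = Q.P.eval (b j) ∧ w ≠ 0 ∧ ‖Q.v j - w‖ < ‖Q.v j + w‖ ∧
    ‖Q.k j‖ * ‖b j - Q.a j‖ < ‖Q.v j + w‖

theorem IsClose.nodal_erase_mul_y_mem (h : Q.IsClose S b) (hB : IsClosed (B : Set E))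
    (hx : Q.x ∈ B) (hg : Q.gen S b ∈ B) {j : ℕ} (hj : j ∈ S) :
    aeval Q.x (nodal (S.erase j) b) * Q.y ∈ B := by
  obtain ⟨w, hw, hw0, h1, h2⟩ := h.root j hj
  have hd : 0 < ‖b j - Q.a j‖ := norm_pos_iff.2 (sub_ne_zero.2 (h.ne j hj j))
  have hd0 := norm_pos_iff.1 hd
  obtain ⟨e1, e2⟩ := tendsto_inv_smul_pow (k := Q.k j) (l := (Q.v j + w) / (b j - Q.a j))
    (m := (Q.v j - w) / (b j - Q.a j)) hw0 (by rw [norm_div, norm_div]; gcongr)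
    (by rwa [norm_div, lt_div_iff₀ hd])
  set r := aeval Q.x (nodal (S.erase j) b) with hr
  have hp := aeval_mem (Q := Q) hx
  have e3 := (e2.const_mul r).const_sub (r * Q.y)
  rw [mul_zero, sub_zero] at e3
  refine hB.mem_of_tendsto e3 (e1.mono fun n hn => ?_)
  obtain ⟨G, hG, hGe⟩ := k_pow_decomposition hx hg hj (fun i hi => h.ne i hi j) hw hw0 n
  set β := (((Q.v j + w) / (b j - Q.a j)) ^ n - ((Q.v j - w) / (b j - Q.a j)) ^ n) / (2 * w)
  set α := (((Q.v j + w) / (b j - Q.a j)) ^ n + ((Q.v j - w) / (b j - Q.a j)) ^ n) / 2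
  have hG0 := (hG 0).1
  rw [pow_zero, one_mul, mem_conductor, nodal_eq_mul_nodal_erase hj] at hG0
  have : r * Q.y - r * β⁻¹ • Q.k j ^ n = -(β⁻¹ * α) • r -
      β⁻¹ • (aeval Q.x ((X - C (b j)) * nodal (S.erase j) b) * G) := by
    have hβ : algebraMap ℂ E β⁻¹ * algebraMap ℂ E β = 1 := by
      rw [← map_mul, inv_mul_cancel₀ hn, map_one]
    rw [hGe]
    simp only [Algebra.smul_def, map_mul, map_sub, map_neg, aeval_X, aeval_C, ← hr]
    linear_combination (- r * Q.y) * hβ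
  simp only [SetLike.mem_coe]
  rw [this]
  exact B.sub_mem (B.smul_mem (hp _) _) (B.smul_mem hG0 _)

theorem IsClose.y_mem (h : Q.IsClose S b) (hB : IsClosed (B : Set E))
    (hx : Q.x ∈ B) (hg : Q.gen S b ∈ B) : Q.y ∈ B := by
  rcases S.eq_empty_or_nonempty with rfl | hS
  · simpa [gen] using hg
  have h1 := congrArg (fun p => aeval Q.x p * Q.y) (sum_basis h.inj hS)
  simp only [map_one, one_mul, map_sum, Finset.sum_mul] at h1
  rw [← h1]
  refine B.sum_mem fun j hj => ?_
  rw [basis_eq_prod_sub_inv_mul_nodal_div hj, ← nodal_erase_eq_nodal_div hj, map_mul, mul_assoc,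
    aeval_C, ← Algebra.smul_def]
  exact B.smul_mem (h.nodal_erase_mul_y_mem hB hx hg hj) _

theorem IsClose.k_mem (h : Q.IsClose S b) (hB : IsClosed (B : Set E))
    (hx : Q.x ∈ B) (hg : Q.gen S b ∈ B) {j : ℕ} (hj : j ∈ S) : Q.k j ∈ B := by
  have hy := h.y_mem hB hx hg
  have hp := aeval_mem (Q := Q) hx
  refine mem_of_nodal_mul_mem (Q := Q) (B := Subalgebra.toSubmodule B) (S := S) (j := j)
    (fun p F hF => B.mul_mem (hp p) hF) ?_ ?_
  · rw [← Submodule.smul_mem_iff _ (Q.coef_ne_zero fun i hi => h.ne i hi j)]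
    obtain ⟨u, w, e⟩ := Q.nodal_erase_mul_gen S b hj
    have : Q.coef S b j • (aeval Q.x (nodal (S.erase j) Q.a) * Q.k j) =
        aeval Q.x (nodal (S.erase j) Q.a) * Q.gen S b - aeval Q.x u - aeval Q.x w * Q.y := by
      rw [e]; ring
    rw [this]
    exact B.sub_mem (B.sub_mem (B.mul_mem (hp _) hg) (hp _)) (B.mul_mem (hp _) hy)
  · rw [Q.rel]
    exact B.add_mem hy (B.algebraMap_mem _)

end Finite

section Generic

open Filter Topology

variable {E : Type*} [NormedCommRing E] [NormedAlgebra ℂ E] {Q : PoleSystem E}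

theorem eventually_exists_root (Q : PoleSystem E) (j : ℕ) :
    ∀ᶠ β in 𝓝 (Q.a j), ∃ w : ℂ, w ^ 2 = Q.P.eval β ∧ w ≠ 0 ∧ ‖Q.v j - w‖ < ‖Q.v j + w‖ ∧
      ‖Q.k j‖ * ‖β - Q.a j‖ < ‖Q.v j + w‖ := by
  have hv := Q.v_ne j
  set w : ℂ → ℂ := fun β => Q.v j * (Q.P.eval β / Q.v j ^ 2) ^ (((2 : ℕ) : ℂ)⁻¹) with hwdef
  have hwa : w (Q.a j) = Q.v j := by
    simp only [hwdef]
    rw [← Q.v_sq, div_self (pow_ne_zero _ hv), one_cpow, mul_one]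
  have hw : ContinuousAt w (Q.a j) := by
    refine continuousAt_const.mul (ContinuousAt.cpow ?_ continuousAt_const ?_)
    · exact Q.P.continuous.continuousAt.div_const _
    · rw [← Q.v_sq, div_self (pow_ne_zero _ hv)]; exact one_mem_slitPlane
  have h1 : ∀ᶠ β in 𝓝 (Q.a j), w β ≠ 0 := hw.eventually_ne (by rwa [hwa])
  have h2 : ∀ᶠ β in 𝓝 (Q.a j), ‖Q.v j - w β‖ < ‖Q.v j + w β‖ := by
    refine Tendsto.eventually_lt (continuousAt_const.sub hw).norm
      (continuousAt_const.add hw).norm ?_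
    simp [hwa, ← two_mul, hv]
  have h3 : ∀ᶠ β in 𝓝 (Q.a j), ‖Q.k j‖ * ‖β - Q.a j‖ < ‖Q.v j + w β‖ := by
    refine Tendsto.eventually_lt
      (continuousAt_const.mul (continuousAt_id.sub continuousAt_const).norm)
      (continuousAt_const.add hw).norm ?_
    simp [hwa, ← two_mul, hv]
  filter_upwards [h1, h2, h3] with β b1 b2 b3
  refine ⟨w β, ?_, b1, b2, b3⟩
  simp only [hwdef]
  rw [mul_pow, cpow_nat_inv_pow _ two_ne_zero, mul_div_cancel₀ _ (pow_ne_zero _ hv)]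

theorem gen_range_succ_update (Q : PoleSystem E) (N : ℕ) (b : ℕ → ℂ) (β : ℂ) :
    Q.gen (Finset.range (N + 1)) (Function.update b N β) =
      Q.y + ∑ j ∈ Finset.range N,
        ((Q.a j - β) / (Q.a j - Q.a N) * Q.coef (Finset.range N) b j) • Q.k j +
      ((Q.a N - β) * ((nodal (Finset.range N) b).eval (Q.a N) /
        (nodal (Finset.range N) Q.a).eval (Q.a N))) • Q.k N := by
  have hn : nodal (Finset.range (N + 1)) (Function.update b N β) =
      (X - C β) * nodal (Finset.range N) b := by
    rw [Finset.range_add_one, nodal_insert_eq_nodal Finset.notMem_range_self,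
      Function.update_self]
    congr 1
    refine Finset.prod_congr rfl fun i hi => ?_
    rw [Function.update_of_ne (Finset.mem_range.1 hi).ne]
  rw [gen, Finset.sum_range_succ, ← add_assoc]
  congr 1
  · congr 1
    refine Finset.sum_congr rfl fun j hj => ?_
    congr 1
    have hjN : j ≠ N := (Finset.mem_range.1 hj).ne
    rw [coef, coef, hn, Finset.range_add_one, Finset.erase_insert_of_ne hjN.symm,
      nodal_insert_eq_nodal (fun h => Finset.notMem_range_self (Finset.mem_of_mem_erase h))]
    simp only [eval_mul, eval_sub, eval_X, eval_C]
    rw [mul_div_mul_comm]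
  · congr 1
    rw [coef, hn, Finset.range_add_one, Finset.erase_insert Finset.notMem_range_self]
    simp only [eval_mul, eval_sub, eval_X, eval_C]
    rw [mul_div_assoc]

theorem IsClose.gen_mem_closure {N : ℕ} {b : ℕ → ℂ} (h : Q.IsClose (Finset.range N) b) :
    Q.gen (Finset.range N) b ∈
      closure {g | ∃ c, Q.IsClose (Finset.range (N + 1)) c ∧
        g = Q.gen (Finset.range (N + 1)) c} := by
  set φ : ℂ → E := fun β => Q.gen (Finset.range (N + 1)) (Function.update b N β) with hφ
  have hcont : Continuous φ := by
    simp only [hφ, gen_range_succ_update]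
    fun_prop
  have hφa : φ (Q.a N) = Q.gen (Finset.range N) b := by
    simp only [hφ]
    rw [gen_range_succ_update, sub_self, zero_mul, zero_smul, add_zero, gen]
    congr 1
    refine Finset.sum_congr rfl fun j hj => ?_
    rw [div_self, one_mul]
    exact sub_ne_zero.2 fun e => (Finset.mem_range.1 hj).ne (Q.a_inj e)
  set bad : Set ℂ := range Q.a ∪ b '' (Finset.range N : Set ℕ) with hbad
  have hcount : bad.Countable :=
    (countable_range _).union ((Finset.countable_toSet _).image _)
  have hfreq : ∃ᶠ β in 𝓝 (Q.a N), β ∈ badᶜ :=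
    mem_closure_iff_frequently.1 (hcount.dense_compl ℂ (Q.a N))
  rw [← hφa]
  refine mem_closure_iff_frequently.2 ?_
  refine hcont.continuousAt.tendsto.frequently
    ((hfreq.and_eventually (Q.eventually_exists_root N)).mono ?_)
  rintro β ⟨hβ, hroot⟩
  have hlt : ∀ {i}, i < N → Function.update b N β i = b i := fun hi =>
    Function.update_of_ne hi.ne _ _
  refine ⟨_, ⟨fun i hi j => ?_, ?_, fun i hi => ?_⟩, rfl⟩
  · rcases Finset.mem_range_succ_iff.1 hi |>.lt_or_eq with hi | rfl
    · rw [hlt hi]; exact h.ne i (Finset.mem_range.2 hi) j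
    · rw [Function.update_self]
      exact fun e => hβ (Or.inl ⟨j, e.symm⟩)
  · intro i hi l hl e
    rcases (Finset.mem_range_succ_iff.1 hi).lt_or_eq with hi | rfl <;>
    rcases (Finset.mem_range_succ_iff.1 hl).lt_or_eq with hl | rfl
    · rw [hlt hi, hlt hl] at e
      exact h.inj (Finset.mem_coe.2 (Finset.mem_range.2 hi))
          (Finset.mem_coe.2 (Finset.mem_range.2 hl)) e
    · rw [hlt hi, Function.update_self] at e
      exact absurd (Or.inr ⟨i, Finset.mem_coe.2 (Finset.mem_range.2 hi), e⟩) hβ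
    · rw [hlt hl, Function.update_self] at e
      exact absurd (Or.inr ⟨l, Finset.mem_coe.2 (Finset.mem_range.2 hl), e.symm⟩) hβ
    · rfl
  · rcases Finset.mem_range_succ_iff.1 hi |>.lt_or_eq with hi | rfl
    · rw [hlt hi]; exact h.root i (Finset.mem_range.2 hi)
    · rw [Function.update_self]; exact hroot

theorem continuous_aeval_pair (x : E) (p : MvPolynomial (Fin 2) ℂ) :
    Continuous fun g : E => MvPolynomial.aeval ![x, g] p := by
  induction p using MvPolynomial.induction_on with
  | C c => simpa using continuous_const
  | add p q hp hq => simp only [map_add]; exact hp.add hq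
  | mul_X p i hp =>
    simp only [map_mul, MvPolynomial.aeval_X]
    refine hp.mul ?_
    fin_cases i
    · exact continuous_const
    · exact continuous_id

theorem mem_adjoin_pair_iff {R : Type*} [CommRing R] [Algebra ℂ R] {x g F : R} :
    F ∈ Algebra.adjoin ℂ {x, g} ↔
      ∃ p : MvPolynomial (Fin 2) ℂ, MvPolynomial.aeval ![x, g] p = F := by
  have : ({x, g} : Set R) = range ![x, g] := by simp [pair_comm]
  rw [this, Algebra.adjoin_range_eq_range_aeval]
  rfl

/-- In the closed algebra generated by a pole system, some `g` generates it together with `x`. -/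
theorem exists_generator [CompleteSpace E] (Q : PoleSystem E) :
    ∃ g ∈ (Algebra.adjoin ℂ ({Q.x, Q.y} ∪ range Q.k)).topologicalClosure,
      Q.y ∈ (Algebra.adjoin ℂ {Q.x, g}).topologicalClosure ∧
      ∀ j, Q.k j ∈ (Algebra.adjoin ℂ {Q.x, g}).topologicalClosure := by
  set G : ℕ → Set E := fun N =>
    {g | ∃ c, Q.IsClose (Finset.range N) c ∧ g = Q.gen (Finset.range N) c} with hG
  have hGs : ∀ N, closure (G N) ⊆ closure (G (N + 1)) := fun N =>
    closure_minimal (by rintro _ ⟨c, hc, rfl⟩; exact hc.gen_mem_closure) isClosed_closure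
  have hGm : Monotone fun N => closure (G N) := monotone_nat_of_le_succ hGs
  set X : Set E := closure (⋃ N, G N) with hX
  have : CompleteSpace X := isClosed_closure.completeSpace_coe
  have : Nonempty X := ⟨⟨Q.gen (Finset.range 0) 0, subset_closure (mem_iUnion.2 ⟨0, 0,
    ⟨by simp, by simp, by simp⟩, rfl⟩)⟩⟩
  set T : ℕ → E := fun i => Nat.casesOn i Q.y Q.k with hT
  set O : ℕ × ℕ → Set X := fun i =>
    {g | ∃ p : MvPolynomial (Fin 2) ℂ, ‖MvPolynomial.aeval ![Q.x, (g : E)] p - T i.1‖ <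
      1 / (i.2 + 1)}
    with hO
  have hOo : ∀ i, IsOpen (O i) := fun i => by
    simp only [hO, ofPred_exists]
    refine isOpen_iUnion fun p => isOpen_lt ?_ continuous_const
    exact (((continuous_aeval_pair Q.x p).comp continuous_subtype_val).sub continuous_const).norm
  have hGO : ∀ i N, i.1 ≤ N → ∀ g : X, (g : E) ∈ G N → g ∈ O i := by
    rintro ⟨i, n⟩ N hN ⟨g, hgX⟩ ⟨c, hc, hgc⟩
    simp only at hgc hN
    subst hgc
    have hB := (Algebra.adjoin ℂ {Q.x, Q.gen (Finset.range N) c}).isClosed_topologicalClosure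
    have hle := (Algebra.adjoin ℂ {Q.x, Q.gen (Finset.range N) c}).le_topologicalClosure
    have hx := hle (Algebra.subset_adjoin (mem_insert Q.x _))
    have hg := hle (Algebra.subset_adjoin (mem_insert_of_mem Q.x (mem_singleton _)))
    have hTi : T i ∈ (Algebra.adjoin ℂ {Q.x, Q.gen (Finset.range N) c}).topologicalClosure := by
      cases i with
      | zero => exact hc.y_mem hB hx hg
      | succ i => exact hc.k_mem hB hx hg (Finset.mem_range.2 hN)
    rw [← SetLike.mem_coe, Subalgebra.topologicalClosure_coe, Metric.mem_closure_iff] at hTi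
    obtain ⟨F, hF, hFd⟩ := hTi (1 / (n + 1)) (by positivity)
    obtain ⟨p, rfl⟩ := mem_adjoin_pair_iff.1 hF
    exact ⟨p, by rwa [← dist_eq_norm, dist_comm]⟩
  have hOd : ∀ i, Dense (O i) := by
    intro i
    rw [Subtype.dense_iff]
    have : X ⊆ closure (⋃ N ≥ i.1, G N) := by
      refine closure_minimal (iUnion_subset fun N => ?_) isClosed_closure
      refine subset_closure.trans ((hGm (le_max_left N i.1)).trans (closure_mono ?_))
      exact subset_biUnion_of_mem (u := fun N => G N) (le_max_right N i.1)
    refine this.trans (closure_mono ?_)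
    intro g hg
    simp only [mem_iUnion] at hg
    obtain ⟨N, hN, hgN⟩ := hg
    exact ⟨⟨g, subset_closure (mem_iUnion.2 ⟨N, hgN⟩)⟩, hGO i N hN _ hgN, rfl⟩
  obtain ⟨⟨g, hgX⟩, hgO⟩ := (dense_iInter_of_isOpen hOo hOd).nonempty
  rw [mem_iInter] at hgO
  have hTg : ∀ i, T i ∈ (Algebra.adjoin ℂ {Q.x, g}).topologicalClosure := by
    intro i
    rw [← SetLike.mem_coe, Subalgebra.topologicalClosure_coe, Metric.mem_closure_iff]
    intro ε hε
    obtain ⟨n, hn⟩ := exists_nat_one_div_lt hε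
    obtain ⟨p, hp⟩ := hgO (i, n)
    exact ⟨_, mem_adjoin_pair_iff.2 ⟨p, rfl⟩, by rw [dist_comm, dist_eq_norm]; exact hp.trans hn⟩
  refine ⟨g, ?_, hTg 0, fun j => hTg (j + 1)⟩
  have hsub : (⋃ N, G N) ⊆ (Algebra.adjoin ℂ ({Q.x, Q.y} ∪ range Q.k) : Set E) := by
    refine iUnion_subset fun N => ?_
    rintro _ ⟨c, -, rfl⟩
    refine Subalgebra.add_mem _ (Algebra.subset_adjoin (by simp))
      (Subalgebra.sum_mem _ fun j _ => ?_)
    exact Subalgebra.smul_mem _ (Algebra.subset_adjoin (by simp)) _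
  exact closure_mono hsub hgX

end Generic

end PoleSystem

section Weierstrass

open Filter Topology Bornology

theorem AnalyticAt.eventually_eq_zero_of_linear_ode {D q : ℂ → ℂ} {u : ℂ} (hD : AnalyticAt ℂ D u)
    (hq : AnalyticAt ℂ q u) (h0 : D u = 0) (h1 : deriv D u = 0)
    (h2 : ∀ᶠ z in 𝓝 u, deriv (deriv D) z = q z * D z) : ∀ᶠ z in 𝓝 u, D z = 0 := by
  rw [← analyticOrderAt_eq_top]
  have e1 := hD.analyticOrderAt_deriv_add_one
  have e2 := hD.deriv.analyticOrderAt_deriv_add_one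
  simp only [h0, h1, sub_zero] at e1 e2
  rw [analyticOrderAt_congr h2, show (fun z => q z * D z) = q * D from rfl,
    analyticOrderAt_mul hq hD] at e2
  by_contra hne
  obtain ⟨n, hn⟩ := ENat.ne_top_iff_exists.1 hne
  have e3 : analyticOrderAt (deriv D) u ≠ ⊤ := by
    intro h; rw [h] at e1; exact hne (by simpa using e1.symm)
  obtain ⟨m, hm⟩ := ENat.ne_top_iff_exists.1 e3
  have e4 : analyticOrderAt q u ≠ ⊤ := by
    intro h; rw [h] at e2; exact e3 (by simpa using e2.symm)
  obtain ⟨l, hl⟩ := ENat.ne_top_iff_exists.1 e4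
  rw [← hn, ← hm] at e1
  rw [← hn, ← hm, ← hl] at e2
  norm_cast at e1 e2
  omega

namespace PeriodPair

variable (L : PeriodPair)

theorem countable_lattice : (L.lattice : Set ℂ).Countable := by
  have : (L.lattice : Set ℂ) = range fun p : ℤ × ℤ => (p.1 : ℂ) * L.ω₁ + p.2 * L.ω₂ := by
    ext x
    simp [mem_lattice]
  rw [this]
  exact countable_range _

theorem isPreconnected_compl_of_countable {s : Set ℂ} (hs : s.Countable) : IsPreconnected sᶜ :=
  (hs.isConnected_compl_of_one_lt_rank (by simp)).isPreconnected

theorem isOpen_compl_lattice : IsOpen (L.lattice : Set ℂ)ᶜ := L.isClosed_lattice.isOpen_compl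

theorem tendsto_weierstrassP_cobounded {l : ℂ} (hl : l ∈ L.lattice) :
    Tendsto L.weierstrassP (𝓝[≠] l) (cobounded ℂ) := by
  refine tendsto_cobounded_of_meromorphicOrderAt_neg ?_
  rw [L.order_weierstrassP l hl]
  decide

theorem eventually_notMem_lattice (z : ℂ) : ∀ᶠ u in 𝓝[≠] z, u ∉ L.lattice := by
  have := L.compl_lattice_sdiff_singleton_mem_nhds z
  filter_upwards [nhdsWithin_le_nhds this, self_mem_nhdsWithin] with u hu huz h
  exact hu ⟨h, huz⟩

theorem not_eqOn_weierstrassP_const (c : ℂ) : ¬ ∀ z ∉ L.lattice, L.weierstrassP z = c := by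
  intro h
  have h1 := L.tendsto_weierstrassP_cobounded L.lattice.zero_mem
  have h2 : Tendsto L.weierstrassP (𝓝[≠] (0 : ℂ)) (𝓝 c) :=
    tendsto_const_nhds.congr' ((L.eventually_notMem_lattice 0).mono fun u hu => (h u hu).symm)
  exact h2.not_tendsto (Metric.disjoint_nhds_cobounded c) h1

theorem hasDerivAt_weierstrassP {z : ℂ} (hz : z ∉ L.lattice) :
    HasDerivAt L.weierstrassP (L.derivWeierstrassP z) z := by
  have := (L.analyticOnNhd_weierstrassP z hz).differentiableAt.hasDerivAt
  rwa [L.deriv_weierstrassP] at this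

theorem hasDerivAt_derivWeierstrassP {z : ℂ} (hz : z ∉ L.lattice) :
    HasDerivAt L.derivWeierstrassP (6 * L.weierstrassP z ^ 2 - L.g₂ / 2) z := by
  have hd : ∀ {z}, z ∉ L.lattice → HasDerivAt L.derivWeierstrassP (deriv L.derivWeierstrassP z) z :=
    fun hz => (L.analyticOnNhd_derivWeierstrassP _ hz).differentiableAt.hasDerivAt
  have hx := L.analyticOnNhd_weierstrassP
  have hy := L.analyticOnNhd_derivWeierstrassP
  have key : (∀ z ∈ (L.lattice : Set ℂ)ᶜ, L.derivWeierstrassP z = 0) ∨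
      ∀ z ∈ (L.lattice : Set ℂ)ᶜ,
        deriv L.derivWeierstrassP z - (6 * L.weierstrassP z ^ 2 - L.g₂ / 2) = 0 := by
    refine hy.eq_zero_or_eq_zero_of_mul_eq_zero (hy.deriv.sub
      (((analyticOnNhd_const.mul (hx.pow 2)).sub analyticOnNhd_const))) (fun z hz => ?_)
      (isPreconnected_compl_of_countable L.countable_lattice)
    have h1 := (hd hz).pow 2
    have h2 := (((L.hasDerivAt_weierstrassP hz).pow 3).const_mul 4).sub
      ((L.hasDerivAt_weierstrassP hz).const_mul L.g₂) |>.sub_const L.g₃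
    have h3 := h1.unique (h2.congr_of_eventuallyEq
      (mem_of_superset (L.isOpen_compl_lattice.mem_nhds hz) fun u hu =>
        L.derivWeierstrassP_sq u hu))
    change L.derivWeierstrassP z * (deriv L.derivWeierstrassP z -
      (6 * L.weierstrassP z ^ 2 - L.g₂ / 2)) = 0
    push_cast at h3
    linear_combination h3 / 2
  rcases key with h | h
  · exfalso
    obtain ⟨c, hc⟩ := L.isOpen_compl_lattice.exists_is_const_of_deriv_eq_zero
      (isPreconnected_compl_of_countable L.countable_lattice) L.differentiableOn_weierstrassP
      (fun z hz => by rw [L.deriv_weierstrassP]; exact h z hz)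
    exact L.not_eqOn_weierstrassP_const c hc
  · rw [← sub_eq_zero.1 (h z hz)]
    exact hd hz

theorem deriv_derivWeierstrassP_ne_zero {z : ℂ} (hz : z ∉ L.lattice)
    (hy : L.derivWeierstrassP z = 0) : 6 * L.weierstrassP z ^ 2 - L.g₂ / 2 ≠ 0 := by
  intro h
  set e := L.weierstrassP z with he
  have hx := L.analyticOnNhd_weierstrassP
  have hD : AnalyticOnNhd ℂ (fun u => L.weierstrassP u - e) (L.lattice : Set ℂ)ᶜ :=
    hx.sub analyticOnNhd_const
  have h1 : deriv (fun u => L.weierstrassP u - e) = L.derivWeierstrassP := by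
    funext u; rw [deriv_sub_const, L.deriv_weierstrassP]
  have := AnalyticAt.eventually_eq_zero_of_linear_ode (q := fun u => 6 * (L.weierstrassP u + e))
    (hD z hz) (analyticAt_const.mul ((hx z hz).add analyticAt_const)) (sub_self e)
    (by rw [h1]; exact hy) ?_
  · have h2 := hD.eqOn_zero_of_preconnected_of_eventuallyEq_zero
      (isPreconnected_compl_of_countable L.countable_lattice) hz this
    exact L.not_eqOn_weierstrassP_const e fun u hu => sub_eq_zero.1 (h2 hu)
  · filter_upwards [L.isOpen_compl_lattice.mem_nhds hz] with u hu
    rw [h1, (L.hasDerivAt_derivWeierstrassP hu).deriv]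
    linear_combination h

theorem sub_mem_lattice_of_weierstrassP_eq {z w : ℂ} (hz : z ∉ L.lattice) (hw : w ∉ L.lattice)
    (hx : L.weierstrassP z = L.weierstrassP w)
    (hy : L.derivWeierstrassP z = L.derivWeierstrassP w) : z - w ∈ L.lattice := by
  by_contra hzw
  set T : Set ℂ := (fun u => z + u) ⁻¹' L.lattice ∪ (fun u => w + u) ⁻¹' L.lattice with hT
  have hTc : T.Countable := (L.countable_lattice.preimage (add_right_injective z)).union
    (L.countable_lattice.preimage (add_right_injective w))
  have hTz : ∀ {u}, u ∈ Tᶜ → z + u ∉ L.lattice := fun hu h => hu (Or.inl h)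
  have hTw : ∀ {u}, u ∈ Tᶜ → w + u ∉ L.lattice := fun hu h => hu (Or.inr h)
  have hTo : IsOpen Tᶜ := by
    rw [isOpen_compl_iff]
    exact (L.isClosed_lattice.preimage (by fun_prop)).union
      (L.isClosed_lattice.preimage (by fun_prop))
  have ha : ∀ {c u}, c + u ∉ L.lattice → AnalyticAt ℂ (fun u => L.weierstrassP (c + u)) u :=
    fun {c u} h => (L.analyticOnNhd_weierstrassP _ h).comp_of_eq (f := fun u => c + u)
      (analyticAt_const.add analyticAt_id) rfl
  have hd : ∀ {c u}, c + u ∉ L.lattice → HasDerivAt (fun u => L.weierstrassP (c + u))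
      (L.derivWeierstrassP (c + u)) u := fun {c u} h =>
    (L.hasDerivAt_weierstrassP h).comp_const_add c u
  have hd' : ∀ {c u}, c + u ∉ L.lattice → HasDerivAt (fun u => L.derivWeierstrassP (c + u))
      (6 * L.weierstrassP (c + u) ^ 2 - L.g₂ / 2) u := fun {c u} h =>
    (L.hasDerivAt_derivWeierstrassP h).comp_const_add c u
  set D : ℂ → ℂ := fun u => L.weierstrassP (z + u) - L.weierstrassP (w + u) with hDdef
  have hD : AnalyticOnNhd ℂ D Tᶜ := fun u hu => (ha (hTz hu)).sub (ha (hTw hu))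
  have h0T : (0 : ℂ) ∈ Tᶜ := by rintro (h | h) <;> simp_all
  have hD1 : ∀ u ∈ Tᶜ, HasDerivAt D
      (L.derivWeierstrassP (z + u) - L.derivWeierstrassP (w + u)) u :=
    fun u hu => (hd (hTz hu)).sub (hd (hTw hu))
  have := AnalyticAt.eventually_eq_zero_of_linear_ode
    (q := fun u => 6 * (L.weierstrassP (z + u) + L.weierstrassP (w + u)))
    (hD 0 h0T) (analyticAt_const.mul ((ha (hTz h0T)).add (ha (hTw h0T)))) (by simp [hDdef, hx])
    (by rw [(hD1 0 h0T).deriv]; simp [hy]) ?_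
  · have h2 := hD.eqOn_zero_of_preconnected_of_eventuallyEq_zero
      (isPreconnected_compl_of_countable hTc) h0T this
    have hzw' : w + -z ∉ L.lattice := fun h => hzw (by
      have := L.lattice.neg_mem h; rwa [neg_add, neg_neg, add_comm, ← sub_eq_add_neg] at this)
    have h3 : Tendsto (fun u => L.weierstrassP (w + u)) (𝓝[≠] (-z)) (𝓝 (L.weierstrassP (w + -z))) :=
      ((ha hzw').continuousAt.tendsto).mono_left nhdsWithin_le_nhds
    have h4 : Tendsto (fun u => z + u) (𝓝[≠] (-z)) (𝓝[≠] 0) := by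
      refine tendsto_nhdsWithin_of_tendsto_nhds_of_eventually_within _ ?_ ?_
      · have : ContinuousAt (fun u => z + u) (-z) := by fun_prop
        have := this.tendsto
        rw [add_neg_cancel] at this
        exact this.mono_left nhdsWithin_le_nhds
      · filter_upwards [self_mem_nhdsWithin] with u hu h
        exact hu (eq_neg_of_add_eq_zero_right h)
    have h5 := (L.tendsto_weierstrassP_cobounded L.lattice.zero_mem).comp h4
    have h6 : ∀ᶠ u in 𝓝[≠] (-z), u ∈ Tᶜ := by
      have e1 := h4.eventually (L.eventually_notMem_lattice 0)
      have e2 : ∀ᶠ u in 𝓝 (-z), w + u ∉ L.lattice :=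
        (continuous_const.add continuous_id).continuousAt.eventually
          (L.isOpen_compl_lattice.mem_nhds hzw')
      filter_upwards [e1, nhdsWithin_le_nhds e2] with u h1 h2
      rintro (h | h)
      exacts [h1 h, h2 h]
    refine (h3.congr' (h6.mono fun u hu => ?_)).not_tendsto (Metric.disjoint_nhds_cobounded _) h5
    exact (sub_eq_zero.1 (h2 hu)).symm
  · filter_upwards [hTo.mem_nhds h0T] with u hu
    have h1 : deriv D =ᶠ[𝓝 u]
        fun u => L.derivWeierstrassP (z + u) - L.derivWeierstrassP (w + u) := by
      filter_upwards [hTo.mem_nhds hu] with t ht using (hD1 t ht).deriv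
    rw [h1.deriv_eq, ((hd' (hTz hu)).fun_sub (hd' (hTw hu))).deriv]
    simp only [hDdef]
    ring

/-- The meromorphic function of `z` and `w` with value `(℘' z + ℘' w) / (℘ z - ℘ w)`. As a function
of `z` its poles are simple and located at `0` and `w` modulo the lattice. -/
noncomputable def kappa (z w : ℂ) : ℂ :=
  open Classical in
  if L.weierstrassP z = L.weierstrassP w then
    (4 * (L.weierstrassP z ^ 2 + L.weierstrassP z * L.weierstrassP w + L.weierstrassP w ^ 2) - L.g₂) /
      (L.derivWeierstrassP z - L.derivWeierstrassP w)
  else (L.derivWeierstrassP z + L.derivWeierstrassP w) / (L.weierstrassP z - L.weierstrassP w)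

variable {L} {z w : ℂ}

theorem derivWeierstrassP_eq_neg (hz : z ∉ L.lattice) (hw : w ∉ L.lattice)
    (hzw : z - w ∉ L.lattice) (hx : L.weierstrassP z = L.weierstrassP w) :
    L.derivWeierstrassP z + L.derivWeierstrassP w = 0 := by
  have h1 := L.derivWeierstrassP_sq z hz
  have h2 := L.derivWeierstrassP_sq w hw
  rw [hx, ← h2] at h1
  rcases sq_eq_sq_iff_eq_or_eq_neg.1 h1 with h | h
  · exact absurd (L.sub_mem_lattice_of_weierstrassP_eq hz hw hx h) hzw
  · rw [h]; ring

theorem kappa_mul_sub (hz : z ∉ L.lattice) (hw : w ∉ L.lattice) (hzw : z - w ∉ L.lattice) :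
    (L.weierstrassP z - L.weierstrassP w) * L.kappa z w =
      L.derivWeierstrassP z + L.derivWeierstrassP w := by
  by_cases h : L.weierstrassP z = L.weierstrassP w
  · rw [derivWeierstrassP_eq_neg hz hw hzw h, h, sub_self, zero_mul]
  · rw [kappa, if_neg h, mul_div_cancel₀ _ (sub_ne_zero.2 h)]

theorem kappa_mul_sub_deriv (hz : z ∉ L.lattice) (hw : w ∉ L.lattice) (hzw : z - w ∉ L.lattice) :
    (L.derivWeierstrassP z - L.derivWeierstrassP w) * L.kappa z w =
      4 * (L.weierstrassP z ^ 2 + L.weierstrassP z * L.weierstrassP w + L.weierstrassP w ^ 2) -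
        L.g₂ := by
  by_cases h : L.weierstrassP z = L.weierstrassP w
  · have hy : L.derivWeierstrassP z - L.derivWeierstrassP w ≠ 0 := fun hy =>
      hzw (L.sub_mem_lattice_of_weierstrassP_eq hz hw h (sub_eq_zero.1 hy))
    rw [kappa, if_pos h, mul_div_cancel₀ _ hy]
  · have h' := sub_ne_zero.2 h
    rw [kappa, if_neg h, ← mul_div_assoc, div_eq_iff h']
    linear_combination L.derivWeierstrassP_sq z hz - L.derivWeierstrassP_sq w hw

theorem kappa_add_coe (z w : ℂ) {l : ℂ} (hl : l ∈ L.lattice) : L.kappa (z + l) w = L.kappa z w := by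
  simp only [kappa, L.weierstrassP_add_coe z ⟨l, hl⟩, L.derivWeierstrassP_add_coe z ⟨l, hl⟩]

theorem kappa_add_coe_right (z w : ℂ) {l : ℂ} (hl : l ∈ L.lattice) :
    L.kappa z (w + l) = L.kappa z w := by
  simp only [kappa, L.weierstrassP_add_coe w ⟨l, hl⟩, L.derivWeierstrassP_add_coe w ⟨l, hl⟩]

theorem kappa_swap (z w : ℂ) : L.kappa w z = - L.kappa z w := by
  by_cases h : L.weierstrassP z = L.weierstrassP w
  · rw [kappa, kappa, if_pos h, if_pos h.symm, ← neg_sub (L.derivWeierstrassP z), div_neg]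
    ring
  · rw [kappa, kappa, if_neg h, if_neg (Ne.symm h), ← neg_sub (L.weierstrassP z), div_neg]
    ring

variable (L) in
/-- The domain of regularity of `kappa`. -/
def kappaDomain : Set (ℂ × ℂ) :=
  {p | p.1 ∉ L.lattice ∧ p.2 ∉ L.lattice ∧ p.1 - p.2 ∉ L.lattice}

theorem isOpen_kappaDomain : IsOpen L.kappaDomain := by
  have h := L.isOpen_compl_lattice
  exact (h.preimage continuous_fst).inter ((h.preimage continuous_snd).inter
    (h.preimage (continuous_fst.sub continuous_snd)))

/-- Locally `kappa` is a quotient of polynomials in `℘` and `℘'`. -/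
theorem differentiableAt_kappa (h : (z, w) ∈ L.kappaDomain) :
    DifferentiableAt ℂ (fun p : ℂ × ℂ => L.kappa p.1 p.2) (z, w) := by
  have hz := h.1
  have hw := h.2.1
  have ev := isOpen_kappaDomain.mem_nhds h
  have x1 : DifferentiableAt ℂ (fun p : ℂ × ℂ => L.weierstrassP p.1) (z, w) :=
    (L.hasDerivAt_weierstrassP hz).differentiableAt.comp (z, w) differentiableAt_fst
  have x2 : DifferentiableAt ℂ (fun p : ℂ × ℂ => L.weierstrassP p.2) (z, w) :=
    (L.hasDerivAt_weierstrassP hw).differentiableAt.comp (z, w) differentiableAt_snd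
  have y1 : DifferentiableAt ℂ (fun p : ℂ × ℂ => L.derivWeierstrassP p.1) (z, w) :=
    (L.hasDerivAt_derivWeierstrassP hz).differentiableAt.comp (z, w) differentiableAt_fst
  have y2 : DifferentiableAt ℂ (fun p : ℂ × ℂ => L.derivWeierstrassP p.2) (z, w) :=
    (L.hasDerivAt_derivWeierstrassP hw).differentiableAt.comp (z, w) differentiableAt_snd
  by_cases hx : L.weierstrassP z = L.weierstrassP w
  · have hy : L.derivWeierstrassP z - L.derivWeierstrassP w ≠ 0 := fun hy =>
      h.2.2 (L.sub_mem_lattice_of_weierstrassP_eq hz hw hx (sub_eq_zero.1 hy))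
    have hd := y1.fun_sub y2
    refine ((((((x1.fun_pow 2).fun_add (x1.fun_mul x2)).fun_add (x2.fun_pow 2)).const_mul
      4).sub_const L.g₂).fun_mul (hd.fun_inv hy)).congr_of_eventuallyEq ?_
    filter_upwards [ev, hd.continuousAt.eventually_ne hy] with p hp hpy
    rw [← kappa_mul_sub_deriv hp.1 hp.2.1 hp.2.2, mul_comm, inv_mul_cancel_left₀ hpy]
  · have hx := sub_ne_zero.2 hx
    have hd := x1.fun_sub x2
    refine ((y1.fun_add y2).fun_mul (hd.fun_inv hx)).congr_of_eventuallyEq ?_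
    filter_upwards [ev, hd.continuousAt.eventually_ne hx] with p hp hpy
    rw [← kappa_mul_sub hp.1 hp.2.1 hp.2.2, mul_comm, inv_mul_cancel_left₀ hpy]

theorem differentiableAt_kappa_left (hz : z ∉ L.lattice) (hw : w ∉ L.lattice)
    (hzw : z - w ∉ L.lattice) : DifferentiableAt ℂ (fun z => L.kappa z w) z :=
  (differentiableAt_kappa ⟨hz, hw, hzw⟩).comp (f := fun z => (z, w)) z (by fun_prop)

theorem differentiableAt_kappa_right (hz : z ∉ L.lattice) (hw : w ∉ L.lattice)
    (hzw : z - w ∉ L.lattice) : DifferentiableAt ℂ (fun w => L.kappa z w) w :=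
  (differentiableAt_kappa ⟨hz, hw, hzw⟩).comp (f := fun w => (z, w)) w (by fun_prop)

theorem eventually_mem_kappaDomain (hz : z ∉ L.lattice) :
    ∀ᶠ w in 𝓝[≠] z, (z, w) ∈ L.kappaDomain := by
  have h1 : Tendsto (fun w => z - w) (𝓝[≠] z) (𝓝[≠] 0) := by
    refine tendsto_nhdsWithin_of_tendsto_nhds_of_eventually_within _ ?_ ?_
    · have : ContinuousAt (fun w => z - w) z := by fun_prop
      have := this.tendsto
      rw [sub_self] at this
      exact this.mono_left nhdsWithin_le_nhds
    · filter_upwards [self_mem_nhdsWithin] with w hw h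
      exact hw (sub_eq_zero.1 h).symm
  filter_upwards [h1.eventually (L.eventually_notMem_lattice 0),
    nhdsWithin_le_nhds (L.isOpen_compl_lattice.mem_nhds hz)] with w h1 h2
  exact ⟨hz, h2, h1⟩

theorem tendsto_sub_mul_kappa (hz : z ∉ L.lattice) :
    Tendsto (fun w => (w - z) * L.kappa z w) (𝓝[≠] z) (𝓝 (-2)) := by
  have ev := eventually_mem_kappaDomain hz
  have x1 := L.hasDerivAt_weierstrassP hz
  have y1 := L.hasDerivAt_derivWeierstrassP hz
  by_cases hy : L.derivWeierstrassP z = 0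
  · have hd := L.deriv_derivWeierstrassP_ne_zero hz hy
    set c := 6 * L.weierstrassP z ^ 2 - L.g₂ / 2 with hc
    have h1 := (hasDerivAt_iff_tendsto_slope.1 y1).inv₀ hd
    have h2 : ContinuousAt (fun w => 4 * (L.weierstrassP z ^ 2 + L.weierstrassP z * L.weierstrassP w +
        L.weierstrassP w ^ 2) - L.g₂) z := by
      have := x1.continuousAt
      fun_prop
    have h3 := h1.neg.mul (h2.tendsto.mono_left nhdsWithin_le_nhds)
    have h4 : -c⁻¹ * (4 * (L.weierstrassP z ^ 2 + L.weierstrassP z * L.weierstrassP z +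
        L.weierstrassP z ^ 2) - L.g₂) = -2 := by
      rw [show 4 * (L.weierstrassP z ^ 2 + L.weierstrassP z * L.weierstrassP z +
        L.weierstrassP z ^ 2) - L.g₂ = 2 * c by rw [hc]; ring]
      field_simp
    rw [h4] at h3
    refine h3.congr' ?_
    filter_upwards [ev, self_mem_nhdsWithin, y1.eventually_ne hd (c := L.derivWeierstrassP z)]
      with w hw hwz hyw
    rw [← kappa_mul_sub_deriv hw.1 hw.2.1 hw.2.2, slope_def_field]
    have e1 : w - z ≠ 0 := sub_ne_zero.2 hwz
    have e2 := sub_ne_zero.2 hyw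
    rw [inv_div, ← neg_sub (L.derivWeierstrassP w) (L.derivWeierstrassP z)]
    field_simp
  · have h1 := (hasDerivAt_iff_tendsto_slope.1 x1).inv₀ hy
    have h2 : ContinuousAt (fun w => L.derivWeierstrassP z + L.derivWeierstrassP w) z := by
      have := y1.continuousAt
      fun_prop
    have h3 := h1.neg.mul (h2.tendsto.mono_left nhdsWithin_le_nhds)
    have h4 : -(L.derivWeierstrassP z)⁻¹ * (L.derivWeierstrassP z + L.derivWeierstrassP z) = -2 := by
      field_simp; ring
    rw [h4] at h3
    refine h3.congr' ?_
    filter_upwards [ev, self_mem_nhdsWithin, x1.eventually_ne hy (c := L.weierstrassP z)]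
      with w hw hwz hyw
    rw [← kappa_mul_sub hw.1 hw.2.1 hw.2.2, slope_def_field]
    have e1 : w - z ≠ 0 := sub_ne_zero.2 hwz
    have e2 := sub_ne_zero.2 hyw
    rw [inv_div, ← neg_sub (L.weierstrassP w) (L.weierstrassP z)]
    field_simp

theorem tendsto_norm_kappa_atTop (hz : z ∉ L.lattice) :
    Tendsto (fun w => ‖L.kappa z w‖) (𝓝[≠] z) atTop := by
  have h1 := (tendsto_sub_mul_kappa hz).norm
  have h2 : Tendsto (fun w => ‖w - z‖⁻¹) (𝓝[≠] z) atTop := by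
    refine Tendsto.inv_tendsto_nhdsGT_zero ?_
    exact tendsto_norm_sub_self_nhdsNE z
  have h3 := h1.pos_mul_atTop (by simp) h2
  refine h3.congr' ?_
  filter_upwards [self_mem_nhdsWithin] with w hw
  have : ‖w - z‖ ≠ 0 := norm_ne_zero_iff.2 (sub_ne_zero.2 hw)
  rw [norm_mul]
  field_simp

theorem eventually_weierstrassP_ne (hz : z ∉ L.lattice) :
    ∀ᶠ w in 𝓝[≠] z, L.weierstrassP w ≠ L.weierstrassP z := by
  by_cases hy : L.derivWeierstrassP z = 0
  · filter_upwards [eventually_mem_kappaDomain hz] with w hw hx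
    have := derivWeierstrassP_eq_neg hw.1 hw.2.1 hw.2.2 hx.symm
    rw [hy, zero_add] at this
    exact hw.2.2 (L.sub_mem_lattice_of_weierstrassP_eq hw.1 hw.2.1 hx.symm (hy.trans this.symm))
  · exact (L.hasDerivAt_weierstrassP hz).eventually_ne hy

/-- The product of the translates of two `kappa`s with cancelling finite poles. -/
theorem kappa_sub_mul_kappa_add {u : ℂ} (hu : (z, u) ∈ L.kappaDomain) (hw : (z, w) ∈ L.kappaDomain)
    (hwu : (w, u) ∈ L.kappaDomain) (hx : L.weierstrassP w ≠ L.weierstrassP u) :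
    (L.kappa z u - L.kappa w u) * (L.kappa z w + L.kappa w u) =
      4 * L.weierstrassP z + (4 * (L.weierstrassP u + L.weierstrassP w) - L.kappa w u ^ 2) := by
  have a1 := kappa_mul_sub hu.1 hu.2.1 hu.2.2
  have a2 := kappa_mul_sub_deriv hu.1 hu.2.1 hu.2.2
  have b1 := kappa_mul_sub hw.1 hw.2.1 hw.2.2
  have b2 := kappa_mul_sub_deriv hw.1 hw.2.1 hw.2.2
  have c1 := kappa_mul_sub hwu.1 hwu.2.1 hwu.2.2
  have c2 := kappa_mul_sub_deriv hwu.1 hwu.2.1 hwu.2.2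
  have d1 := L.derivWeierstrassP_sq z hu.1
  have d2 := L.derivWeierstrassP_sq u hu.2.1
  have d3 := L.derivWeierstrassP_sq w hw.2.1
  have e1 := derivWeierstrassP_eq_neg hu.1 hu.2.1 hu.2.2
  have e2 := derivWeierstrassP_eq_neg hw.1 hw.2.1 hw.2.2
  generalize L.kappa z u = p at *
  generalize L.kappa z w = q at *
  generalize L.kappa w u = t at *
  generalize L.weierstrassP z = X at *
  generalize L.weierstrassP u = x at *
  generalize L.weierstrassP w = x' at *
  generalize L.derivWeierstrassP z = Y at *
  generalize L.derivWeierstrassP u = y at *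
  generalize L.derivWeierstrassP w = y' at *
  have hx := sub_ne_zero.2 hx
  by_cases h1 : X = x
  · subst h1
    have hY := e1 rfl
    apply mul_left_cancel₀ hx
    linear_combination (t - p) * b1 + p * c1 - a2 + c2 + t * hY
  by_cases h2 : X = x'
  · subst h2
    have hY := e2 rfl
    apply mul_left_cancel₀ hx
    linear_combination (q + t) * a1 - q * c1 + b2 - c2 + t * hY
  apply mul_left_cancel₀ (mul_ne_zero hx (mul_ne_zero (sub_ne_zero.2 h1) (sub_ne_zero.2 h2)))
  linear_combination (x' - x) * (((X - x') * (q + t)) * a1 + (Y + y - (X - x) * t) * b1 + d1) +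
    (-Y * (x' - x) + y * (X - x') - y' * (X - x)) * c1 + (X - x') * d2 - (X - x) * d3

end PeriodPair

end Weierstrass

section Cutoff

open MeasureTheory Metric

theorem exists_contDiff_cutoff_infDist (S : Set ℂ) {δ : ℝ} (hδ : 0 < δ) :
    ∃ χ : ℂ → ℝ, ContDiff ℝ 1 χ ∧ (∀ z, infDist z S < δ → χ z = 0) ∧
      (∀ z, 3 * δ ≤ infDist z S → χ z = 1) ∧
      ∀ l, (∀ z, infDist (z + l) S = infDist z S) → ∀ z, χ (z + l) = χ z := by
  let φ : ContDiffBump (0 : ℂ) := ⟨δ / 2, δ, by positivity, by linarith⟩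
  let T : Set ℂ := {z | 2 * δ ≤ infDist z S}
  have hT : MeasurableSet T :=
    (isClosed_le continuous_const (continuous_infDist_pt S)).measurableSet
  let g : ℂ → ℝ := T.indicator 1
  have hg : LocallyIntegrable g volume :=
    (locallyIntegrable_const (1 : ℝ)).indicator hT
  have key (z w : ℂ) (h : w ∈ ball z δ) :
      infDist w S ≤ infDist z S + δ ∧ infDist z S ≤ infDist w S + δ := by
    have h' := mem_ball.1 h
    refine ⟨infDist_le_infDist_add_dist.trans (by linarith),
      infDist_le_infDist_add_dist.trans (by rw [dist_comm]; linarith)⟩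
  refine ⟨convolution (φ.normed volume) g (ContinuousLinearMap.lsmul ℝ ℝ) volume, ?_, ?_, ?_, ?_⟩
  · exact φ.hasCompactSupport_normed.contDiff_convolution_left _ φ.contDiff_normed hg
  · intro z hz
    have h0 : ∀ w ∈ ball z δ, g w = 0 := fun w hw =>
      indicator_of_notMem (s := T)
        (fun h => by linarith [key z w hw, show 2 * δ ≤ infDist w S from h]) _
    rw [φ.normed_convolution_eq_right, h0 z (mem_ball_self hδ)]
    intro w hw
    rw [h0 w hw, h0 z (mem_ball_self hδ)]
  · intro z hz
    have h1 : ∀ w ∈ ball z δ, g w = 1 := fun w hw =>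
      indicator_of_mem (s := T) (show 2 * δ ≤ infDist w S by linarith [key z w hw]) _
    rw [φ.normed_convolution_eq_right, h1 z (mem_ball_self hδ)]
    intro w hw
    rw [h1 w hw, h1 z (mem_ball_self hδ)]
  · intro l hl z
    simp only [convolution_def]
    congr 1
    ext t
    congr 1
    have : z + l - t ∈ T ↔ z - t ∈ T := by
      simp only [T, mem_ofPred_eq]
      rw [← hl (z - t), show z - t + l = z + l - t by ring]
    simp only [g, indicator, this, Pi.one_apply]

end Cutoff

section PoleMoving

open Filter Topology

namespace PeriodPair

variable (L : PeriodPair)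

open Classical in
/-- The function `z ↦ κ(z, w)` as a continuous function on `K` (zero if it is not continuous). -/
noncomputable def kappaMap (K : Set ℂ) (w : ℂ) : C(K, ℂ) :=
  if h : Continuous fun z : K => L.kappa z w then ⟨_, h⟩ else 0

variable {L} {K : Set ℂ}

theorem kappaMap_apply {w : ℂ} (hw : ∀ z ∈ K, (z, w) ∈ L.kappaDomain) (z : K) :
    L.kappaMap K w z = L.kappa z w := by
  have h : Continuous fun z : K => L.kappa z w := by
    refine continuous_iff_continuousAt.2 fun z => ?_
    obtain ⟨h1, h2, h3⟩ := hw z z.2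
    exact ContinuousAt.comp (g := fun z : ℂ => L.kappa z w)
      (differentiableAt_kappa_left h1 h2 h3).continuousAt continuousAt_subtype_val
  rw [kappaMap, dif_pos h]
  rfl

theorem continuousOn_kappaMap {D : Set ℂ} (hD : ∀ w ∈ D, ∀ z ∈ K, (z, w) ∈ L.kappaDomain) :
    ContinuousOn (L.kappaMap K) D := by
  rw [continuousOn_iff_continuous_domRestrict]
  refine ContinuousMap.continuous_of_continuous_uncurry _ ?_
  have : (Function.uncurry fun (w : D) (z : K) => D.domRestrict (L.kappaMap K) w z) =
      fun p : D × K => L.kappa p.2 p.1 := by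
    ext ⟨w, z⟩
    exact kappaMap_apply (hD w w.2) z
  rw [this]
  refine continuous_iff_continuousAt.2 fun p => ?_
  exact ContinuousAt.comp (g := fun q : ℂ × ℂ => L.kappa q.1 q.2)
    (f := fun p : D × K => ((p.2 : ℂ), (p.1 : ℂ)))
    (differentiableAt_kappa (hD p.1 p.1.2 p.2 p.2.2)).continuousAt (by fun_prop)

theorem eventually_kappaMap_mem [CompactSpace K] {A : Subalgebra ℂ C(K, ℂ)}
    (hA : IsClosed (A : Set C(K, ℂ))) {x : C(K, ℂ)} (hxA : x ∈ A)
    (hx : ∀ z : K, x z = L.weierstrassP z) {u : ℂ}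
    (hu : ∀ᶠ w in 𝓝 u, ∀ z ∈ K, (z, w) ∈ L.kappaDomain) (hul : u ∉ L.lattice)
    (huA : L.kappaMap K u ∈ A) : ∀ᶠ w in 𝓝 u, L.kappaMap K w ∈ A := by
  have hu0 := hu.self_of_nhds
  rw [← nhdsNE_sup_pure, eventually_sup, eventually_pure]
  refine ⟨?_, huA⟩
  filter_upwards [eventually_mem_kappaDomain hul, hu.filter_mono nhdsWithin_le_nhds,
    eventually_weierstrassP_ne hul,
    (tendsto_norm_kappa_atTop hul).eventually_gt_atTop ‖L.kappaMap K u‖] with w h1 h2 h3 h4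
  have h5 : (w, u) ∈ L.kappaDomain :=
    ⟨h1.2.1, h1.1, fun h => h1.2.2 (by simpa using neg_mem h)⟩
  have ht : L.kappa u w ≠ 0 := fun h => by
    rw [h, norm_zero] at h4
    exact absurd h4 (norm_nonneg _).not_gt
  have : CompleteSpace A := hA.completeSpace_coe
  let q : A := ⟨-(L.kappa u w)⁻¹ • L.kappaMap K u, A.smul_mem huA _⟩
  have hq : ‖q‖ < 1 := by
    change ‖-(L.kappa u w)⁻¹ • L.kappaMap K u‖ < 1
    rw [norm_smul, norm_neg, norm_inv, inv_mul_lt_iff₀ (norm_pos_iff.2 ht), mul_one]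
    exact h4
  obtain ⟨b, hb⟩ := (isUnit_one_sub_of_norm_lt_one hq).exists_left_inv
  have hb' : ∀ z : K, (b : C(K, ℂ)) z * (1 - -(L.kappa u w)⁻¹ * L.kappa z u) = 1 := by
    intro z
    have := congrArg (fun a : A => (a : C(K, ℂ)) z) hb
    simpa [q, kappaMap_apply hu0] using this
  have hmem : (b : C(K, ℂ)) * ((L.kappa u w)⁻¹ • ((4 : ℂ) • x +
      (4 * (L.weierstrassP u + L.weierstrassP w) - L.kappa w u ^ 2) • (1 : C(K, ℂ)))) -
        (L.kappa w u) • (1 : C(K, ℂ)) ∈ A :=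
    A.sub_mem (A.mul_mem b.2 (A.smul_mem (A.add_mem (A.smul_mem hxA _) (A.smul_mem A.one_mem _)) _))
      (A.smul_mem A.one_mem _)
  convert hmem using 1
  ext z
  have key := kappa_sub_mul_kappa_add (hu0 z z.2) (h2 z z.2) h5 h3
  have hbz := hb' z
  simp only [ContinuousMap.sub_apply, ContinuousMap.mul_apply, ContinuousMap.smul_apply,
    ContinuousMap.add_apply, ContinuousMap.one_apply, smul_eq_mul, mul_one, hx z,
    kappaMap_apply h2]
  rw [kappa_swap u w] at key ⊢
  rw [← key]
  have : (L.kappa u w)⁻¹ * L.kappa u w = 1 := inv_mul_cancel₀ ht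
  linear_combination (-(L.kappa z w) + L.kappa u w) * hbz - (b : C(K, ℂ)) z *
    (L.kappa z w - L.kappa u w) * this

theorem kappaMap_mem_of_isPreconnected [CompactSpace K] {W V S : Set ℂ} (hW : IsOpen W)
    (hKW : ∀ z ∈ K, ∀ w ∈ W, z - w ∉ L.lattice) (hV : IsOpen V) (hLV : ∀ l ∈ L.lattice, l ∈ V)
    (hVW : V ⊆ W) (hVS : V ⊆ closure S) {A : Subalgebra ℂ C(K, ℂ)}
    (hA : IsClosed (A : Set C(K, ℂ))) {x : C(K, ℂ)} (hxA : x ∈ A)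
    (hx : ∀ z : K, x z = L.weierstrassP z) (hS : ∀ w ∈ S, L.kappaMap K w ∈ A)
    (hconn : ∀ w ∈ W, ∃ T ⊆ W, IsPreconnected T ∧ w ∈ T ∧ (T ∩ V).Nonempty)
    {w : ℂ} (hw : w ∈ W) (hwl : w ∉ L.lattice) : L.kappaMap K w ∈ A := by
  have hdom : ∀ w ∈ W \ (L.lattice : Set ℂ), ∀ z ∈ K, (z, w) ∈ L.kappaDomain := fun w hw z hz =>
    ⟨fun h => hKW z hz z (hVW (hLV z h)) (by simp), hw.2, hKW z hz w hw.1⟩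
  have hDo : IsOpen (W \ (L.lattice : Set ℂ)) := hW.sdiff L.isClosed_lattice
  have hcont := continuousOn_kappaMap hdom
  have hVA : ∀ u ∈ V, u ∉ L.lattice → L.kappaMap K u ∈ A := by
    intro u hu hul
    have huD : u ∈ W \ (L.lattice : Set ℂ) := ⟨hVW hu, hul⟩
    exact hA.mem_of_frequently_of_tendsto
      ((mem_closure_iff_frequently.1 (hVS hu)).mono fun v hv => hS v hv)
      (hcont.continuousAt (hDo.mem_nhds huD))
  let Z : Set ℂ := {w | w ∈ W ∧ (w ∉ L.lattice → L.kappaMap K w ∈ A)}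
  let Y : Set ℂ := (W \ (L.lattice : Set ℂ)) ∩ L.kappaMap K ⁻¹' (A : Set C(K, ℂ))ᶜ
  have hY : IsOpen Y := hcont.isOpen_inter_preimage hDo hA.isOpen_compl
  have hVZ : V ⊆ Z := fun u hu => ⟨hVW hu, hVA u hu⟩
  have hZ : IsOpen Z := by
    refine isOpen_iff_mem_nhds.2 fun u hu => ?_
    by_cases hul : u ∈ L.lattice
    · exact mem_of_superset (hV.mem_nhds (hLV u hul)) hVZ
    filter_upwards [hW.mem_nhds hu.1, eventually_kappaMap_mem hA hxA hx
      (eventually_of_mem (hDo.mem_nhds ⟨hu.1, hul⟩) hdom) hul (hu.2 hul)] with v h1 h2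
    exact ⟨h1, fun _ => h2⟩
  obtain ⟨T, hTW, hT, hwT, v, hvT, hvV⟩ := hconn w hw
  have hTZ : T ⊆ Z := by
    refine hT.subset_left_of_subset_union hZ hY ?_ ?_ ⟨v, hvT, hVZ hvV⟩
    · exact disjoint_left.2 fun u hu hu' => hu'.2 (hu.2 hu'.1.2)
    · intro u hu
      by_cases hul : u ∈ L.lattice
      · exact Or.inl ⟨hTW hu, fun h => absurd hul h⟩
      by_cases huA : L.kappaMap K u ∈ A
      · exact Or.inl ⟨hTW hu, fun _ => huA⟩
      · exact Or.inr ⟨⟨hTW hu, hul⟩, huA⟩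
  exact (hTZ hwT).2 hwl

end PeriodPair

end PoleMoving

section Cauchy

open Filter Topology MeasureTheory

namespace PeriodPair

variable (L : PeriodPair)

/-- The real linear isomorphism `(s, t) ↦ s ω₁ + t ω₂`. -/
noncomputable def coordMap : ℝ × ℝ →L[ℝ] ℂ :=
  (ContinuousLinearMap.fst ℝ ℝ ℝ).smulRight L.ω₁ + (ContinuousLinearMap.snd ℝ ℝ ℝ).smulRight L.ω₂

@[simp]
theorem coordMap_apply (p : ℝ × ℝ) : L.coordMap p = p.1 • L.ω₁ + p.2 • L.ω₂ := rfl

/-- A nonzero multiple of the Cauchy–Riemann operator, adapted to the periods. -/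
noncomputable def dbar (F : ℂ → ℂ) (w : ℂ) : ℂ :=
  L.ω₁ * fderiv ℝ F w L.ω₂ - L.ω₂ * fderiv ℝ F w L.ω₁

/-- The closed period parallelogram centred at the origin. -/
def cell : Set (ℝ × ℝ) := Icc (-1 / 2) (1 / 2) ×ˢ Icc (-1 / 2) (1 / 2)

theorem integral_dbar_eq_zero {Φ G : ℂ → ℂ} (hΦ : ∀ p ∈ cell, ContinuousAt Φ (L.coordMap p))
    (hG : Continuous G)
    (hd : ∀ p ∈ cell, p ≠ 0 → DifferentiableAt ℝ Φ (L.coordMap p))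
    (hdG : ∀ p ∈ cell, p ≠ 0 → L.dbar Φ (L.coordMap p) = G (L.coordMap p))
    (h₁ : ∀ t ∈ Icc (-1 / 2 : ℝ) (1 / 2),
      Φ (L.coordMap (1 / 2, t)) = Φ (L.coordMap (-1 / 2, t)))
    (h₂ : ∀ s ∈ Icc (-1 / 2 : ℝ) (1 / 2),
      Φ (L.coordMap (s, 1 / 2)) = Φ (L.coordMap (s, -1 / 2))) :
    ∫ s in (-1 / 2 : ℝ)..1 / 2, ∫ t in (-1 / 2 : ℝ)..1 / 2, G (L.coordMap (s, t)) = 0 := by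
  classical
  have hle : (-1 / 2 : ℝ) ≤ 1 / 2 := by norm_num
  have huIcc : uIcc (-1 / 2 : ℝ) (1 / 2) = Icc (-1 / 2) (1 / 2) := uIcc_of_le hle
  let T : ℝ × ℝ → ℝ × ℝ →L[ℝ] ℂ := fun p => (fderiv ℝ Φ (L.coordMap p)).comp L.coordMap
  let f' : ℝ × ℝ → ℝ × ℝ →L[ℝ] ℂ := fun p =>
    if p ∈ cell ∧ p ≠ 0 then -L.ω₂ • T p
    else (ContinuousLinearMap.fst ℝ ℝ ℝ).smulRight (G (L.coordMap p))
  let g' : ℝ × ℝ → ℝ × ℝ →L[ℝ] ℂ := fun p => if p ∈ cell ∧ p ≠ 0 then L.ω₁ • T p else 0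
  have hsum : ∀ p, f' p (1, 0) + g' p (0, 1) = G (L.coordMap p) := by
    intro p
    by_cases hp : p ∈ cell ∧ p ≠ 0
    · simp only [f', g', if_pos hp]
      rw [← hdG p hp.1 hp.2, dbar]
      simp [T]
      ring
    · simp [f', g', if_neg hp]
  have hcont : ContinuousOn (fun p => Φ (L.coordMap p)) cell := fun p hp =>
    (ContinuousAt.comp (f := L.coordMap) (hΦ p hp)
      L.coordMap.continuous.continuousAt).continuousWithinAt
  have hder : ∀ p ∈ cell, p ≠ 0 → HasFDerivAt (fun p => Φ (L.coordMap p)) (T p) p :=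
    fun p hp hp0 => (hd p hp hp0).hasFDerivAt.comp p L.coordMap.hasFDerivAt
  have hsub : ∀ p ∈ Ioo (min (-1 / 2 : ℝ) (1 / 2)) (max (-1 / 2) (1 / 2)) ×ˢ
      Ioo (min (-1 / 2 : ℝ) (1 / 2)) (max (-1 / 2) (1 / 2)) \ {0}, p ∈ cell ∧ p ≠ 0 := by
    rw [min_eq_left hle, max_eq_right hle]
    exact fun p hp => ⟨⟨Ioo_subset_Icc_self hp.1.1, Ioo_subset_Icc_self hp.1.2⟩, hp.2⟩
  have key := integral2_divergence_prod_of_hasFDerivAt_off_countable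
    (fun p => -L.ω₂ • Φ (L.coordMap p)) (fun p => L.ω₁ • Φ (L.coordMap p)) f' g'
    (-1 / 2) (-1 / 2) (1 / 2) (1 / 2) {0} (countable_singleton _)
    (by rw [huIcc]; exact hcont.fun_const_smul _) (by rw [huIcc]; exact hcont.fun_const_smul _)
    (fun p hp => by
      simp only [f', if_pos (hsub p hp)]
      exact (hder p (hsub p hp).1 (hsub p hp).2).fun_const_smul _)
    (fun p hp => by
      simp only [g', if_pos (hsub p hp)]
      exact (hder p (hsub p hp).1 (hsub p hp).2).fun_const_smul _)
    (by
      simp only [hsum]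
      rw [huIcc]
      exact (hG.comp L.coordMap.continuous).continuousOn.integrableOn_compact
        (isCompact_Icc.prod isCompact_Icc))
  simp only [hsum] at key
  rw [key]
  have e₁ : ∫ s in (-1 / 2 : ℝ)..1 / 2, L.ω₁ • Φ (L.coordMap (s, 1 / 2)) =
      ∫ s in (-1 / 2 : ℝ)..1 / 2, L.ω₁ • Φ (L.coordMap (s, -1 / 2)) :=
    intervalIntegral.integral_congr fun s hs => by
      rw [huIcc] at hs
      exact congrArg _ (h₂ s hs)
  have e₂ : ∫ t in (-1 / 2 : ℝ)..1 / 2, -L.ω₂ • Φ (L.coordMap (1 / 2, t)) =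
      ∫ t in (-1 / 2 : ℝ)..1 / 2, -L.ω₂ • Φ (L.coordMap (-1 / 2, t)) :=
    intervalIntegral.integral_congr fun t ht => by
      rw [huIcc] at ht
      exact congrArg _ (h₁ t ht)
  rw [e₁, e₂]
  ring

theorem exists_coordMap_eq (z : ℂ) : ∃ p, L.coordMap p = z := by
  refine ⟨(L.basis.repr z 0, L.basis.repr z 1), ?_⟩
  have := L.basis.sum_repr z
  simpa [Fin.sum_univ_two] using this

theorem integral_coordMap_add {q : ℂ → ℂ} (hq : ∀ l ∈ L.lattice, ∀ w, q (w + l) = q w) (z : ℂ) :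
    ∫ s in (-1 / 2 : ℝ)..1 / 2, ∫ t in (-1 / 2 : ℝ)..1 / 2, q (z + L.coordMap (s, t)) =
      ∫ s in (-1 / 2 : ℝ)..1 / 2, ∫ t in (-1 / 2 : ℝ)..1 / 2, q (L.coordMap (s, t)) := by
  obtain ⟨⟨a, b⟩, rfl⟩ := L.exists_coordMap_eq z
  have shift {f : ℝ → ℂ} (hf : Function.Periodic f 1) (c : ℝ) :
      ∫ s in (-1 / 2 : ℝ)..1 / 2, f (c + s) = ∫ s in (-1 / 2 : ℝ)..1 / 2, f s := by
    rw [intervalIntegral.integral_comp_add_left]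
    have := hf.intervalIntegral_add_eq (c + -1 / 2) (-1 / 2)
    convert this using 2 <;> ring
  have hper₂ (s : ℝ) : Function.Periodic (fun t : ℝ => q (L.coordMap (s, t))) 1 := fun t => by
    have := hq L.ω₂ (L.ω₂_mem_lattice) (L.coordMap (s, t))
    beta_reduce
    rw [← this]
    congr 1
    simp [add_smul]
    ring
  have hper₁ : Function.Periodic
      (fun s : ℝ => ∫ t in (-1 / 2 : ℝ)..1 / 2, q (L.coordMap (s, t))) 1 := fun s => by
    refine intervalIntegral.integral_congr fun t _ => ?_
    have := hq L.ω₁ (L.ω₁_mem_lattice) (L.coordMap (s, t))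
    rw [← this]
    congr 1
    simp [add_smul]
    ring
  rw [← shift hper₁ a]
  refine intervalIntegral.integral_congr fun s _ => ?_
  rw [← shift (hper₂ (a + s)) b]
  refine intervalIntegral.integral_congr fun t _ => ?_
  rw [← map_add, Prod.mk_add_mk]

end PeriodPair

end Cauchy

section Cauchy

open Filter Topology MeasureTheory

theorem hasDerivAt_max_zero_sq (x : ℝ) : HasDerivAt (fun y : ℝ => max 0 y ^ 2) (2 * max 0 x) x := by
  rcases lt_trichotomy x 0 with hx | rfl | hx
  · rw [max_eq_left hx.le, mul_zero]
    refine (hasDerivAt_const x (0 : ℝ)).congr_of_eventuallyEq ?_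
    filter_upwards [gt_mem_nhds hx] with y hy
    simp [max_eq_left hy.le]
  · rw [max_self, mul_zero]
    have : (fun y : ℝ => max 0 y ^ 2) =O[𝓝 0] fun y => ‖y - 0‖ ^ 2 := by
      refine Asymptotics.IsBigO.of_bound 1 (Eventually.of_forall fun y => ?_)
      rw [norm_pow, norm_pow, norm_norm, one_mul, sub_zero]
      gcongr
      rw [Real.norm_eq_abs, Real.norm_eq_abs, abs_of_nonneg (le_max_left _ _)]
      exact max_le (abs_nonneg _) (le_abs_self _)
    simpa using (this.hasFDerivAt one_lt_two).hasDerivAt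
  · rw [max_eq_right hx.le]
    have := (hasDerivAt_id x).fun_pow 2
    refine HasDerivAt.congr_of_eventuallyEq (by simpa using this) ?_
    filter_upwards [lt_mem_nhds hx] with y hy
    simp [max_eq_right hy.le]

namespace PeriodPair

variable (L : PeriodPair)

theorem coordMap_injective : Function.Injective L.coordMap := by
  refine (injective_iff_map_eq_zero L.coordMap).2 fun p hp => ?_
  have := LinearIndependent.pair_iff.1 L.indep p.1 p.2 hp
  exact Prod.ext this.1 this.2

theorem exists_le_norm_coordMap :
    ∃ ρ > 0, ∀ p : ℝ × ℝ, 1 / 2 ≤ ‖p‖ → ρ ≤ ‖L.coordMap p‖ := by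
  obtain ⟨K, hK, h⟩ := (L.coordMap : ℝ × ℝ →ₗ[ℝ] ℂ).exists_antilipschitzWith
    (LinearMap.ker_eq_bot.2 L.coordMap_injective)
  refine ⟨1 / 2 / K, by positivity, fun p hp => ?_⟩
  have := h.le_mul_dist p 0
  simp only [dist_zero_right, map_zero] at this
  rw [div_le_iff₀ (by positivity), mul_comm]
  exact hp.trans this

theorem mul_conj_sub_ne_zero :
    L.ω₁ * (starRingEnd ℂ) L.ω₂ - L.ω₂ * (starRingEnd ℂ) L.ω₁ ≠ 0 := by
  intro h
  have him : (L.ω₁ * (starRingEnd ℂ) L.ω₂).im = 0 := by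
    have := congrArg Complex.im h
    simp at this ⊢
    linarith
  have h0 : L.coordMap (normSq L.ω₂, -(L.ω₁ * (starRingEnd ℂ) L.ω₂).re) = 0 := by
    have h1 : L.ω₁ * (starRingEnd ℂ) L.ω₂ = ((L.ω₁ * (starRingEnd ℂ) L.ω₂).re : ℂ) :=
      Complex.ext rfl (by simpa using him)
    simp only [coordMap_apply, real_smul, ofReal_neg, ← h1, ← mul_conj]
    ring
  have h2 := L.coordMap_injective (h0.trans (map_zero _).symm)
  have h3 : L.ω₂ = 0 := normSq_eq_zero.1 (congrArg Prod.fst h2)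
  have h4 : ((0 : ℝ), (1 : ℝ)) = 0 := L.coordMap_injective (by simp [h3])
  exact one_ne_zero (congrArg Prod.snd h4)

/-- A compactly supported modification of `1 / u` whose image under the Cauchy–Riemann operator is
continuous and has nonzero mean. -/
theorem exists_cutoff_inv :
    ∃ B N : ℂ → ℂ, Continuous N ∧ (∀ u, u ≠ 0 → DifferentiableAt ℝ B u ∧ L.dbar B u = N u) ∧
      Tendsto (fun u => B u - u⁻¹) (𝓝[≠] 0) (𝓝 0) ∧
      (∀ p : ℝ × ℝ, 1 / 2 ≤ ‖p‖ → B (L.coordMap p) = 0) ∧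
      ∫ s in (-1 / 2 : ℝ)..1 / 2, ∫ t in (-1 / 2 : ℝ)..1 / 2, N (L.coordMap (s, t)) ≠ 0 := by
  obtain ⟨ρ, hρ, hρp⟩ := L.exists_le_norm_coordMap
  let m : ℂ → ℝ := fun u => max 0 (1 - (ρ ^ 2)⁻¹ * ‖u‖ ^ 2)
  let b : ℂ → ℂ := fun u => ((m u ^ 2 : ℝ) : ℂ)
  have hm : Continuous m := by fun_prop
  let b' : ℂ → ℂ →L[ℝ] ℂ := fun u =>
    ofRealCLM.comp ((2 * m u) • -((ρ ^ 2)⁻¹ • (2 • innerSL ℝ u)))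
  have hb (u : ℂ) : HasFDerivAt b (b' u) u := by
    have h1 : HasFDerivAt (fun v : ℂ => 1 - (ρ ^ 2)⁻¹ * ‖v‖ ^ 2)
        (-((ρ ^ 2)⁻¹ • (2 • innerSL ℝ u))) u := by
      exact ((hasStrictFDerivAt_norm_sq u).hasFDerivAt.fun_const_smul ((ρ ^ 2)⁻¹)).const_sub 1
    exact ofRealCLM.hasFDerivAt.comp u ((hasDerivAt_max_zero_sq _).comp_hasFDerivAt u h1)
  let N : ℂ → ℂ := fun u => (L.ω₁ * (starRingEnd ℂ) L.ω₂ - L.ω₂ * (starRingEnd ℂ) L.ω₁) *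
    ((-(2 * (ρ ^ 2)⁻¹) * m u : ℝ) : ℂ)
  refine ⟨fun u => b u * u⁻¹, N, by fun_prop, fun u hu => ?_, ?_, fun p hp => ?_, ?_⟩
  · have h1 : HasFDerivAt (fun v : ℂ => v⁻¹) _ u :=
      ((hasDerivAt_inv hu).hasFDerivAt).restrictScalars ℝ
    have h2 := (hb u).fun_mul h1
    refine ⟨h2.differentiableAt, ?_⟩
    rw [dbar, h2.fderiv]
    have hb' (v : ℂ) : b' u v =
        -(2 * m u * ((ρ : ℂ) ^ 2)⁻¹) * (u * (starRingEnd ℂ) v + v * (starRingEnd ℂ) u) := by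
      have h3 : u * (starRingEnd ℂ) v + v * (starRingEnd ℂ) u = ((2 * inner ℝ u v : ℝ) : ℂ) := by
        apply Complex.ext <;> simp <;> ring
      rw [h3]
      simp only [b', ContinuousLinearMap.comp_apply, smul_apply,
        neg_apply, innerSL_apply_apply, ofRealCLM_apply, smul_eq_mul,
        nsmul_eq_mul]
      push_cast
      ring
    simp [N, hb']
    field_simp
    ring
  · have h0 : b 0 = 1 := by simp [b, m]
    have hb0 : b' 0 = 0 := by simp [b']
    have h1 := hasFDerivAt_iff_isLittleO_nhds_zero.1 (hb 0)
    simp only [zero_add, h0, hb0, zero_apply, sub_zero] at h1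
    refine (h1.tendsto_div_nhds_zero.mono_left nhdsWithin_le_nhds).congr fun u => ?_
    rw [sub_div, div_eq_mul_inv, one_div]
  · have : m (L.coordMap p) = 0 := by
      refine max_eq_left (sub_nonpos.2 ?_)
      rw [← div_eq_inv_mul, one_le_div (by positivity)]
      exact pow_le_pow_left₀ hρ.le (hρp p hp) 2
    simp [b, this, -coordMap_apply]
  · simp only [N, intervalIntegral.integral_const_mul, intervalIntegral.integral_ofReal]
    refine mul_ne_zero L.mul_conj_sub_ne_zero (ofReal_ne_zero.2 (mul_ne_zero (by
      simpa using hρ.ne') (ne_of_gt ?_)))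
    have hcont : Continuous fun p : ℝ × ℝ => m (L.coordMap p) := hm.comp L.coordMap.continuous
    refine intervalIntegral.integral_pos (by norm_num) ?_ ?_ ⟨0, by norm_num, ?_⟩
    · exact (intervalIntegral.continuous_parametric_intervalIntegral_of_continuous' (μ := volume)
        (f := fun s t => m (L.coordMap (s, t))) hcont _ _).continuousOn
    · intro s _
      exact intervalIntegral.integral_nonneg (by norm_num) fun t _ => le_max_left _ _
    · refine intervalIntegral.integral_pos (by norm_num)
        (hcont.comp (Continuous.prodMk_right 0)).continuousOn (fun t _ => le_max_left _ _)
        ⟨0, by norm_num, ?_⟩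
      simp [m]

end PeriodPair

end Cauchy

section Cauchy

open Filter Topology MeasureTheory

namespace PeriodPair

variable {L : PeriodPair}

theorem dbar_congr {F G : ℂ → ℂ} {w : ℂ} (h : F =ᶠ[𝓝 w] G) : L.dbar F w = L.dbar G w := by
  rw [dbar, dbar, h.fderiv_eq]

theorem dbar_eq_zero {F : ℂ → ℂ} {w : ℂ} (h : DifferentiableAt ℂ F w) : L.dbar F w = 0 := by
  rw [dbar, (h.hasFDerivAt.restrictScalars ℝ).fderiv]
  simp only [ContinuousLinearMap.coe_restrictScalars']
  have hlin (v : ℂ) : fderiv ℂ F w v = v * fderiv ℂ F w 1 := by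
    rw [← smul_eq_mul, ← map_smul, smul_eq_mul, mul_one]
  rw [hlin L.ω₁, hlin L.ω₂]
  ring

theorem dbar_mul {F G : ℂ → ℂ} {w : ℂ} (hF : DifferentiableAt ℝ F w)
    (hG : DifferentiableAt ℂ G w) : L.dbar (fun u => F u * G u) w = L.dbar F w * G w := by
  have h0 := dbar_eq_zero (L := L) hG
  rw [dbar] at h0
  rw [dbar, (hF.hasFDerivAt.fun_mul (hG.restrictScalars ℝ).hasFDerivAt).fderiv, dbar]
  simp only [add_apply, smul_apply, smul_eq_mul]
  linear_combination F w * h0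

theorem dbar_add_const_mul {F G : ℂ → ℂ} {w : ℂ} (c : ℂ) (hF : DifferentiableAt ℝ F w)
    (hG : DifferentiableAt ℝ G w) :
    L.dbar (fun u => F u + c * G u) w = L.dbar F w + c * L.dbar G w := by
  rw [dbar, (hF.hasFDerivAt.fun_add (hG.hasFDerivAt.const_mul c)).fderiv, dbar, dbar]
  simp only [add_apply, smul_apply, smul_eq_mul]
  ring

theorem dbar_comp_add_left (F : ℂ → ℂ) (z w : ℂ) :
    L.dbar (fun u => F (z + u)) w = L.dbar F (z + w) := by
  rw [dbar, dbar, fderiv_comp_add_left]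

theorem dbar_comp_add_right (F : ℂ → ℂ) (z w : ℂ) :
    L.dbar (fun u => F (u + z)) w = L.dbar F (w + z) := by
  rw [dbar, dbar, fderiv_comp_add_right]

theorem continuous_dbar {F : ℂ → ℂ} (hF : ContDiff ℝ 1 F) : Continuous (L.dbar F) := by
  have := hF.continuous_fderiv one_ne_zero
  unfold dbar
  fun_prop

theorem coordMap_mem_lattice {p : ℝ × ℝ} (hp : p ∈ cell) (h : L.coordMap p ∈ L.lattice) :
    p = 0 := by
  obtain ⟨m, n, hmn⟩ := mem_lattice.1 h
  have h1 : p = ((m : ℝ), (n : ℝ)) := L.coordMap_injective (by rw [← hmn]; simp)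
  have aux (k : ℤ) (hk : (k : ℝ) ∈ Icc (-1 / 2 : ℝ) (1 / 2)) : k = 0 := by
    have h2 : (k : ℝ) < 1 := by linarith [hk.2]
    have h3 : (-1 : ℝ) < k := by linarith [hk.1]
    have h4 : k < 1 := by exact_mod_cast h2
    have h5 : -1 < k := by exact_mod_cast h3
    omega
  rw [h1] at hp
  rw [h1, aux m hp.1, aux n hp.2]
  simp

section Formula

variable {z : ℂ} {H : ℂ → ℂ}

theorem differentiableAt_mul_kappa (hz : z ∉ L.lattice) (hH : Differentiable ℝ H)
    (hlat : ∀ l ∈ L.lattice, H =ᶠ[𝓝 l] 0) {w : ℂ} (hw : z - w ∉ L.lattice) :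
    DifferentiableAt ℝ (fun w => H w * L.kappa z w) w ∧
      L.dbar (fun w => H w * L.kappa z w) w = L.dbar H w * L.kappa z w := by
  by_cases hwl : w ∈ L.lattice
  · have h : (fun w => H w * L.kappa z w) =ᶠ[𝓝 w] fun _ => 0 :=
      (hlat w hwl).mono fun u hu => by simp only [hu, Pi.zero_apply, zero_mul]
    refine ⟨h.differentiableAt_iff.2 (differentiableAt_const _), ?_⟩
    rw [dbar_congr h, dbar_congr (hlat w hwl), dbar_eq_zero (differentiableAt_const _),
      dbar_eq_zero (F := 0) (differentiableAt_const _), zero_mul]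
  · have h := differentiableAt_kappa_right hz hwl hw
    exact ⟨(hH w).fun_mul (h.restrictScalars ℝ), dbar_mul (hH w) h⟩

theorem continuous_dbar_mul_kappa (hz : z ∉ L.lattice) (hH : ContDiff ℝ 1 H)
    (hper : ∀ l ∈ L.lattice, ∀ w, H (w + l) = H w)
    (hlat : ∀ l ∈ L.lattice, H =ᶠ[𝓝 l] 0) (hhol : ∀ᶠ w in 𝓝 z, DifferentiableAt ℂ H w) :
    Continuous fun w => L.dbar H w * L.kappa z w := by
  refine continuous_iff_continuousAt.2 fun w => ?_
  have hzero (h : ∀ᶠ u in 𝓝 w, L.dbar H u = 0) :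
      ContinuousAt (fun w => L.dbar H w * L.kappa z w) w :=
    continuousAt_const.congr (f := fun _ => 0)
      (h.mono fun u hu => by simp only [hu, zero_mul])
  by_cases hwl : w ∈ L.lattice
  · refine hzero ((hlat w hwl).eventually_nhds.mono fun u hu => ?_)
    rw [dbar_congr hu, dbar_eq_zero (F := 0) (differentiableAt_const _)]
  by_cases hw : z - w ∈ L.lattice
  · have ht : Tendsto (fun u => u + (z - w)) (𝓝 w) (𝓝 z) := by
      have := (continuous_id.fun_add (continuous_const (y := z - w))).tendsto w
      simpa using this
    refine hzero ((ht.eventually hhol).mono fun u hu => ?_)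
    have h1 := dbar_comp_add_right (L := L) H (z - w) u
    rw [dbar_eq_zero hu] at h1
    rw [← h1]
    congr 1
    ext v
    exact (hper _ hw v).symm
  · exact (continuous_dbar hH).continuousAt.mul
      (differentiableAt_kappa_right hz hwl hw).continuousAt

theorem exists_tendsto_mul_kappa_add_inv (hz : z ∉ L.lattice)
    (hhol : ∀ᶠ w in 𝓝 z, DifferentiableAt ℂ H w) :
    ∃ d, Tendsto (fun u => H (z + u) * L.kappa z (z + u) + 2 * H z * u⁻¹) (𝓝[≠] 0) (𝓝 d) := by
  let N : ℂ → ℂ := Function.update (fun w => (w - z) * L.kappa z w * H w) z (-2 * H z)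
  have hN : AnalyticAt ℂ N z := by
    refine analyticAt_of_differentiable_on_punctured_nhds_of_continuousAt ?_ ?_
    · filter_upwards [eventually_mem_kappaDomain hz, hhol.filter_mono nhdsWithin_le_nhds,
        self_mem_nhdsWithin] with w h1 h2 (h3 : w ≠ z)
      have h4 : DifferentiableAt ℂ (fun w => (w - z) * L.kappa z w * H w) w :=
        (DifferentiableAt.fun_mul (by fun_prop)
          (differentiableAt_kappa_right h1.1 h1.2.1 h1.2.2)).fun_mul h2
      refine h4.congr_of_eventuallyEq ?_
      filter_upwards [isOpen_ne.mem_nhds h3] with v hv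
      exact Function.update_of_ne hv _ _
    · exact continuousAt_update_same.2 ((tendsto_sub_mul_kappa hz).mul
        (hhol.self_of_nhds.continuousAt.tendsto.mono_left nhdsWithin_le_nhds))
  refine ⟨deriv N z, ?_⟩
  have h1 := hasDerivAt_iff_tendsto_slope_zero.1 hN.differentiableAt.hasDerivAt
  refine h1.congr' ?_
  filter_upwards [self_mem_nhdsWithin] with u (hu : u ≠ 0)
  have h2 : N z = -2 * H z := Function.update_self ..
  have h3 : N (z + u) = (z + u - z) * L.kappa z (z + u) * H (z + u) :=
    Function.update_of_ne (by simpa using hu) _ _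
  rw [h2, h3, smul_eq_mul, add_sub_cancel_left]
  field_simp
  ring

theorem integral_dbar_mul_kappa (hz : z ∉ L.lattice) (hH : ContDiff ℝ 1 H)
    (hper : ∀ l ∈ L.lattice, ∀ w, H (w + l) = H w)
    (hlat : ∀ l ∈ L.lattice, H =ᶠ[𝓝 l] 0) (hhol : ∀ᶠ w in 𝓝 z, DifferentiableAt ℂ H w)
    {B N : ℂ → ℂ} (hN : Continuous N)
    (hB : ∀ u, u ≠ 0 → DifferentiableAt ℝ B u ∧ L.dbar B u = N u)
    (hB0 : Tendsto (fun u => B u - u⁻¹) (𝓝[≠] 0) (𝓝 0))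
    (hBb : ∀ p : ℝ × ℝ, 1 / 2 ≤ ‖p‖ → B (L.coordMap p) = 0) :
    (∫ s in (-1 / 2 : ℝ)..1 / 2, ∫ t in (-1 / 2 : ℝ)..1 / 2,
        L.dbar H (L.coordMap (s, t)) * L.kappa z (L.coordMap (s, t))) =
      -(2 * H z) * ∫ s in (-1 / 2 : ℝ)..1 / 2, ∫ t in (-1 / 2 : ℝ)..1 / 2, N (L.coordMap (s, t)) := by
  obtain ⟨d, hd⟩ := exists_tendsto_mul_kappa_add_inv hz hhol
  let F : ℂ → ℂ := fun w => H w * L.kappa z w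
  let q : ℂ → ℂ := fun w => L.dbar H w * L.kappa z w
  let Ψ : ℂ → ℂ := fun u => F (z + u) + 2 * H z * B u
  let Φ : ℂ → ℂ := Function.update Ψ 0 d
  have hF : ∀ l ∈ L.lattice, ∀ w, F (w + l) = F w := fun l hl w => by
    simp only [F, hper l hl, kappa_add_coe_right _ _ hl]
  have hq : ∀ l ∈ L.lattice, ∀ w, q (w + l) = q w := fun l hl w => by
    have h := dbar_comp_add_right (L := L) H l w
    simp only [hper l hl] at h
    simp only [q, kappa_add_coe_right _ _ hl, ← h]
  have hqc : Continuous q := continuous_dbar_mul_kappa hz hH hper hlat hhol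
  have hΦ {u : ℂ} (hu : u ≠ 0) : Φ =ᶠ[𝓝 u] Ψ := by
    filter_upwards [isOpen_ne.mem_nhds hu] with v hv
    exact Function.update_of_ne hv _ _
  have hcell {p : ℝ × ℝ} (hp : p ∈ cell) (hp0 : p ≠ 0) : z - (z + L.coordMap p) ∉ L.lattice :=
    fun h => hp0 (coordMap_mem_lattice hp (by simpa using neg_mem h))
  have hne {p : ℝ × ℝ} (hp0 : p ≠ 0) : L.coordMap p ≠ 0 :=
    fun h => hp0 (L.coordMap_injective (h.trans (map_zero _).symm))
  have hdiff {p : ℝ × ℝ} (hp : p ∈ cell) (hp0 : p ≠ 0) :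
      DifferentiableAt ℝ Φ (L.coordMap p) ∧
        L.dbar Φ (L.coordMap p) = q (z + L.coordMap p) + 2 * H z * N (L.coordMap p) := by
    obtain ⟨h1, h2⟩ := differentiableAt_mul_kappa hz (hH.differentiable one_ne_zero) hlat
      (hcell hp hp0)
    obtain ⟨h3, h4⟩ := hB _ (hne hp0)
    have h5 : DifferentiableAt ℝ (fun u => F (z + u)) (L.coordMap p) :=
      (differentiableAt_comp_add_left z).2 h1
    refine ⟨(hΦ (hne hp0)).differentiableAt_iff.2 (h5.fun_add (h3.const_mul _)), ?_⟩
    rw [dbar_congr (hΦ (hne hp0)), dbar_add_const_mul _ h5 h3, dbar_comp_add_left, h2, h4]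
  have hbdry {p r : ℝ × ℝ} {l : ℂ} (hl : l ∈ L.lattice) (hp : 1 / 2 ≤ ‖p‖) (hr : 1 / 2 ≤ ‖r‖)
      (hpr : L.coordMap p = L.coordMap r + l) : Φ (L.coordMap p) = Φ (L.coordMap r) := by
    have h0 {p : ℝ × ℝ} (hp : 1 / 2 ≤ ‖p‖) : L.coordMap p ≠ 0 :=
      hne (norm_pos_iff.1 (one_half_pos.trans_le hp))
    rw [(hΦ (h0 hp)).self_of_nhds, (hΦ (h0 hr)).self_of_nhds]
    simp only [Ψ, hBb p hp, hBb r hr]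
    rw [hpr, ← add_assoc, hF l hl]
  have key : ∫ s in (-1 / 2 : ℝ)..1 / 2, ∫ t in (-1 / 2 : ℝ)..1 / 2,
      (q (z + L.coordMap (s, t)) + 2 * H z * N (L.coordMap (s, t))) = 0 := by
    refine L.integral_dbar_eq_zero (Φ := Φ) (G := fun u => q (z + u) + 2 * H z * N u)
      (fun p hp => ?_) (by fun_prop) (fun p hp hp0 => (hdiff hp hp0).1)
      (fun p hp hp0 => (hdiff hp hp0).2) (fun t _ => ?_) (fun s _ => ?_)
    · by_cases hp0 : p = 0
      · rw [hp0, map_zero]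
        refine continuousAt_update_same.2 ?_
        have h := hd.add (hB0.const_mul (2 * H z))
        rw [mul_zero, add_zero] at h
        refine h.congr fun u => ?_
        simp only [Ψ, F]
        ring
      · exact (hdiff hp hp0).1.continuousAt
    · refine hbdry L.ω₁_mem_lattice ?_ ?_ ?_
      · exact le_max_of_le_left (by norm_num)
      · exact le_max_of_le_left (by norm_num)
      · simp
        ring
    · refine hbdry L.ω₂_mem_lattice ?_ ?_ ?_
      · exact le_max_of_le_right (by norm_num)
      · exact le_max_of_le_right (by norm_num)
      · simp
        ring
  have hc : Continuous L.coordMap := L.coordMap.continuous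
  have hqz : Continuous fun p : ℝ × ℝ => q (z + L.coordMap p) := by fun_prop
  have hNz : Continuous fun p : ℝ × ℝ => 2 * H z * N (L.coordMap p) := by fun_prop
  have inner {f : ℝ × ℝ → ℂ} (hf : Continuous f) (s a b : ℝ) :
      IntervalIntegrable (fun t => f (s, t)) volume a b :=
    (hf.comp (Continuous.prodMk_right s)).intervalIntegrable _ _
  have outer {f : ℝ × ℝ → ℂ} (hf : Continuous f) (a b c d : ℝ) :
      IntervalIntegrable (fun s => ∫ t in c..d, f (s, t)) volume a b :=
    (intervalIntegral.continuous_parametric_intervalIntegral_of_continuous'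
      (f := fun s t => f (s, t)) hf _ _).intervalIntegrable _ _
  simp_rw [fun s => intervalIntegral.integral_add (inner hqz s (-1 / 2) (1 / 2))
    (inner hNz s (-1 / 2) (1 / 2))] at key
  rw [intervalIntegral.integral_add (outer hqz _ _ _ _) (outer hNz _ _ _ _),
    L.integral_coordMap_add hq] at key
  simp only [intervalIntegral.integral_const_mul] at key
  linear_combination key

end Formula

end PeriodPair

end Cauchy

section Cauchy

open Filter Topology MeasureTheory Metric

namespace PeriodPair

variable {L : PeriodPair}

theorem infDist_add_lattice {S : Set ℂ} (hS : ∀ l ∈ L.lattice, ∀ z, z + l ∈ S ↔ z ∈ S) {l : ℂ}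
    (hl : l ∈ L.lattice) (z : ℂ) : infDist (z + l) S = infDist z S := by
  have himage : (fun u => u + l) '' S = S := by
    ext u
    refine ⟨?_, fun hu => ⟨u - l, (hS l hl _).1 (by simpa using hu), by simp⟩⟩
    rintro ⟨v, hv, rfl⟩
    exact (hS l hl v).2 hv
  conv_lhs => rw [← himage]
  exact infDist_image (isometry_add_right l)

theorem contDiff_cutoff_mul {U : Set ℂ} (hU : IsOpen U) {h : ℂ → ℂ}
    (hh : DifferentiableOn ℂ h U) {χ : ℂ → ℝ} (hχ : ContDiff ℝ 1 χ) {δ : ℝ} (hδ : 0 < δ)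
    (hχ0 : ∀ z, infDist z Uᶜ < δ → χ z = 0) : ContDiff ℝ 1 fun z => (χ z : ℂ) * h z := by
  refine contDiff_iff_contDiffAt.2 fun z => ?_
  by_cases hz : z ∈ U
  · have h1 : ContDiffAt ℝ 1 h z := ((hh.contDiffOn hU).contDiffAt
      (hU.mem_nhds hz)).restrict_scalars ℝ
    exact (ofRealCLM.contDiff.comp hχ).contDiffAt.mul h1
  · have h1 : ∀ᶠ w in 𝓝 z, infDist w Uᶜ < δ :=
      (continuous_infDist_pt Uᶜ).continuousAt.eventually_lt_const
        ((infDist_zero_of_mem hz).trans_lt hδ)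
    refine (contDiffAt_const (c := (0 : ℂ))).congr_of_eventuallyEq ?_
    filter_upwards [h1] with w hw
    rw [hχ0 w hw, ofReal_zero, zero_mul]

theorem mem_of_kappaMap_mem {U : Set ℂ} (hU : IsOpen U)
    (hUL : ∀ l ∈ L.lattice, ∀ z, z + l ∈ U ↔ z ∈ U) (hLU : ∀ l ∈ L.lattice, l ∉ U) {h : ℂ → ℂ}
    (hh : DifferentiableOn ℂ h U) (hper : ∀ l ∈ L.lattice, ∀ z ∈ U, h (z + l) = h z)
    {K : Set ℂ} [CompactSpace K] {δ : ℝ} (hδ : 0 < δ) (hK : ∀ z ∈ K, 4 * δ ≤ infDist z Uᶜ)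
    {S : Submodule ℂ C(K, ℂ)} (hS : IsClosed (S : Set C(K, ℂ)))
    (hκ : ∀ w, infDist w Uᶜ < 4 * δ → w ∉ L.lattice → L.kappaMap K w ∈ S) :
    ∃ F ∈ S, ∀ z : K, F z = h z := by
  obtain ⟨χ, hχ, hχ0, hχ1, hχL⟩ := exists_contDiff_cutoff_infDist Uᶜ hδ
  have hUc : ∀ l ∈ L.lattice, ∀ z, z + l ∈ Uᶜ ↔ z ∈ Uᶜ := fun l hl z => not_congr (hUL l hl z)
  have hdist {l : ℂ} (hl : l ∈ L.lattice) (z : ℂ) := infDist_add_lattice hUc hl z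
  have hmem {z : ℂ} (hz : 0 < infDist z Uᶜ) : z ∈ U := by
    by_contra hzU
    exact hz.ne' (infDist_zero_of_mem hzU)
  have hKl (z : ℂ) (hz : z ∈ K) : z ∉ L.lattice := fun hl =>
    hLU z hl (hmem ((by positivity : 0 < 4 * δ).trans_le (hK z hz)))
  let H : ℂ → ℂ := fun z => (χ z : ℂ) * h z
  have hH : ContDiff ℝ 1 H := contDiff_cutoff_mul hU hh hχ hδ hχ0
  have hcont := continuous_infDist_pt Uᶜ
  have hH0 {z : ℂ} (hz : infDist z Uᶜ < δ) : H =ᶠ[𝓝 z] 0 := by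
    filter_upwards [hcont.continuousAt.eventually_lt_const hz] with w hw
    simp only [H, hχ0 w hw, ofReal_zero, zero_mul, Pi.zero_apply]
  have hH1 {z : ℂ} (hz : 3 * δ < infDist z Uᶜ) : H =ᶠ[𝓝 z] h := by
    filter_upwards [hcont.continuousAt.eventually_const_lt hz] with w hw
    simp only [H, hχ1 w hw.le, ofReal_one, one_mul]
  have hhol {z : ℂ} (hz : 3 * δ < infDist z Uᶜ) : DifferentiableAt ℂ H z :=
    (hH1 hz).differentiableAt_iff.2
      (hh.differentiableAt (hU.mem_nhds (hmem ((by positivity : 0 < 3 * δ).trans hz))))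
  have hHper : ∀ l ∈ L.lattice, ∀ z, H (z + l) = H z := by
    intro l hl z
    simp only [H, hχL l (hdist hl) z]
    by_cases hz : z ∈ U
    · rw [hper l hl z hz]
    · rw [hχ0 z (by rwa [infDist_zero_of_mem hz]), ofReal_zero, zero_mul, zero_mul]
  have hlat : ∀ l ∈ L.lattice, H =ᶠ[𝓝 l] 0 := fun l hl =>
    hH0 (by rwa [infDist_zero_of_mem (hLU l hl)])
  have hsupp (w : ℂ) : L.dbar H w = 0 ∨ δ ≤ infDist w Uᶜ ∧ infDist w Uᶜ ≤ 3 * δ := by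
    by_cases h1 : infDist w Uᶜ < δ
    · exact Or.inl (by rw [dbar_congr (hH0 h1), dbar_eq_zero (F := 0) (differentiableAt_const _)])
    by_cases h2 : 3 * δ < infDist w Uᶜ
    · exact Or.inl (dbar_eq_zero (hhol h2))
    · exact Or.inr ⟨not_lt.1 h1, not_lt.1 h2⟩
  let D : Set ℂ := {w | 0 < infDist w Uᶜ} ∩ {w | infDist w Uᶜ < 4 * δ}
  have hDo : IsOpen D := (isOpen_lt continuous_const hcont).inter (isOpen_lt hcont continuous_const)
  have hDdom : ∀ w ∈ D, ∀ z ∈ K, (z, w) ∈ L.kappaDomain := fun w hw z hz =>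
    ⟨hKl z hz, fun hl => hLU w hl (hmem hw.1), fun hl => by
      have h1 := hdist hl w
      rw [add_sub_cancel] at h1
      exact absurd (hK z hz) (not_le.2 (h1.trans_lt hw.2))⟩
  have hsuppD {w : ℂ} (hw : δ ≤ infDist w Uᶜ ∧ infDist w Uᶜ ≤ 3 * δ) : w ∈ D :=
    ⟨hδ.trans_le hw.1, hw.2.trans_lt (by linarith)⟩
  let G : ℂ → C(K, ℂ) := fun w => L.dbar H w • L.kappaMap K w
  have hGS (w : ℂ) : G w ∈ S := by
    rcases hsupp w with h0 | hw
    · simp only [G, h0, zero_smul, S.zero_mem]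
    · have hwD := hsuppD hw
      exact S.smul_mem _ (hκ w hwD.2 fun hl => hLU w hl (hmem hwD.1))
  have hGc : Continuous G := by
    refine continuous_iff_continuousAt.2 fun w => ?_
    have hzero (h : ∀ᶠ u in 𝓝 w, L.dbar H u = 0) : ContinuousAt G w :=
      continuousAt_const.congr (f := fun _ => 0)
        (h.mono fun u hu => by simp only [G, hu, zero_smul])
    by_cases h1 : infDist w Uᶜ < δ
    · refine hzero ?_
      filter_upwards [hcont.continuousAt.eventually_lt_const h1] with u hu
      rw [dbar_congr (hH0 hu), dbar_eq_zero (F := 0) (differentiableAt_const _)]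
    by_cases h2 : 3 * δ < infDist w Uᶜ
    · refine hzero ?_
      filter_upwards [hcont.continuousAt.eventually_const_lt h2] with u hu
      exact dbar_eq_zero (hhol hu)
    · exact (continuous_dbar hH).continuousAt.smul ((continuousOn_kappaMap hDdom).continuousAt
        (hDo.mem_nhds (hsuppD ⟨not_lt.1 h1, not_lt.1 h2⟩)))
  have hGz (z : K) (w : ℂ) : G w z = L.dbar H w * L.kappa z w := by
    rcases hsupp w with h0 | hw
    · simp only [G, h0, zero_smul, ContinuousMap.zero_apply, zero_mul]
    · simp only [G, ContinuousMap.smul_apply, smul_eq_mul, kappaMap_apply (hDdom w (hsuppD hw))]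
  obtain ⟨B, N, hN, hB, hB0, hBb, hJ⟩ := L.exists_cutoff_inv
  have formula (z : K) := integral_dbar_mul_kappa (hKl z z.2) hH hHper hlat
    (by
      have h1 : 3 * δ < infDist (z : ℂ) Uᶜ := by linarith [hK z z.2]
      exact (hcont.continuousAt.eventually_const_lt h1).mono fun w hw => hhol hw) hN hB hB0 hBb
  set J := ∫ s in (-1 / 2 : ℝ)..1 / 2, ∫ t in (-1 / 2 : ℝ)..1 / 2, N (L.coordMap (s, t)) with hJdef
  have : CompleteSpace S := hS.completeSpace_coe
  let GS : ℝ × ℝ → S := fun p => ⟨G (L.coordMap p), hGS _⟩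
  have hGSc : Continuous GS := (hGc.comp L.coordMap.continuous).subtype_mk _
  let I : S := ∫ s in (-1 / 2 : ℝ)..1 / 2, ∫ t in (-1 / 2 : ℝ)..1 / 2, GS (s, t)
  have hI (z : K) : (I : C(K, ℂ)) z = -(2 * h z) * J := by
    let ev : S →L[ℝ] ℂ := ((ContinuousMap.evalCLM ℂ z).comp S.subtypeL).restrictScalars ℝ
    have h1 : (I : C(K, ℂ)) z = ev I := rfl
    have houter : IntervalIntegrable (fun s => ∫ t in (-1 / 2 : ℝ)..1 / 2, GS (s, t)) volume
        (-1 / 2) (1 / 2) :=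
      (intervalIntegral.continuous_parametric_intervalIntegral_of_continuous'
        (f := fun s t => GS (s, t)) hGSc _ _).intervalIntegrable _ _
    rw [h1, ← ev.intervalIntegral_comp_comm houter]
    have hHz : H z = h z := (hH1 (by linarith [hK z z.2])).self_of_nhds
    rw [← hHz, ← formula z]
    refine intervalIntegral.integral_congr fun s _ => ?_
    have hinner : IntervalIntegrable (fun t => GS (s, t)) volume (-1 / 2) (1 / 2) :=
      (hGSc.comp (Continuous.prodMk_right s)).intervalIntegrable _ _
    rw [← ev.intervalIntegral_comp_comm hinner]
    exact intervalIntegral.integral_congr fun t _ => hGz z _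
  refine ⟨(-(2 * J))⁻¹ • (I : C(K, ℂ)), S.smul_mem _ I.2, fun z => ?_⟩
  rw [ContinuousMap.smul_apply, hI, smul_eq_mul]
  field_simp

end PeriodPair

end Cauchy

section Generators

open Filter Topology

/-- In a nonempty open set one can choose a dense sequence avoiding a countable set and on which a
map with countable fibres is injective. -/
theorem exists_dense_seq_injective {V C : Set ℂ} (hV : IsOpen V) (hVne : V.Nonempty)
    (hC : C.Countable) {p : ℂ → ℂ} (hp : ∀ c, {w | w ∉ C ∧ p w = c}.Countable) :
    ∃ α : ℕ → ℂ, (∀ j, α j ∈ V) ∧ (∀ j, α j ∉ C) ∧ Function.Injective (p ∘ α) ∧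
      V ⊆ closure (range α) := by
  let 𝓑 : Set (Set ℂ) := {B | B ∈ TopologicalSpace.countableBasis ℂ ∧ (B ∩ V).Nonempty}
  have h𝓑 : 𝓑.Countable := (TopologicalSpace.countable_countableBasis ℂ).mono fun B hB => hB.1
  have hbasis := TopologicalSpace.isBasis_countableBasis ℂ
  have h𝓑ne : 𝓑.Nonempty := by
    obtain ⟨v, hv⟩ := hVne
    obtain ⟨B, hB, hvB, -⟩ := hbasis.exists_subset_of_mem_open hv hV
    exact ⟨B, hB, v, hvB, hv⟩
  obtain ⟨e, he⟩ := h𝓑.exists_eq_range h𝓑ne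
  have he' (n : ℕ) : e n ∈ 𝓑 := he ▸ mem_range_self n
  have hex (n : ℕ) (F : Finset ℂ) :
      ∃ w ∈ e n ∩ V, w ∉ C ∧ ∀ x ∈ F, p x ≠ p w := by
    have hbad : (C ∪ ⋃ x ∈ F, {w | w ∉ C ∧ p w = p x}).Countable :=
      hC.union (F.countable_toSet.biUnion fun x _ => hp (p x))
    obtain ⟨w, hw, hwb⟩ := (hbad.dense_compl ℝ).inter_open_nonempty _
      ((hbasis.isOpen (he' n).1).inter hV) (he' n).2
    have hwC : w ∉ C := fun h => hwb (Or.inl h)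
    exact ⟨w, hw, hwC, fun x hx hxw => hwb (Or.inr (mem_biUnion hx ⟨hwC, hxw.symm⟩))⟩
  choose y hy hyC hyp using hex
  let s : ℕ → Finset ℂ := fun n => Nat.rec ∅ (fun k F => insert (y k F) F) n
  have hs (n : ℕ) : s (n + 1) = insert (y n (s n)) (s n) := rfl
  have hmono : Monotone s := monotone_nat_of_le_succ fun n => by
    rw [hs]
    exact Finset.subset_insert _ _
  have hlt {i j : ℕ} (hij : i < j) : p (y i (s i)) ≠ p (y j (s j)) :=
    hyp j (s j) _ (hmono (Nat.succ_le_of_lt hij) (by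
      rw [Nat.succ_eq_add_one, hs]
      exact Finset.mem_insert_self _ _))
  refine ⟨fun n => y n (s n), fun n => (hy n _).2, fun n => hyC n _, fun i j hij => ?_, ?_⟩
  · rcases lt_trichotomy i j with h | h | h
    · exact absurd hij (hlt h)
    · exact h
    · exact absurd hij.symm (hlt h)
  · intro v hv
    refine hbasis.mem_closure_iff.2 fun B hB hvB => ?_
    have hB' : B ∈ range e := he ▸ ⟨hB, v, hvB, hv⟩
    obtain ⟨n, rfl⟩ := hB'
    exact ⟨_, (hy n _).1, mem_range_self n⟩

namespace PeriodPair

variable (L : PeriodPair)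

theorem countable_weierstrassP_fiber (c : ℂ) :
    {w | w ∉ L.lattice ∧ L.weierstrassP w = c}.Countable := by
  have key (v : ℂ) :
      {w | w ∉ L.lattice ∧ L.weierstrassP w = c ∧ L.derivWeierstrassP w = v}.Countable := by
    rcases eq_empty_or_nonempty
      {w | w ∉ L.lattice ∧ L.weierstrassP w = c ∧ L.derivWeierstrassP w = v} with h | ⟨u, hu⟩
    · rw [h]
      exact countable_empty
    · refine (L.countable_lattice.image fun l => u + l).mono fun w hw => ?_
      exact ⟨w - u, L.sub_mem_lattice_of_weierstrassP_eq hw.1 hu.1 (hw.2.1.trans hu.2.1.symm)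
        (hw.2.2.trans hu.2.2.symm), by simp⟩
  obtain ⟨v, hv⟩ := IsAlgClosed.exists_pow_nat_eq (4 * c ^ 3 - L.g₂ * c - L.g₃) two_pos
  refine ((key v).union (key (-v))).mono fun w hw => ?_
  have h := L.derivWeierstrassP_sq w hw.1
  rw [hw.2, ← hv] at h
  rcases sq_eq_sq_iff_eq_or_eq_neg.1 h with h | h
  · exact Or.inl ⟨hw.1, hw.2, h⟩
  · exact Or.inr ⟨hw.1, hw.2, h⟩

/-- The cubic polynomial satisfied by the Weierstrass functions. -/
noncomputable def cubic : Polynomial ℂ :=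
  Polynomial.C 4 * Polynomial.X ^ 3 - Polynomial.C L.g₂ * Polynomial.X - Polynomial.C L.g₃

variable {L}

theorem eval_cubic (c : ℂ) : L.cubic.eval c = 4 * c ^ 3 - L.g₂ * c - L.g₃ := by
  simp [cubic]

theorem derivWeierstrassP_sq_eq_eval {z : ℂ} (hz : z ∉ L.lattice) :
    L.derivWeierstrassP z ^ 2 = L.cubic.eval (L.weierstrassP z) := by
  rw [eval_cubic, L.derivWeierstrassP_sq z hz]

variable (L)

theorem countable_derivWeierstrassP_zeros :
    {w | w ∉ L.lattice ∧ L.derivWeierstrassP w = 0}.Countable := by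
  have hne : L.cubic ≠ 0 := fun h => by
    have := congrArg (Polynomial.coeff · 3) h
    simp [cubic] at this
  refine (L.cubic.roots.toFinset.countable_toSet.biUnion
    fun c _ => L.countable_weierstrassP_fiber c).mono fun w hw => ?_
  refine mem_biUnion (x := L.weierstrassP w) ?_ ⟨hw.1, rfl⟩
  rw [Finset.mem_coe, Multiset.mem_toFinset, Polynomial.mem_roots hne, Polynomial.IsRoot,
    ← derivWeierstrassP_sq_eq_eval hw.1, hw.2, zero_pow two_ne_zero]

theorem exists_poles {V : Set ℂ} (hV : IsOpen V) (hVne : V.Nonempty) :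
    ∃ α : ℕ → ℂ, (∀ j, α j ∈ V) ∧ (∀ j, α j ∉ L.lattice) ∧
      (∀ j, L.derivWeierstrassP (α j) ≠ 0) ∧
      Function.Injective (fun j => L.weierstrassP (α j)) ∧ V ⊆ closure (range α) := by
  obtain ⟨α, h1, h2, h3, h4⟩ := exists_dense_seq_injective (p := L.weierstrassP) hV hVne
    (L.countable_lattice.union L.countable_derivWeierstrassP_zeros)
    (fun c => (L.countable_weierstrassP_fiber c).mono fun w hw =>
      And.intro (fun h => hw.1 (Or.inl h)) hw.2)
  have h2' (j : ℕ) : α j ∉ L.lattice := fun h => h2 j (Or.inl h)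
  exact ⟨α, h1, h2', fun j h => h2 j (Or.inr ⟨h2' j, h⟩), h3, h4⟩

variable {L}

theorem exists_norm_le_of_continuousOn {S : Set ℂ} (hS : IsClosed S)
    (hSL : ∀ l ∈ L.lattice, ∀ z, z + l ∈ S ↔ z ∈ S) {F : ℂ → ℂ} (hF : ContinuousOn F S)
    (hper : ∀ l ∈ L.lattice, ∀ z, F (z + l) = F z) : ∃ C, ∀ z ∈ S, ‖F z‖ ≤ C := by
  have hQ : IsCompact (L.coordMap '' (Icc 0 1 ×ˢ Icc 0 1) ∩ S) :=
    ((isCompact_Icc.prod isCompact_Icc).image L.coordMap.continuous).inter_right hS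
  obtain ⟨C, hC⟩ := hQ.exists_bound_of_continuousOn (hF.mono inter_subset_right)
  refine ⟨C, fun z hz => ?_⟩
  obtain ⟨⟨s, t⟩, rfl⟩ := L.exists_coordMap_eq z
  have hl : (⌊s⌋ : ℂ) * L.ω₁ + ⌊t⌋ * L.ω₂ ∈ L.lattice := mem_lattice.2 ⟨_, _, rfl⟩
  have heq : L.coordMap (s, t) = L.coordMap (Int.fract s, Int.fract t) +
      ((⌊s⌋ : ℂ) * L.ω₁ + ⌊t⌋ * L.ω₂) := by
    simp only [coordMap_apply, real_smul, ← Int.self_sub_floor]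
    push_cast
    ring
  rw [heq] at hz ⊢
  rw [hper _ hl]
  refine hC _ ⟨mem_image_of_mem _ ⟨⟨?_, ?_⟩, ?_, ?_⟩, (hSL _ hl _).1 hz⟩
  exacts [Int.fract_nonneg _, (Int.fract_lt_one _).le, Int.fract_nonneg _, (Int.fract_lt_one _).le]

end PeriodPair

end Generators

section PeriodicFunctions

open Filter Topology BoundedContinuousFunction

namespace PeriodPair

variable {L : PeriodPair} {U : Set ℂ}

/-- The bounded continuous functions on `U` that are holomorphic and periodic. -/
def holomorphicSubalgebra (L : PeriodPair) (U : Set ℂ) : Subalgebra ℂ (U →ᵇ ℂ) where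
  carrier := {F | ∃ f : ℂ → ℂ, DifferentiableOn ℂ f U ∧
    (∀ l ∈ L.lattice, ∀ z ∈ U, f (z + l) = f z) ∧ ∀ z : U, F z = f z}
  mul_mem' := by
    rintro F G ⟨f, hf, hfp, hF⟩ ⟨g, hg, hgp, hG⟩
    exact ⟨fun z => f z * g z, hf.fun_mul hg,
      fun l hl z hz => by simp only [hfp l hl z hz, hgp l hl z hz], fun z => by simp [hF, hG]⟩
  add_mem' := by
    rintro F G ⟨f, hf, hfp, hF⟩ ⟨g, hg, hgp, hG⟩
    exact ⟨fun z => f z + g z, hf.fun_add hg,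
      fun l hl z hz => by simp only [hfp l hl z hz, hgp l hl z hz], fun z => by simp [hF, hG]⟩
  algebraMap_mem' c := ⟨fun _ => c, differentiableOn_const c, fun _ _ _ _ => rfl, fun _ => rfl⟩

theorem isClosed_holomorphicSubalgebra (hU : IsOpen U)
    (hUL : ∀ l ∈ L.lattice, ∀ z, z + l ∈ U ↔ z ∈ U) :
    IsClosed (L.holomorphicSubalgebra U : Set (U →ᵇ ℂ)) := by
  refine IsSeqClosed.isClosed fun F G hF hG => ?_
  choose f hfd hfp hFf using hF
  rw [tendsto_iff_tendstoUniformly] at hG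
  classical
  let g : ℂ → ℂ := fun z => if h : z ∈ U then G ⟨z, h⟩ else 0
  have hg {z : ℂ} (hz : z ∈ U) : g z = G ⟨z, hz⟩ := dif_pos hz
  have hlim : TendstoUniformlyOn f g atTop U := by
    rw [Metric.tendstoUniformlyOn_iff]
    rw [Metric.tendstoUniformly_iff] at hG
    intro ε hε
    filter_upwards [hG ε hε] with n hn z hz
    rw [hg hz, ← hFf n ⟨z, hz⟩]
    exact hn ⟨z, hz⟩
  refine ⟨g, hlim.tendstoLocallyUniformlyOn.differentiableOn (.of_forall hfd) hU, ?_,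
    fun z => (hg z.2).symm⟩
  intro l hl z hz
  refine tendsto_nhds_unique (hlim.tendsto_at ((hUL l hl z).2 hz)) ?_
  simpa only [hfp _ l hl z hz] using hlim.tendsto_at hz

/-- The bounded continuous function on `U` obtained by restricting a periodic function which is
continuous on the closure of `U`. -/
theorem exists_boundedContinuousFunction
    (hUL : ∀ l ∈ L.lattice, ∀ z, z + l ∈ closure U ↔ z ∈ closure U) {F : ℂ → ℂ}
    (hF : ContinuousOn F (closure U)) (hper : ∀ l ∈ L.lattice, ∀ z, F (z + l) = F z) :
    ∃ G : U →ᵇ ℂ, ∀ z : U, G z = F z := by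
  obtain ⟨C, hC⟩ := exists_norm_le_of_continuousOn isClosed_closure hUL hF hper
  exact ⟨.ofNormedAddCommGroup (fun z : U => F z)
    (hF.mono subset_closure).domRestrict C fun z => hC z (subset_closure z.2), fun _ => rfl⟩

/-- Restriction of bounded continuous functions to a compact subset. -/
noncomputable def restrictCompact {K : Set ℂ} (hKU : K ⊆ U) : (U →ᵇ ℂ) →ₐ[ℂ] C(K, ℂ) :=
  (ContinuousMap.compRightAlgHom ℂ ℂ ⟨inclusion hKU, continuous_inclusion hKU⟩).comp
    (toContinuousMapₐ ℂ)

@[simp]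
theorem restrictCompact_apply {K : Set ℂ} (hKU : K ⊆ U) (F : U →ᵇ ℂ) (z : K) :
    restrictCompact hKU F z = F ⟨z, hKU z.2⟩ := rfl

theorem continuous_restrictCompact {K : Set ℂ} [CompactSpace K] (hKU : K ⊆ U) :
    Continuous (restrictCompact hKU) :=
  AddMonoidHomClass.continuous_of_bound (restrictCompact hKU) 1 fun F => by
    rw [one_mul, ContinuousMap.norm_le _ (norm_nonneg _)]
    exact fun z => F.norm_coe_le_norm _

theorem restrictCompact_mem_topologicalClosure {K : Set ℂ} [CompactSpace K] (hKU : K ⊆ U)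
    {F x g : U →ᵇ ℂ} (hF : F ∈ (Algebra.adjoin ℂ {x, g}).topologicalClosure) :
    restrictCompact hKU F ∈
      (Algebra.adjoin ℂ {restrictCompact hKU x, restrictCompact hKU g}).topologicalClosure := by
  have h := map_mem_closure (continuous_restrictCompact hKU) hF
    (t := Algebra.adjoin ℂ {restrictCompact hKU x, restrictCompact hKU g}) ?_
  · exact h
  · intro G hG
    have := (restrictCompact hKU).map_adjoin {x, g}
    rw [image_pair] at this
    rw [← this]
    exact Subalgebra.mem_map.2 ⟨G, hG, rfl⟩

theorem aeval_apply_eq_eval {X : Type*} [TopologicalSpace X] (x g : C(X, ℂ))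
    (P : MvPolynomial (Fin 2) ℂ) (z : X) :
    MvPolynomial.aeval ![x, g] P z = MvPolynomial.eval ![x z, g z] P := by
  induction P using MvPolynomial.induction_on with
  | C a => simp
  | add p q hp hq => simp [hp, hq]
  | mul_X p i hp => fin_cases i <;> simp [hp]

theorem exists_polynomial_of_mem_topologicalClosure {K : Set ℂ} [CompactSpace K] {x g F : C(K, ℂ)}
    (hF : F ∈ (Algebra.adjoin ℂ {x, g}).topologicalClosure) {ε : ℝ} (hε : 0 < ε) :
    ∃ P : MvPolynomial (Fin 2) ℂ, ∀ z : K, ‖F z - MvPolynomial.eval ![x z, g z] P‖ < ε := by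
  obtain ⟨G, hG, hFG⟩ := Metric.mem_closure_iff.1 hF ε hε
  obtain ⟨P, rfl⟩ := PoleSystem.mem_adjoin_pair_iff.1 hG
  refine ⟨P, fun z => ?_⟩
  rw [← aeval_apply_eq_eval, ← dist_eq_norm]
  exact (ContinuousMap.dist_apply_le_dist z).trans_lt hFG

end PeriodPair

end PeriodicFunctions

section TwoGenerators

open Filter Topology BoundedContinuousFunction Metric

namespace PeriodPair

variable {L : PeriodPair} {U : Set ℂ}

theorem add_mem_closure_iff {S : Set ℂ} (hS : ∀ l ∈ L.lattice, ∀ z, z + l ∈ S ↔ z ∈ S) {l : ℂ}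
    (hl : l ∈ L.lattice) (z : ℂ) : z + l ∈ closure S ↔ z ∈ closure S := by
  have h : (fun u => u + l) ⁻¹' S = S := by
    ext u
    exact hS l hl u
  have h2 := (Homeomorph.addRight l).preimage_closure S
  rw [Homeomorph.coe_addRight, h] at h2
  exact Set.ext_iff.1 h2 z

/-- A domain with `0` in the exterior: the Weierstrass functions and the functions `κ(·, αⱼ)`, with
`αⱼ` dense in the exterior, form a pole system of bounded functions. -/
theorem exists_poleSystem (hUL : ∀ l ∈ L.lattice, ∀ z, z + l ∈ U ↔ z ∈ U)
    (h0 : 0 ∉ closure U) : ∃ (Q : PoleSystem (U →ᵇ ℂ)) (α : ℕ → ℂ),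
      (∀ z : U, Q.x z = L.weierstrassP z) ∧ (∀ z : U, Q.y z = L.derivWeierstrassP z) ∧
      (∀ j, ∀ z : U, Q.k j z = L.kappa z (α j)) ∧ (∀ j, α j ∉ closure U) ∧
      (∀ j, α j ∉ L.lattice) ∧ (closure U)ᶜ ⊆ closure (range α) := by
  have hcl : ∀ l ∈ L.lattice, ∀ z, z + l ∈ closure U ↔ z ∈ closure U :=
    fun l hl z => add_mem_closure_iff hUL hl z
  have hLU {z : ℂ} (hz : z ∈ closure U) : z ∉ L.lattice := fun h =>
    h0 ((hcl z h 0).1 (by simpa using hz))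
  obtain ⟨α, hαV, hαL, hα', hαinj, hαV'⟩ :=
    L.exists_poles isClosed_closure.isOpen_compl ⟨0, h0⟩
  have hαU {z : ℂ} (hz : z ∈ closure U) (j : ℕ) : z - α j ∉ L.lattice := fun h =>
    hαV j ((hcl _ h _).1 (by simpa using hz))
  obtain ⟨x, hx⟩ := exists_boundedContinuousFunction (F := L.weierstrassP) hcl
    (fun z hz => (L.hasDerivAt_weierstrassP (hLU hz)).continuousAt.continuousWithinAt)
    fun l hl z => L.weierstrassP_add_coe z ⟨l, hl⟩
  obtain ⟨y, hy⟩ := exists_boundedContinuousFunction (F := L.derivWeierstrassP) hcl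
    (fun z hz => (L.hasDerivAt_derivWeierstrassP (hLU hz)).continuousAt.continuousWithinAt)
    fun l hl z => L.derivWeierstrassP_add_coe z ⟨l, hl⟩
  have hk (j : ℕ) : ∃ G : U →ᵇ ℂ, ∀ z : U, G z = L.kappa z (α j) :=
    exists_boundedContinuousFunction (F := fun z => L.kappa z (α j)) hcl
      (fun z hz => (differentiableAt_kappa_left (hLU hz) (hαL j)
        (hαU hz j)).continuousAt.continuousWithinAt)
      fun l hl z => kappa_add_coe z (α j) hl
  choose k hk using hk
  refine ⟨{ x := x, y := y, P := L.cubic, k := k, a := fun j => L.weierstrassP (α j)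
            v := fun j => L.derivWeierstrassP (α j), y_sq := ?_, rel := ?_
            v_sq := fun j => derivWeierstrassP_sq_eq_eval (hαL j), v_ne := hα', a_inj := hαinj },
    α, hx, hy, hk, hαV, hαL, hαV'⟩
  · ext z
    have h := derivWeierstrassP_sq_eq_eval (hLU (subset_closure z.2))
    rw [eval_cubic] at h
    simp [cubic, hx, hy, h, Algebra.algebraMap_eq_smul_one]
  · intro j
    ext z
    have hz := subset_closure z.2
    simpa [hx, hy, hk, Algebra.algebraMap_eq_smul_one] using
      kappa_mul_sub (hLU hz) (hαL j) (hαU hz j)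

/-- The key approximation: if all `κ(·, αⱼ)` lie in a closed subalgebra of `C(K, ℂ)`, then so does
the restriction to `K` of every periodic holomorphic function on `U`. -/
theorem exists_mem_of_kappaMap_mem (hU : IsOpen U)
    (hUL : ∀ l ∈ L.lattice, ∀ z, z + l ∈ U ↔ z ∈ U) (h0 : 0 ∉ closure U)
    (hcompl : ∀ z ∈ Uᶜ, (interior (connectedComponentIn Uᶜ z)).Nonempty) {h : ℂ → ℂ}
    (hh : DifferentiableOn ℂ h U) (hper : ∀ l ∈ L.lattice, ∀ z ∈ U, h (z + l) = h z) {K : Set ℂ}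
    [CompactSpace K] (hKU : K ⊆ U) {S : Set ℂ} (hS : (closure U)ᶜ ⊆ closure S)
    {A : Subalgebra ℂ C(K, ℂ)} (hA : IsClosed (A : Set C(K, ℂ))) {x : C(K, ℂ)} (hxA : x ∈ A)
    (hx : ∀ z : K, x z = L.weierstrassP z) (hSA : ∀ w ∈ S, L.kappaMap K w ∈ A) :
    ∃ F ∈ A, ∀ z : K, F z = h z := by
  have hcl : ∀ l ∈ L.lattice, ∀ z, z + l ∈ closure U ↔ z ∈ closure U :=
    fun l hl z => add_mem_closure_iff hUL hl z
  have hLV : ∀ l ∈ L.lattice, l ∈ (closure U)ᶜ := fun l hl h =>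
    h0 ((hcl l hl 0).1 (by simpa using h))
  have hVU : (closure U)ᶜ ⊆ Uᶜ := compl_subset_compl.2 subset_closure
  have hUne : (Uᶜ).Nonempty := ⟨0, hVU h0⟩
  have hUL' : ∀ l ∈ L.lattice, ∀ z, z + l ∈ Uᶜ ↔ z ∈ Uᶜ := fun l hl z => not_congr (hUL l hl z)
  obtain ⟨δ, hδ, hK⟩ : ∃ δ > 0, ∀ z ∈ K, 4 * δ ≤ infDist z Uᶜ := by
    rcases K.eq_empty_or_nonempty with rfl | hKne
    · exact ⟨1, one_pos, by simp⟩
    obtain ⟨z₀, hz₀, hmin⟩ := (isCompact_iff_compactSpace.2 ‹_›).exists_isMinOn hKne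
      (continuous_infDist_pt Uᶜ).continuousOn
    have hpos : 0 < infDist z₀ Uᶜ :=
      (hU.isClosed_compl.notMem_iff_infDist_pos hUne).1 (not_not.2 (hKU hz₀))
    exact ⟨infDist z₀ Uᶜ / 4, by positivity, fun z hz => by
      have := hmin hz
      rw [mem_ofPred_eq] at this
      linarith⟩
  let W : Set ℂ := {w | infDist w Uᶜ < 4 * δ}
  have hUW : Uᶜ ⊆ W := fun w hw => by
    change infDist w Uᶜ < 4 * δ
    rw [infDist_zero_of_mem hw]
    positivity
  have hW : IsOpen W := isOpen_lt (continuous_infDist_pt _) continuous_const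
  have hKW : ∀ z ∈ K, ∀ w ∈ W, z - w ∉ L.lattice := by
    intro z hz w hw hzw
    have h1 := infDist_add_lattice hUL' hzw w
    rw [add_sub_cancel] at h1
    exact (hK z hz).not_gt (h1 ▸ hw)
  refine mem_of_kappaMap_mem hU hUL (fun l hl h => hLV l hl (subset_closure h)) hh hper hδ hK
    (S := Subalgebra.toSubmodule A) hA fun w hw hwl => ?_
  refine kappaMap_mem_of_isPreconnected hW hKW isClosed_closure.isOpen_compl hLV (hVU.trans hUW) hS
    hA hxA hx hSA (fun u hu => ?_) hw hwl
  obtain ⟨p, hp, hup⟩ := (infDist_lt_iff hUne).1 hu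
  have hpC := mem_connectedComponentIn hp
  refine ⟨segment ℝ u p ∪ connectedComponentIn Uᶜ p, ?_, ?_, Or.inl (left_mem_segment ℝ u p), ?_⟩
  · refine union_subset (fun v hv => ?_) ((connectedComponentIn_subset _ _).trans hUW)
    refine (infDist_le_dist_of_mem hp).trans_lt (lt_of_le_of_lt ?_ hup)
    rw [dist_comm v, dist_comm u]
    exact (convex_closedBall p (dist p u)).segment_subset (by simp [dist_comm])
      (mem_closedBall_self dist_nonneg) hv |> fun h => by simpa [dist_comm] using h
  · exact (convex_segment u p).isPreconnected.union p (right_mem_segment ℝ u p) hpC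
      isPreconnected_connectedComponentIn
  · obtain ⟨v, hv⟩ := hcompl p hp
    refine ⟨v, Or.inr (interior_subset hv), ?_⟩
    rw [← interior_compl]
    exact interior_mono (connectedComponentIn_subset _ _) hv

theorem exists_two_generators_of_zero_notMem (hU : IsOpen U)
    (hUL : ∀ l ∈ L.lattice, ∀ z, z + l ∈ U ↔ z ∈ U) (h0 : 0 ∉ closure U)
    (hcompl : ∀ z ∈ Uᶜ, (interior (connectedComponentIn Uᶜ z)).Nonempty) :
    ∃ f g : ℂ → ℂ, DifferentiableOn ℂ f U ∧ DifferentiableOn ℂ g U ∧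
      (∀ l ∈ L.lattice, ∀ z ∈ U, f (z + l) = f z) ∧
      (∀ l ∈ L.lattice, ∀ z ∈ U, g (z + l) = g z) ∧
      ∀ h : ℂ → ℂ, DifferentiableOn ℂ h U → (∀ l ∈ L.lattice, ∀ z ∈ U, h (z + l) = h z) →
        ∀ K : Set ℂ, IsCompact K → K ⊆ U → ∀ ε > (0 : ℝ),
          ∃ P : MvPolynomial (Fin 2) ℂ,
            ∀ z ∈ K, ‖h z - MvPolynomial.eval ![f z, g z] P‖ < ε := by
  obtain ⟨Q, α, hx, hy, hk, hαU, hαL, hα⟩ := exists_poleSystem hUL h0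
  have hLU {z : ℂ} (hz : z ∈ closure U) : z ∉ L.lattice := fun h =>
    h0 ((add_mem_closure_iff hUL h 0).1 (by simpa using hz))
  have hαz {z : ℂ} (hz : z ∈ U) (j : ℕ) : z - α j ∉ L.lattice := fun h =>
    hαU j ((add_mem_closure_iff hUL h _).1 (by simpa using subset_closure hz))
  obtain ⟨G, hG, -, hkG⟩ := Q.exists_generator
  have hd {z : ℂ} (hz : z ∈ U) := hLU (subset_closure hz)
  have hle : (Algebra.adjoin ℂ ({Q.x, Q.y} ∪ range Q.k)).topologicalClosure ≤
      L.holomorphicSubalgebra U := by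
    refine Subalgebra.topologicalClosure_minimal (Algebra.adjoin_le ?_)
      (isClosed_holomorphicSubalgebra hU hUL)
    rintro F ((rfl | rfl) | ⟨j, rfl⟩)
    · exact ⟨_, fun z hz =>
          (L.hasDerivAt_weierstrassP (hd hz)).differentiableAt.differentiableWithinAt,
        fun l hl z _ => L.weierstrassP_add_coe z ⟨l, hl⟩, hx⟩
    · exact ⟨_, fun z hz =>
          (L.hasDerivAt_derivWeierstrassP (hd hz)).differentiableAt.differentiableWithinAt,
        fun l hl z _ => L.derivWeierstrassP_add_coe z ⟨l, hl⟩, hy⟩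
    · exact ⟨_, fun z hz => (differentiableAt_kappa_left (hd hz) (hαL j)
          (hαz hz j)).differentiableWithinAt, fun l hl z _ => kappa_add_coe z (α j) hl, hk j⟩
  obtain ⟨g, hg, hgp, hGg⟩ := hle hG
  refine ⟨L.weierstrassP, g,
    fun z hz => (L.hasDerivAt_weierstrassP (hd hz)).differentiableAt.differentiableWithinAt, hg,
    fun l hl z _ => L.weierstrassP_add_coe z ⟨l, hl⟩, hgp, ?_⟩
  intro h hh hper K hK hKU ε hε
  have : CompactSpace K := isCompact_iff_compactSpace.1 hK
  obtain ⟨F, hF, hFh⟩ := exists_mem_of_kappaMap_mem hU hUL h0 hcompl hh hper hKU hα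
    (A := (Algebra.adjoin ℂ {restrictCompact hKU Q.x, restrictCompact hKU G}).topologicalClosure)
    (Subalgebra.isClosed_topologicalClosure _)
    (Subalgebra.le_topologicalClosure _ (Algebra.subset_adjoin (mem_insert _ _)))
    (fun z => hx _) (by
      rintro _ ⟨j, rfl⟩
      convert restrictCompact_mem_topologicalClosure hKU (hkG j) using 1
      ext z
      rw [kappaMap_apply (fun z hz => ⟨hd (hKU hz), hαL j, hαz (hKU hz) j⟩), restrictCompact_apply,
        hk])
  obtain ⟨P, hP⟩ := exists_polynomial_of_mem_topologicalClosure hF hε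
  refine ⟨P, fun z hz => ?_⟩
  simpa [hFh, hx, hGg] using hP ⟨z, hz⟩

end PeriodPair

end TwoGenerators

section Main

open Filter Topology Bornology

namespace PeriodPair

variable {L : PeriodPair} {U : Set ℂ}

theorem eq_of_differentiable_of_periodic {h : ℂ → ℂ} (hh : Differentiable ℂ h)
    (hper : ∀ l ∈ L.lattice, ∀ z, h (z + l) = h z) (z w : ℂ) : h z = h w := by
  obtain ⟨C, hC⟩ := exists_norm_le_of_continuousOn (L := L) isClosed_univ (by simp)
    hh.continuous.continuousOn hper
  refine hh.apply_eq_apply_of_bounded (isBounded_iff_forall_norm_le.2 ⟨C, ?_⟩) z w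
  rintro _ ⟨u, rfl⟩
  exact hC u (mem_univ u)

theorem exists_two_generators (hU : IsOpen U)
    (hUL : ∀ l ∈ L.lattice, ∀ z, z + l ∈ U ↔ z ∈ U)
    (hcompl : ∀ z ∈ Uᶜ, (interior (connectedComponentIn Uᶜ z)).Nonempty) :
    ∃ f g : ℂ → ℂ, DifferentiableOn ℂ f U ∧ DifferentiableOn ℂ g U ∧
      (∀ l ∈ L.lattice, ∀ z ∈ U, f (z + l) = f z) ∧
      (∀ l ∈ L.lattice, ∀ z ∈ U, g (z + l) = g z) ∧
      ∀ h : ℂ → ℂ, DifferentiableOn ℂ h U → (∀ l ∈ L.lattice, ∀ z ∈ U, h (z + l) = h z) →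
        ∀ K : Set ℂ, IsCompact K → K ⊆ U → ∀ ε > (0 : ℝ),
          ∃ P : MvPolynomial (Fin 2) ℂ,
            ∀ z ∈ K, ‖h z - MvPolynomial.eval ![f z, g z] P‖ < ε := by
  rcases (Uᶜ).eq_empty_or_nonempty with hUe | ⟨b, hb⟩
  · obtain rfl := compl_empty_iff.1 hUe
    refine ⟨0, 0, differentiableOn_const 0, differentiableOn_const 0, by simp, by simp, ?_⟩
    intro h hh hper K _ _ ε hε
    refine ⟨MvPolynomial.C (h 0), fun z _ => ?_⟩
    rw [eq_of_differentiable_of_periodic (differentiableOn_univ.1 hh)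
      (fun l hl z => hper l hl z (mem_univ z)) z 0]
    simpa using hε
  obtain ⟨a, ha⟩ := hcompl b hb
  have ha : a ∉ closure U := by
    rw [← mem_compl_iff, ← interior_compl]
    exact interior_mono (connectedComponentIn_subset _ _) ha
  let e := Homeomorph.addRight a
  have he (z : ℂ) : e z = z + a := rfl
  have hes (z : ℂ) : e.symm z = z - a := (sub_eq_add_neg z a).symm
  obtain ⟨f, g, hf, hg, hfp, hgp, hfg⟩ := exists_two_generators_of_zero_notMem (L := L)
    (U := e ⁻¹' U) (hU.preimage e.continuous)
    (fun l hl z => by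
      rw [mem_preimage, mem_preimage, he, he, add_right_comm]
      exact hUL l hl _)
    (by
      rw [← e.preimage_closure, mem_preimage, he, zero_add]
      exact ha)
    (fun z hz => by
      obtain ⟨w, hw⟩ := hcompl (e z) hz
      refine ⟨e.symm w, ?_⟩
      have h := e.symm.image_connectedComponentIn (show e z ∈ Uᶜ from hz)
      rw [e.image_symm, preimage_compl, e.symm_apply_apply] at h
      rw [← h, ← e.preimage_interior, mem_preimage, e.apply_symm_apply]
      exact hw)
  have hmaps : MapsTo (fun z => z - a) U (e ⁻¹' U) := fun z hz => by
    rwa [mem_preimage, he, sub_add_cancel]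
  have hd : DifferentiableOn ℂ (fun z : ℂ => z - a) U := by fun_prop
  refine ⟨fun z => f (z - a), fun z => g (z - a), hf.fun_comp hd hmaps, hg.fun_comp hd hmaps,
    fun l hl z hz => ?_, fun l hl z hz => ?_, fun h hh hper K hK hKU ε hε => ?_⟩
  · simpa only [sub_add_eq_add_sub] using hfp l hl _ (hmaps hz)
  · simpa only [sub_add_eq_add_sub] using hgp l hl _ (hmaps hz)
  · obtain ⟨P, hP⟩ := hfg (fun z => h (z + a))
      (hh.fun_comp (by fun_prop) fun z hz => hz)
      (fun l hl z hz => by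
        simp only [add_right_comm z l a]
        exact hper l hl _ hz)
      (e.symm '' K) (hK.image e.symm.continuous)
      (by
        rintro _ ⟨z, hz, rfl⟩
        rw [mem_preimage, e.apply_symm_apply]
        exact hKU hz) ε hε
    refine ⟨P, fun z hz => ?_⟩
    simpa [hes] using hP (e.symm z) (mem_image_of_mem _ hz)

end PeriodPair

theorem linearIndependent_one_of_im_pos {τ : ℂ} (hτ : 0 < τ.im) :
    LinearIndependent ℝ ![1, τ] := by
  rw [LinearIndependent.pair_iff]
  intro s t h
  have ht : t = 0 := by simpa [hτ.ne'] using congrArg im h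
  exact ⟨by simpa [ht] using congrArg re h, ht⟩

end Main

/-- **Theorem 2 (the algebra of functions on a torus domain is 2-generated).**
Let `τ ∈ ℂ` with `Im τ > 0` and `L = {m + n·τ : m, n ∈ ℤ}`.  Let `U ⊆ ℂ` be a nonempty
open `L`-invariant set which is connected modulo `L`, such that every connected
component of `ℂ ∖ U` has nonempty interior.  Then there are holomorphic `L`-periodic
functions `f, g` on `U` such that every holomorphic `L`-periodic function on `U` can be
approximated, uniformly on compact subsets of `U`, by polynomials in `f` and `g`. -/
theorem torus_domain_algebra_two_generated
    (τ : ℂ) (hτ : 0 < τ.im)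
    (L : Set ℂ) (hL : L = {ω : ℂ | ∃ m n : ℤ, ω = (m : ℂ) + (n : ℂ) * τ})
    (U : Set ℂ) (hUne : U.Nonempty) (hUopen : IsOpen U)
    (hUinv : ∀ ω ∈ L, ∀ z : ℂ, z ∈ U ↔ z + ω ∈ U)
    (hUconn : ∀ z ∈ U, ∀ w ∈ U, ∃ ω ∈ L, w + ω ∈ connectedComponentIn U z)
    (hcompl : ∀ z ∈ Uᶜ, (interior (connectedComponentIn Uᶜ z)).Nonempty) :
    ∃ f g : ℂ → ℂ,
      DifferentiableOn ℂ f U ∧ DifferentiableOn ℂ g U ∧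
      (∀ z ∈ U, ∀ ω ∈ L, f (z + ω) = f z) ∧
      (∀ z ∈ U, ∀ ω ∈ L, g (z + ω) = g z) ∧
      ∀ h : ℂ → ℂ, DifferentiableOn ℂ h U → (∀ z ∈ U, ∀ ω ∈ L, h (z + ω) = h z) →
        ∀ K : Set ℂ, IsCompact K → K ⊆ U → ∀ ε > (0 : ℝ),
          ∃ P : MvPolynomial (Fin 2) ℂ,
            ∀ z ∈ K, ‖h z - MvPolynomial.eval ![f z, g z] P‖ < ε := by
  let Λ : PeriodPair := ⟨1, τ, linearIndependent_one_of_im_pos hτ⟩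
  have hΛ (ω : ℂ) : ω ∈ L ↔ ω ∈ Λ.lattice := by
    rw [hL, PeriodPair.mem_lattice, mem_ofPred_eq]
    simp only [Λ, mul_one, eq_comm]
  obtain ⟨f, g, hf, hg, hfp, hgp, hfg⟩ := PeriodPair.exists_two_generators (L := Λ) hUopen
    (fun l hl z => (hUinv l ((hΛ l).2 hl) z).symm) hcompl
  exact ⟨f, g, hf, hg, fun z hz ω hω => hfp ω ((hΛ ω).1 hω) z hz,
    fun z hz ω hω => hgp ω ((hΛ ω).1 hω) z hz, fun h hh hper =>
      hfg h hh fun l hl z hz => hper z hz l ((hΛ l).2 hl)⟩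
end

section
/- The function G of two complex variables defined by G(λ, z) = 1/z² + Σ'_{(m,n) ∈ ℤ² ∖ {(0,0)}} [ 1/(z − (m + n·λ))² − 1/(m + n·λ)² ] is holomorphic (complex differentiable as a function of (λ, z) ∈ ℂ²) on the open set D = {(λ, z) ∈ ℂ × ℂ : Im λ > 0 and z ≠ m + n·λ for all m, n ∈ ℤ}. In particular, for each fixed λ with Im λ > 0, z ↦ G(λ, z) is the Weierstrass ℘-function of the lattice ℤ + ℤλ, and G is jointly holomorphic in the modulus λ and the variable z. -/
open Complex Set

open Filter Topology

/-- A series of holomorphic functions on a complex normed space with a summable bound on a ball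
is differentiable at the center of the ball. -/
lemma differentiableAt_tsum_of_summable_norm_ball {ι E F : Type*}
    [NormedAddCommGroup E] [NormedSpace ℂ E]
    [NormedAddCommGroup F] [NormedSpace ℂ F] [CompleteSpace F] {f : ι → E → F} {u : ι → ℝ}
    (hu : Summable u) {x : E} {r : ℝ} (hr : 0 < r)
    (hf : ∀ i, DifferentiableOn ℂ (f i) (Metric.ball x r))
    (hfu : ∀ i, ∀ y ∈ Metric.ball x r, ‖f i y‖ ≤ u i) :
    DifferentiableAt ℂ (fun y => ∑' i, f i y) x := by
  have hx : x ∈ Metric.ball x (r / 2) := Metric.mem_ball_self (half_pos hr)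
  have hsub : ∀ y ∈ Metric.ball x (r / 2), Metric.ball y (r / 2) ⊆ Metric.ball x r := by
    intro y hy
    apply Metric.ball_subset_ball'
    have := Metric.mem_ball.1 hy
    linarith
  have hpre : IsPreconnected (Metric.ball x (r / 2)) := by
    let _ : NormedSpace ℝ E := NormedSpace.restrictScalars ℝ ℂ E
    exact (convex_ball x (r / 2)).isPreconnected
  refine (hasFDerivAt_tsum_of_isPreconnected (𝕜 := ℂ) (f' := fun i y => fderiv ℂ (f i) y)
    (u := fun i => 2 * u i / (r / 2)) ((hu.mul_left 2).div_const _) Metric.isOpen_ball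
    hpre ?_ ?_ hx ?_ hx).differentiableAt
  · intro i y hy
    exact ((hf i).differentiableAt (Metric.isOpen_ball.mem_nhds
      (Metric.ball_subset_ball (by linarith) hy))).hasFDerivAt
  · intro i y hy
    refine norm_fderiv_le_div_of_mapsTo_ball ((hf i).mono (hsub y hy)) ?_ (half_pos hr)
    intro w hw
    rw [mem_closedBall_iff_norm]
    have h₁ := hfu i w (hsub y hy hw)
    have h₂ := hfu i y (Metric.ball_subset_ball (by linarith) hy)
    linarith [norm_sub_le (f i w) (f i y)]
  · exact .of_norm_bounded hu fun i => hfu i x (Metric.mem_ball_self hr)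

/-- A series of functions on a complex normed space, each differentiable at `x`, all but finitely
many of which are holomorphic with a summable bound on a common neighborhood of `x`, is
differentiable at `x`. -/
lemma differentiableAt_tsum_of_eventually_cofinite {ι E F : Type*}
    [NormedAddCommGroup E] [NormedSpace ℂ E]
    [NormedAddCommGroup F] [NormedSpace ℂ F] [CompleteSpace F] {f : ι → E → F} {u : ι → ℝ}
    (hu : Summable u) {x : E} {U : Set E} (hU : U ∈ 𝓝 x)
    (hfx : ∀ i, DifferentiableAt ℂ (f i) x)
    (hf : ∀ᶠ i in cofinite, DifferentiableOn ℂ (f i) U ∧ ∀ y ∈ U, ‖f i y‖ ≤ u i) :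
    DifferentiableAt ℂ (fun y => ∑' i, f i y) x := by
  obtain ⟨r, hr, hrU⟩ := Metric.mem_nhds_iff.1 hU
  let s : Finset ι := (eventually_cofinite.1 hf).toFinset
  have hs : ∀ i, i ∉ s → DifferentiableOn ℂ (f i) U ∧ ∀ y ∈ U, ‖f i y‖ ≤ u i := by
    intro i hi
    simpa [s] using hi
  have htail : DifferentiableAt ℂ (fun y => ∑' i : {i // i ∉ s}, f i y) x :=
    differentiableAt_tsum_of_summable_norm_ball (hu.comp_injective Subtype.val_injective) hr
      (fun i => (hs i i.2).1.mono hrU) (fun i y hy => (hs i i.2).2 y (hrU hy))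
  refine ((DifferentiableAt.fun_sum (u := s) fun i _ => hfx i).add htail).congr_of_eventuallyEq ?_
  filter_upwards [hU] with y hy
  refine (Summable.sum_add_tsum_subtype_compl (f := fun i => f i y) ?_ s).symm
  exact .of_norm_bounded_eventually hu (hf.mono fun i hi => hi.2 y hy)

/-- Locally uniform comparison, for `τ` near `τ₀` in the upper half plane, of the lattice point
`m + n * τ` with its vector of coordinates. -/
lemma exists_mul_norm_le_norm_add_mul {τ₀ : ℂ} (hτ₀ : 0 < τ₀.im) :
    ∃ c > 0, ∀ᶠ τ in 𝓝 τ₀, ∀ m n : ℤ, c * ‖![n, m]‖ ≤ ‖(m : ℂ) + n * τ‖ := by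
  have hB : 0 < τ₀.im / 2 := half_pos hτ₀
  refine ⟨EisensteinSeries.r ⟨⟨|τ₀.re| + 1, τ₀.im / 2⟩, hB⟩, EisensteinSeries.r_pos _, ?_⟩
  have him : ∀ᶠ τ : ℂ in 𝓝 τ₀, τ₀.im / 2 < τ.im :=
    continuous_im.continuousAt.eventually_const_lt (by linarith)
  have hre : ∀ᶠ τ : ℂ in 𝓝 τ₀, |τ.re| < |τ₀.re| + 1 :=
    (continuous_abs.comp continuous_re).continuousAt.eventually_lt_const
      (by simp)
  filter_upwards [him, hre] with τ hi hr m n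
  by_cases h : (![n, m] : Fin 2 → ℤ) = 0
  · simp [h]
  have hmem : (⟨τ, hB.trans hi⟩ : UpperHalfPlane) ∈
      UpperHalfPlane.verticalStrip (|τ₀.re| + 1) (τ₀.im / 2) := ⟨hr.le, hi.le⟩
  calc
    _ ≤ EisensteinSeries.r ⟨τ, hB.trans hi⟩ * ‖![n, m]‖ := by
      gcongr
      exact EisensteinSeries.r_lower_bound_on_verticalStrip _ hB hmem
    _ ≤ _ := by
      simpa [add_comm] using EisensteinSeries.r_mul_max_le ⟨τ, hB.trans hi⟩ h

lemma injective_coordinates_swap :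
    Function.Injective fun q : {q : ℤ × ℤ // q ≠ 0} => (![q.1.2, q.1.1] : Fin 2 → ℤ) := by
  intro p q h
  have h₀ := congrFun h 0
  have h₁ := congrFun h 1
  simp only [Matrix.cons_val_zero, Matrix.cons_val_one] at h₀ h₁
  exact Subtype.ext (Prod.ext h₁ h₀)

/-- **Lemma 4, first assertion (joint holomorphy of the Weierstrass ℘-function).**
The function `G(λ, z) = 1/z² + Σ'_{(m,n) ≠ (0,0)} [1/(z - (m + nλ))² - 1/(m + nλ)²]`
is holomorphic as a function of `(λ, z)` on the open set of pairs with `Im λ > 0` and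
`z` not a point of the lattice `ℤ + ℤλ`. -/
theorem weierstrassP_jointly_holomorphic :
    DifferentiableOn ℂ
      (fun p : ℂ × ℂ =>
        1 / p.2 ^ 2 +
          ∑' q : {q : ℤ × ℤ // q ≠ 0},
            (1 / (p.2 - (((q : ℤ × ℤ).1 : ℂ) + ((q : ℤ × ℤ).2 : ℂ) * p.1)) ^ 2 -
              1 / (((q : ℤ × ℤ).1 : ℂ) + ((q : ℤ × ℤ).2 : ℂ) * p.1) ^ 2))
      {p : ℂ × ℂ | 0 < p.1.im ∧ ∀ m n : ℤ, p.2 ≠ (m : ℂ) + (n : ℂ) * p.1} := by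
  rintro ⟨τ₀, z₀⟩ ⟨hτ₀, hz₀⟩
  simp only at hτ₀ hz₀
  apply DifferentiableAt.differentiableWithinAt
  obtain ⟨c, hc, hlow⟩ := exists_mul_norm_le_norm_add_mul hτ₀
  have hpos : ∀ q : {q : ℤ × ℤ // q ≠ 0}, 0 < ‖(![q.1.2, q.1.1] : Fin 2 → ℤ)‖ := by
    intro q
    rw [norm_pos_iff]
    intro h
    have h₀ := congrFun h 0
    have h₁ := congrFun h 1
    simp only [Matrix.cons_val_zero, Matrix.cons_val_one, Pi.zero_apply] at h₀ h₁
    exact q.2 (Prod.ext h₁ h₀)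
  have hdiff : ∀ (q : {q : ℤ × ℤ // q ≠ 0}) (p : ℂ × ℂ),
      p.2 ≠ (q.1.1 : ℂ) + q.1.2 * p.1 → (q.1.1 : ℂ) + q.1.2 * p.1 ≠ 0 →
      DifferentiableAt ℂ (fun p : ℂ × ℂ => 1 / (p.2 - ((q.1.1 : ℂ) + q.1.2 * p.1)) ^ 2 -
        1 / ((q.1.1 : ℂ) + q.1.2 * p.1) ^ 2) p := by
    intro q p h₁ h₂
    have h₃ := pow_ne_zero 2 (sub_ne_zero.2 h₁)
    have h₄ := pow_ne_zero 2 h₂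
    fun_prop (disch := assumption)
  have hne : ∀ (q : {q : ℤ × ℤ // q ≠ 0}) (τ : ℂ),
      c * ‖(![q.1.2, q.1.1] : Fin 2 → ℤ)‖ ≤ ‖(q.1.1 : ℂ) + q.1.2 * τ‖ →
      (q.1.1 : ℂ) + q.1.2 * τ ≠ 0 := fun q τ h =>
    norm_pos_iff.1 ((mul_pos hc (hpos q)).trans_le h)
  set R : ℝ := ‖z₀‖ + 1 with hR
  have hRpos : 0 < R := by positivity
  have hsum : Summable fun q : {q : ℤ × ℤ // q ≠ 0} =>
      10 * R * (c ^ (-3 : ℝ) * ‖(![q.1.2, q.1.1] : Fin 2 → ℤ)‖ ^ (-3 : ℝ)) :=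
    (((EisensteinSeries.summable_one_div_norm_rpow (k := 3) (by norm_num)).comp_injective
      injective_coordinates_swap).mul_left _).mul_left _
  have hlarge : ∀ᶠ q : {q : ℤ × ℤ // q ≠ 0} in cofinite,
      2 * R / c ≤ ‖(![q.1.2, q.1.1] : Fin 2 → ℤ)‖ := by
    have h : Tendsto (fun x : Fin 2 → ℤ => ‖x‖) cofinite atTop := by
      rw [← cocompact_eq_cofinite]
      exact tendsto_norm_cocompact_atTop
    exact (h.comp injective_coordinates_swap.tendsto_cofinite).eventually_ge_atTop _
  have hU : {p : ℂ × ℂ | (∀ m n : ℤ, c * ‖![n, m]‖ ≤ ‖(m : ℂ) + n * p.1‖) ∧ ‖p.2‖ < R} ∈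
      𝓝 (τ₀, z₀) := by
    have h₁ := (continuous_fst (X := ℂ) (Y := ℂ)).continuousAt (x := (τ₀, z₀)) |>.eventually hlow
    have h₂ : ∀ᶠ p : ℂ × ℂ in 𝓝 (τ₀, z₀), ‖p.2‖ < R :=
      continuous_snd.norm.continuousAt.eventually_lt_const (by simp [hR])
    exact h₁.and h₂
  have hz₀0 : z₀ ^ 2 ≠ 0 := pow_ne_zero 2 (by simpa using hz₀ 0 0)
  refine DifferentiableAt.add (by fun_prop (disch := assumption)) ?_
  refine differentiableAt_tsum_of_eventually_cofinite hsum hU ?_ ?_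
  · intro q
    exact hdiff q _ (hz₀ _ _) (hne q τ₀ (hlow.self_of_nhds _ _))
  · filter_upwards [hlarge] with q hq
    rw [div_le_iff₀' hc] at hq
    refine ⟨?_, ?_⟩
    · rintro p ⟨hp₁, hp₂⟩
      refine (hdiff q p ?_ (hne q p.1 (hp₁ _ _))).differentiableWithinAt
      intro h
      have := hp₁ q.1.1 q.1.2
      rw [← h] at this
      linarith
    · rintro p ⟨hp₁, hp₂⟩
      refine (PeriodPair.weierstrassP_bound R hRpos p.2 hp₂ _ (hq.trans (hp₁ _ _))).trans ?_
      rw [← Real.mul_rpow hc.le (norm_nonneg _)]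
      gcongr ?_ * ?_
      exact Real.rpow_le_rpow_of_nonpos (mul_pos hc (hpos q)) (hp₁ _ _) (by norm_num)
end

section
/- Let λ ∈ ℂ with Im λ ≠ 0, and let Ω ⊆ ℂ be an open set with 0 ∈ Ω, 1 ∈ Ω, λ ∈ Ω, and z + m + n·λ ∈ Ω for every z ∈ Ω and all m, n ∈ ℤ. Let g : Ω → ℂ be holomorphic and injective with g(0) = 0 and g(z + m + n·λ) = g(z) + m·g(1) + n·g(λ) for all z ∈ Ω and all m, n ∈ ℤ. Then g(1) and g(λ) are linearly independent over ℝ: if a, b ∈ ℝ satisfy a·g(1) + b·g(λ) = 0, then a = 0 and b = 0. -/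
open Complex Set

/-- Local open mapping property of an injective holomorphic function. -/
theorem nhds_le_map_nhds_of_injOn {Ω : Set ℂ} (hΩ : IsOpen Ω) {g : ℂ → ℂ}
    (hg : DifferentiableOn ℂ g Ω) (hinj : Set.InjOn g Ω) {z₀ : ℂ} (hz₀ : z₀ ∈ Ω) :
    nhds (g z₀) ≤ Filter.map g (nhds z₀) := by
  have hnhds : Ω ∈ nhds z₀ := hΩ.mem_nhds hz₀
  refine (hg.analyticAt hnhds).eventually_constant_or_nhds_le_map_nhds.resolve_left fun h => ?_
  have heq : ∀ᶠ z in nhds z₀, z = z₀ := by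
    filter_upwards [h, hnhds] with z hz hzΩ using hinj hzΩ hz₀ hz
  obtain ⟨z, hz, hne⟩ := ((heq.filter_mono nhdsWithin_le_nhds).and
    (self_mem_nhdsWithin (a := z₀) (s := {z₀}ᶜ))).exists
  exact hne hz

/-- Nonzero points of the lattice `ℤ + ℤλ` are bounded away from `0`. -/
theorem int_coeffs_eq_zero_of_norm_lt {lam : ℂ} {m n : ℤ}
    (h : ‖(m : ℂ) + (n : ℂ) * lam‖ < min 1 |lam.im|) : m = 0 ∧ n = 0 := by
  have hn : n = 0 := by
    have h' : |(n : ℝ)| * |lam.im| < 1 * |lam.im| := by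
      have him := Complex.abs_im_le_norm ((m : ℂ) + (n : ℂ) * lam)
      simp only [add_im, intCast_im, mul_im, intCast_re, zero_mul, add_zero, zero_add,
        abs_mul] at him
      linarith [min_le_right 1 |lam.im|]
    have h1 : |(n : ℝ)| < 1 := lt_of_mul_lt_mul_right h' (abs_nonneg _)
    exact Int.abs_lt_one_iff.mp (mod_cast h1)
  subst hn
  refine ⟨Int.abs_lt_one_iff.mp ?_, rfl⟩
  have h1 := h.trans_le (min_le_left _ _)
  simp only [Int.cast_zero, zero_mul, add_zero, Complex.norm_intCast] at h1
  exact_mod_cast h1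

/-- Integer combinations of two complex numbers on a common real line come arbitrarily close
to `0`. -/
theorem exists_int_combination_norm_lt (w : ℂ) (t : ℝ) {ε : ℝ} (hε : 0 < ε) :
    ∃ m n : ℤ, 0 < n ∧ ‖(m : ℂ) * w + (n : ℂ) * (t * w)‖ < ε := by
  obtain ⟨N, hN⟩ := exists_nat_gt (‖w‖ / ε)
  have hNpos : (0 : ℝ) < N := lt_of_le_of_lt (by positivity) hN
  obtain ⟨j, k, hk, -, hjk⟩ := Real.exists_int_int_abs_mul_sub_le t (Nat.cast_pos.mp hNpos)
  refine ⟨-j, k, hk, ?_⟩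
  have hfac : ((-j : ℤ) : ℂ) * w + (k : ℂ) * (t * w) = ((k * t - j : ℝ) : ℂ) * w := by
    push_cast
    ring
  rw [hfac, norm_mul, Complex.norm_real, Real.norm_eq_abs]
  calc |k * t - j| * ‖w‖ ≤ 1 / (N + 1) * ‖w‖ := by gcongr
    _ < ε := by
      rw [div_lt_iff₀ hε] at hN
      rw [one_div_mul_eq_div, div_lt_iff₀ (by positivity)]
      linarith

/-- **Period independence for equivariant univalent maps.**
Let `λ ∈ ℂ` with `Im λ ≠ 0`, and let `Ω ⊆ ℂ` be an open set containing `0, 1, λ` and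
invariant under translation by the lattice `ℤ + ℤλ`.  If `g` is holomorphic and injective
on `Ω`, `g(0) = 0`, and `g(z + m + nλ) = g(z) + m·g(1) + n·g(λ)` for all `z ∈ Ω` and
`m, n ∈ ℤ`, then `g(1)` and `g(λ)` are linearly independent over `ℝ`. -/
theorem periods_linearly_independent
    (lam : ℂ) (hlam : lam.im ≠ 0)
    (Ω : Set ℂ) (hΩ : IsOpen Ω)
    (h0 : (0 : ℂ) ∈ Ω) (h1 : (1 : ℂ) ∈ Ω) (hl : lam ∈ Ω)
    (hinv : ∀ z ∈ Ω, ∀ m n : ℤ, z + (m : ℂ) + (n : ℂ) * lam ∈ Ω)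
    (g : ℂ → ℂ) (hg : DifferentiableOn ℂ g Ω) (hginj : Set.InjOn g Ω)
    (hg0 : g 0 = 0)
    (heq : ∀ z ∈ Ω, ∀ m n : ℤ,
      g (z + (m : ℂ) + (n : ℂ) * lam) = g z + (m : ℂ) * g 1 + (n : ℂ) * g lam) :
    ∀ a b : ℝ, (a : ℂ) * g 1 + (b : ℂ) * g lam = 0 → a = 0 ∧ b = 0 := by
  have hsmall : Metric.ball (0 : ℂ) (min 1 |lam.im|) ∩ Ω ∈ nhds (0 : ℂ) :=
    Filter.inter_mem (Metric.ball_mem_nhds _ (by positivity)) (hΩ.mem_nhds h0)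
  have himage := nhds_le_map_nhds_of_injOn hΩ hg hginj h0 (Filter.image_mem_map hsmall)
  rw [hg0] at himage
  obtain ⟨ε, hε, hball⟩ := Metric.mem_nhds_iff.mp himage
  have hindep : ∀ t : ℝ, g lam ≠ t * g 1 := by
    intro t ht
    obtain ⟨m, n, hn, hmn⟩ := exists_int_combination_norm_lt (g 1) t hε
    rw [← ht] at hmn
    obtain ⟨z, ⟨hz, hzΩ⟩, hgz⟩ := hball (mem_ball_zero_iff.mpr hmn)
    have hval := heq 0 h0 m n
    have hmem := hinv 0 h0 m n
    rw [zero_add] at hval hmem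
    rw [hg0, zero_add, ← hgz] at hval
    rw [← hginj hmem hzΩ hval, mem_ball_zero_iff] at hz
    exact hn.ne' (int_coeffs_eq_zero_of_norm_lt hz).2
  have hg1 : g 1 ≠ 0 := fun h => one_ne_zero (hginj h1 h0 (h.trans hg0.symm))
  intro a b hab
  have hb : b = 0 := by
    by_contra hb
    have hb' : (b : ℂ) ≠ 0 := mod_cast hb
    refine hindep (-a / b) ?_
    push_cast
    field_simp
    linear_combination hab
  subst hb
  refine ⟨?_, rfl⟩
  simpa [hg1] using hab
end

section
/- Let N ≥ 1 and let K ⊆ ℂ^N × ℂ² be a compact set such that every point (y, v) ∈ K has y ∈ ℝ^N (i.e., all N coordinates of the first factor are real). Suppose that for every y ∈ ℝ^N the slice K_y = {v ∈ ℂ² : (y, v) ∈ K} is polynomially convex as a compact subset of ℂ². Then K is polynomially convex as a compact subset of ℂ^{N+2}. -/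
open Complex Set

/-- The polynomial hull of a set `K` of points of `ℂ^σ`: the points at which every complex
polynomial in the variables `σ` is bounded by its supremum of moduli over `K`. -/
noncomputable def polyHull {σ : Type*} (K : Set (σ → ℂ)) : Set (σ → ℂ) :=
  {z | ∀ P : MvPolynomial σ ℂ,
    ‖MvPolynomial.eval z P‖ ≤ sSup ((fun w => ‖MvPolynomial.eval w P‖) '' K)}

/-- A set `K ⊆ ℂ^σ` is polynomially convex if it equals its polynomial hull. -/
def IsPolyConvex {σ : Type*} (K : Set (σ → ℂ)) : Prop := polyHull K = K

/-- The identification of `ℂ^N × ℂ²` with `ℂ^{N+2}` (with variables indexed by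
`Fin N ⊕ Fin 2`). -/
def prodToFun (N : ℕ) (p : (Fin N → ℂ) × (ℂ × ℂ)) : (Fin N ⊕ Fin 2) → ℂ :=
  Sum.elim p.1 ![p.2.1, p.2.2]

theorem norm_eval_le_of_mem_polyHull {σ : Type*} {K : Set (σ → ℂ)} {z : σ → ℂ}
    (hz : z ∈ polyHull K) (P : MvPolynomial σ ℂ) {C : ℝ} (hC : 0 ≤ C)
    (h : ∀ w ∈ K, ‖MvPolynomial.eval w P‖ ≤ C) : ‖MvPolynomial.eval z P‖ ≤ C :=
  (hz P).trans (Real.sSup_le (forall_mem_image.2 h) hC)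

theorem IsCompact.subset_polyHull {σ : Type*} {K : Set (σ → ℂ)} (hK : IsCompact K) :
    K ⊆ polyHull K := fun z hz P =>
  le_csSup (hK.image (MvPolynomial.continuous_eval P).norm).bddAbove ⟨z, hz, rfl⟩

theorem continuous_prodToFun (N : ℕ) : Continuous (prodToFun N) := by
  refine continuous_pi ?_
  rintro (i | j)
  · simp only [prodToFun, Sum.elim_inl]; fun_prop
  · fin_cases j
    · exact continuous_fst.comp continuous_snd
    · exact continuous_snd.comp continuous_snd

/-- For `c > 0` small, this polynomial peaks at `a` on a bounded set of points whose
coordinates indexed by `ι` are real. -/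
noncomputable def peakPoly {ι : Type*} (τ : Type*) [Fintype ι] (a : ι → ℝ) (c : ℝ) :
    MvPolynomial (ι ⊕ τ) ℂ :=
  1 - MvPolynomial.C (c : ℂ) *
    ∑ i, (MvPolynomial.X (.inl i) - MvPolynomial.C (a i : ℂ)) ^ 2

section peakPoly

variable {ι τ : Type*} [Fintype ι] (a : ι → ℝ) (c : ℝ)

theorem eval_peakPoly_of_re_eq (z : ι ⊕ τ → ℂ) (hz : ∀ i, (z (.inl i)).re = a i) :
    MvPolynomial.eval z (peakPoly τ a c) =
      ((1 + c * ∑ i, (z (.inl i)).im ^ 2 : ℝ) : ℂ) := by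
  have h (i : ι) : (z (.inl i) - a i) ^ 2 = -(((z (.inl i)).im ^ 2 : ℝ) : ℂ) := by
    have : z (.inl i) - a i = (z (.inl i)).im * I := by
      rw [← hz i]; apply Complex.ext <;> simp
    rw [this, mul_pow, I_sq]; push_cast; ring
  simp [peakPoly, h]

theorem eval_peakPoly_of_im_eq_zero (z : ι ⊕ τ → ℂ) (hz : ∀ i, (z (.inl i)).im = 0) :
    MvPolynomial.eval z (peakPoly τ a c) =
      ((1 - c * ∑ i, ((z (.inl i)).re - a i) ^ 2 : ℝ) : ℂ) := by
  have h (i : ι) : z (.inl i) = ((z (.inl i)).re : ℂ) := by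
    apply Complex.ext <;> simp [hz]
  simp only [peakPoly, map_sub, map_mul, map_one, map_sum, map_pow, MvPolynomial.eval_C,
    MvPolynomial.eval_X]
  push_cast
  simp only [← h]

/-- On a compact set of points whose coordinates indexed by `ι` are real, a suitable `peakPoly`
takes values in `[0, 1]`. -/
theorem IsCompact.exists_peakPoly_bound {L : Set (ι ⊕ τ → ℂ)} (hL : IsCompact L) :
    ∃ c : ℝ, 0 < c ∧ ∀ w ∈ L, c * ∑ i, ((w (.inl i)).re - a i) ^ 2 ≤ 1 := by
  have hcont : Continuous fun w : ι ⊕ τ → ℂ => ∑ i, ((w (.inl i)).re - a i) ^ 2 := by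
    fun_prop
  obtain ⟨B, hB⟩ := (hL.image hcont).bddAbove
  have hpos : 0 < max B 1 := by positivity
  refine ⟨(max B 1)⁻¹, inv_pos.2 hpos, fun w hw => ?_⟩
  rw [inv_mul_le_one₀ hpos]
  exact (hB ⟨w, hw, rfl⟩).trans (le_max_left _ _)

end peakPoly

/-- If `z` is a point of the hull with `p z = 1`, where `‖p‖ ≤ 1` on `L`, then `‖Q z‖` is bounded
by any `m > 0` such that `‖Q‖ < m` on the part of `L` where `‖p‖ = 1`. -/
theorem norm_eval_le_of_peak {σ : Type*} {L : Set (σ → ℂ)} (hL : IsCompact L) {z : σ → ℂ}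
    (hz : z ∈ polyHull L) (p Q : MvPolynomial σ ℂ) (hpz : MvPolynomial.eval z p = 1)
    (hp : ∀ w ∈ L, ‖MvPolynomial.eval w p‖ ≤ 1) {m : ℝ} (hm : 0 < m)
    (hQ : ∀ w ∈ L, m ≤ ‖MvPolynomial.eval w Q‖ → ‖MvPolynomial.eval w p‖ < 1) :
    ‖MvPolynomial.eval z Q‖ ≤ m := by
  have hcp := (MvPolynomial.continuous_eval p).norm
  have hcQ := (MvPolynomial.continuous_eval Q).norm
  obtain ⟨B, hB⟩ := (hL.image hcQ).bddAbove
  have hS : IsCompact (L ∩ {w | m ≤ ‖MvPolynomial.eval w Q‖}) :=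
    hL.inter_right (isClosed_le continuous_const hcQ)
  obtain ⟨r, hr0, hr1, hr⟩ : ∃ r : ℝ, 0 ≤ r ∧ r < 1 ∧
      ∀ w ∈ L, m ≤ ‖MvPolynomial.eval w Q‖ → ‖MvPolynomial.eval w p‖ ≤ r := by
    rcases (L ∩ {w | m ≤ ‖MvPolynomial.eval w Q‖}).eq_empty_or_nonempty with he | hne
    · refine ⟨0, le_rfl, one_pos, fun w hw hwm => ?_⟩
      exact absurd (show w ∈ L ∩ {w | m ≤ ‖MvPolynomial.eval w Q‖} from ⟨hw, hwm⟩) (by simp [he])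
    · obtain ⟨x, hx, hmax⟩ := hS.exists_isMaxOn hne hcp.continuousOn
      exact ⟨_, norm_nonneg _, hQ x hx.1 hx.2, fun w hw hwm => hmax ⟨hw, hwm⟩⟩
  obtain ⟨n, hn⟩ : ∃ n : ℕ, r ^ n * B ≤ m := by
    have := (tendsto_pow_atTop_nhds_zero_of_lt_one hr0 hr1).mul_const B
    rw [zero_mul] at this
    exact (this.eventually_le_const hm).exists
  have key := norm_eval_le_of_mem_polyHull hz (p ^ n * Q) hm.le fun w hw => by
    rw [map_mul, map_pow, norm_mul, norm_pow]
    rcases le_total m ‖MvPolynomial.eval w Q‖ with h | h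
    · refine le_trans ?_ hn
      gcongr
      · exact hr w hw h
      · exact hB ⟨w, hw, rfl⟩
    · exact (mul_le_of_le_one_left (norm_nonneg _)
        (pow_le_one₀ (norm_nonneg _) (hp w hw))).trans h
  simpa [hpz] using key

/-- **Fiberwise polynomial convexity over a real parameter set.**
Let `K ⊆ ℂ^N × ℂ²` be compact, with all first-factor coordinates real, and suppose every
slice `K_y = {v ∈ ℂ² : (y, v) ∈ K}` over `y ∈ ℝ^N` is polynomially convex in `ℂ²`.
Then `K` is polynomially convex in `ℂ^{N+2}`. -/
theorem polyConvex_of_real_fibers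
    (N : ℕ) (hN : 1 ≤ N) (K : Set ((Fin N → ℂ) × (ℂ × ℂ)))
    (hKc : IsCompact K)
    (hreal : ∀ p ∈ K, ∀ i : Fin N, (p.1 i).im = 0)
    (hslice : ∀ y : Fin N → ℂ,
      IsPolyConvex ((fun v : ℂ × ℂ => ![v.1, v.2]) '' {v : ℂ × ℂ | (y, v) ∈ K})) :
    IsPolyConvex (prodToFun N '' K) := by
  have hL : IsCompact (prodToFun N '' K) := hKc.image (continuous_prodToFun N)
  refine Subset.antisymm (fun z hz => ?_) hL.subset_polyHull
  let a : Fin N → ℝ := fun i => (z (.inl i)).re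
  obtain ⟨c, hc, hcL⟩ := hL.exists_peakPoly_bound a
  have him : ∀ w ∈ prodToFun N '' K, ∀ i, (w (.inl i)).im = 0 := by
    rintro _ ⟨p, hp, rfl⟩ i
    exact hreal p hp i
  have hnorm : ∀ w ∈ prodToFun N '' K, ‖MvPolynomial.eval w (peakPoly (Fin 2) a c)‖ =
      1 - c * ∑ i, ((w (.inl i)).re - a i) ^ 2 := fun w hw => by
    rw [eval_peakPoly_of_im_eq_zero a c w (him w hw), norm_real, Real.norm_of_nonneg]
    linarith [hcL w hw]
  have hle : ∀ w ∈ prodToFun N '' K, ‖MvPolynomial.eval w (peakPoly (Fin 2) a c)‖ ≤ 1 :=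
    fun w hw => by
      rw [hnorm w hw, sub_le_self_iff]
      positivity
  have hpz := eval_peakPoly_of_re_eq a c z fun _ => rfl
  have hzim : c * ∑ i, (z (.inl i)).im ^ 2 = 0 := by
    have h0 : 0 ≤ c * ∑ i, (z (.inl i)).im ^ 2 := by positivity
    have h := norm_eval_le_of_mem_polyHull hz _ zero_le_one hle
    rw [hpz, norm_real, Real.norm_of_nonneg (by linarith)] at h
    linarith
  have hzreal : ∀ i, (z (.inl i)).im = 0 := fun i => by
    have h := (mul_eq_zero.1 hzim).resolve_left hc.ne'
    rw [Finset.sum_eq_zero_iff_of_nonneg fun _ _ => sq_nonneg _] at h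
    exact pow_eq_zero_iff two_ne_zero |>.1 (h i (Finset.mem_univ i))
  rw [hzim, add_zero, ofReal_one] at hpz
  let y : Fin N → ℂ := fun i => z (.inl i)
  suffices hv : (fun j => z (.inr j)) ∈ polyHull
      ((fun v : ℂ × ℂ => ![v.1, v.2]) '' {v : ℂ × ℂ | (y, v) ∈ K}) by
    rw [hslice y] at hv
    obtain ⟨v, hv, hvz⟩ := hv
    refine ⟨(y, v), hv, ?_⟩
    ext (i | j)
    · rfl
    · exact congrFun hvz j
  intro Q
  have hren (w : Fin N ⊕ Fin 2 → ℂ) : MvPolynomial.eval w (MvPolynomial.rename Sum.inr Q) =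
      MvPolynomial.eval (fun j => w (.inr j)) Q := MvPolynomial.eval_rename _ _ _
  have hbdd : BddAbove ((fun w => ‖MvPolynomial.eval w Q‖) ''
      ((fun v : ℂ × ℂ => ![v.1, v.2]) '' {v : ℂ × ℂ | (y, v) ∈ K})) := by
    refine (hL.image
      (MvPolynomial.continuous_eval (MvPolynomial.rename Sum.inr Q)).norm).bddAbove.mono ?_
    rintro _ ⟨_, ⟨v, hv, rfl⟩, rfl⟩
    exact ⟨_, ⟨(y, v), hv, rfl⟩, congrArg norm (hren _)⟩
  refine le_of_forall_gt_imp_ge_of_dense fun m hm => ?_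
  have hm0 : 0 < m := lt_of_le_of_lt
    (Real.sSup_nonneg (by rintro _ ⟨_, _, rfl⟩; exact norm_nonneg _)) hm
  rw [← hren]
  refine norm_eval_le_of_peak hL hz _ _ hpz hle hm0 fun w hw hwm => ?_
  refine (hle w hw).lt_of_ne fun h1 => ?_
  rw [hnorm w hw, sub_eq_self] at h1
  have h := (mul_eq_zero.1 h1).resolve_left hc.ne'
  rw [Finset.sum_eq_zero_iff_of_nonneg fun _ _ => sq_nonneg _] at h
  have hwy : ∀ i, w (.inl i) = y i := fun i => by
    have hi := sub_eq_zero.1 (pow_eq_zero_iff two_ne_zero |>.1 (h i (Finset.mem_univ i)))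
    exact Complex.ext hi ((him w hw i).trans (hzreal i).symm)
  obtain ⟨⟨u, v⟩, hp, rfl⟩ := hw
  obtain rfl : u = y := funext hwy
  rw [hren] at hwm
  exact (hwm.trans (le_csSup hbdd ⟨_, ⟨v, hp, rfl⟩, rfl⟩)).not_gt hm
end
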